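/- Under the Setup, assume f is transcendental. Then: (i) if 0 ≤ m ≤ M+1 and K_m is constant, then f^{(m)} has finitely many zeros; (ii) if 0 ≤ m ≤ M and K_m and K_{m+1} are both non-constant, then N̄(r, 1/f^{(m+1)}) = O(r) as r → ∞; (iii) if 0 ≤ m ≤ M and K_m and K_{m+1} are both non-constant rational functions, then f^{(m+1)} has finitely many zeros; (iv) if 0 ≤ m ≤ M and K_m and K_{m+1} are both rational functions, then f^{(m)} or f^{(m+1)} has finitely many zeros. -/

import Mathlib

open Complex Filter Topology MeasureTheory
open scoped Classical

noncomputable section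

/-- `mtilde f` is the function `z ↦ conj (f (conj z))`, denoted `f̃` in the paper. -/
def mtilde (f : ℂ → ℂ) : ℂ → ℂ := fun z => (starRingEnd ℂ) (f ((starRingEnd ℂ) z))

/-- Equality of meromorphic functions: near every point of `ℂ`, the two functions agree on a
punctured neighbourhood (so the set where they disagree is closed and discrete). -/
def MeroEq (h₁ h₂ : ℂ → ℂ) : Prop := ∀ z : ℂ, ∀ᶠ w in 𝓝[≠] z, h₁ w = h₂ w

/-- `f` is strictly non-real: `f̃` is not a constant multiple of `f`. -/
def StrictlyNonReal (f : ℂ → ℂ) : Prop := ¬ ∃ c : ℂ, MeroEq (mtilde f) (fun z => c * f z)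

/-- A rational function, as a meromorphic function on `ℂ`. -/
def IsRatFn (h : ℂ → ℂ) : Prop :=
  ∃ p q : Polynomial ℂ, q ≠ 0 ∧ MeroEq h (fun z => p.eval z / q.eval z)

/-- The order of vanishing (negative at a pole) of a function at a point, when the function is
meromorphic there; junk value `0` otherwise. -/
def meroOrder (h : ℂ → ℂ) (z : ℂ) : WithTop ℤ :=
  if hh : MeromorphicAt h z then meromorphicOrderAt h z else 0

/-- The positive part of the logarithm. -/
def logPlus (x : ℝ) : ℝ := max (Real.log x) 0

/-- The Nevanlinna proximity function `m(r, h)`. -/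
def proximity (h : ℂ → ℂ) (r : ℝ) : ℝ :=
  (2 * Real.pi)⁻¹ * ∫ θ in (0:ℝ)..(2 * Real.pi),
    logPlus ‖h ((r : ℂ) * Complex.exp (θ * Complex.I))‖

/-- The multiplicity of a pole of `h` at `z` (0 if not a pole). -/
def poleMult (h : ℂ → ℂ) (z : ℂ) : ℕ := (-((meroOrder h z).untopD 0)).toNat

/-- The number of poles, counted with multiplicity, in the closed disc of radius `t`. -/
def poleCount (h : ℂ → ℂ) (t : ℝ) : ℝ := ∑ᶠ z ∈ Metric.closedBall (0:ℂ) t, (poleMult h z : ℝ)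

/-- The integrated counting function `N(r, h)` of the poles of `h` (with multiplicity). -/
def NCount (h : ℂ → ℂ) (r : ℝ) : ℝ := ∫ t in (1:ℝ)..r, poleCount h t / t

/-- The Nevanlinna characteristic `T(r, h) = m(r, h) + N(r, h)`. -/
def TChar (h : ℂ → ℂ) (r : ℝ) : ℝ := proximity h r + NCount h r

/-- The number of points of `S` in the closed disc of radius `t`. -/
def distinctCount (S : Set ℂ) (t : ℝ) : ℝ := (S ∩ Metric.closedBall (0:ℂ) t).ncard

/-- The integrated counting function `N̄(r, h)` of the distinct poles of `h`. -/
def NbarPoles (h : ℂ → ℂ) (r : ℝ) : ℝ :=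
  ∫ t in (1:ℝ)..r, distinctCount {z | meroOrder h z < 0} t / t

/-- The integrated counting function `N̄(r, 1/h)` of the distinct zeros of `h`. -/
def NbarZeros (h : ℂ → ℂ) (r : ℝ) : ℝ :=
  ∫ t in (1:ℝ)..r, distinctCount {z | 0 < meroOrder h z} t / t

/-- `h` has finite (Nevanlinna) order: `T(r, h) ≤ r ^ C` for all large `r`. -/
def FiniteOrder (h : ℂ → ℂ) : Prop := ∃ C : ℝ, ∀ᶠ r in atTop, TChar h r ≤ r ^ C

/-- `h` has finite lower order: `T(r, h) ≤ r ^ C` for arbitrarily large `r`. -/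
def FiniteLowerOrder (h : ℂ → ℂ) : Prop := ∃ C : ℝ, ∃ᶠ r in atTop, TChar h r ≤ r ^ C

/-- The Setup of Section 3 of the paper: `M ≥ 4` and `f` is a strictly non-real meromorphic
function in the plane such that `f, f', …, f^(M+3)` all have finitely many non-real zeros. -/
def Setup (M : ℕ) (f : ℂ → ℂ) : Prop :=
  4 ≤ M ∧ (∀ z, MeromorphicAt f z) ∧ StrictlyNonReal f ∧
    ∀ m, m ≤ M + 3 → {z : ℂ | 0 < meroOrder (iteratedDeriv m f) z ∧ z.im ≠ 0}.Finite

/-- The function `F_m(z) = z - f^(m)(z) / f^(m+1)(z)`. -/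
def Fm (f : ℂ → ℂ) (m : ℕ) : ℂ → ℂ :=
  fun z => z - iteratedDeriv m f z / iteratedDeriv (m + 1) f z

/-- `Km` is the meromorphic function with finitely many zeros and poles satisfying
`F_m' = K_m G_m'`, where `G_m` is the analogue of `F_m` for `g = f̃`. -/
def IsKm (f : ℂ → ℂ) (m : ℕ) (Km : ℂ → ℂ) : Prop :=
  (∀ z, MeromorphicAt Km z) ∧ {z | 0 < meroOrder Km z}.Finite ∧
    {z | meroOrder Km z < 0}.Finite ∧
    MeroEq (deriv (Fm f m)) (fun z => Km z * deriv (Fm (mtilde f) m) z)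

end

/-! ### The purely algebraic step -/

/-- Algebraic elimination in a differential field. -/
theorem alg_step {K : Type*} [Field K] [CharZero K] (d : K → K)
    (dadd : ∀ a b, d (a + b) = d a + d b) (dmul : ∀ a b, d (a * b) = d a * b + a * d b)
    (S : Subfield K) (hd : ∀ a ∈ S, d a ∈ S) (hc : ∀ a, d a = 0 → a ∈ S)
    (f0 f1 f2 f3 : K) (n0 : f0 ≠ 0) (n1 : f1 ≠ 0) (n2 : f2 ≠ 0) (n3 : f3 ≠ 0)
    (e0 : d f0 = f1) (e1 : d f1 = f2) (e2 : d f2 = f3)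
    (h0 : d (f0 * f2 / f1 ^ 2) / (f0 * f2 / f1 ^ 2) ∈ S)
    (h1 : d (f1 * f3 / f2 ^ 2) / (f1 * f3 / f2 ^ 2) ∈ S) :
    f0 * f2 / f1 ^ 2 ∈ S ∧ f1 * f3 / f2 ^ 2 ∈ S := by
  have done : d 1 = 0 := by
    have := dmul 1 1
    simp at this; exact this
  have dzero : d 0 = 0 := by
    have := dadd 0 0
    simp at this; exact this
  have dneg : ∀ a, d (-a) = - d a := by
    intro a
    have := dadd a (-a)
    rw [add_neg_cancel, dzero] at this
    linear_combination -this
  have dsub : ∀ a b, d (a - b) = d a - d b := by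
    intro a b; rw [sub_eq_add_neg, dadd, dneg]; ring
  have ddiv : ∀ a b, b ≠ 0 → d (a / b) = (d a * b - a * d b) / b ^ 2 := by
    intro a b hb
    have := dmul (a / b) b
    rw [div_mul_cancel₀ _ hb] at this
    rw [this]; field_simp; ring
  have dtwo : d 2 = 0 := by
    have := dadd 1 1
    rw [done] at this; norm_num at this; exact this
  set p := f0 * f2 / f1 ^ 2 with hp
  set q := f1 * f3 / f2 ^ 2 with hq
  have np : p ≠ 0 := by rw [hp]; positivity
  have nq : q ≠ 0 := by rw [hq]; positivity
  set u := d p / p with hu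
  set v := d q / q with hv
  have dp : d p = p * u := by rw [hu]; field_simp
  have dq : d q = q * v := by rw [hv]; field_simp
  have hP : d (f0 / f1) = 1 - p := by
    rw [ddiv _ _ n1, e0, e1, hp]; field_simp
  have key : u * (f0 / f1) = 1 - 2 * p + p * q := by
    rw [hu, hp, ddiv _ _ (by positivity), dmul, sq, dmul, e0, e1, e2, hq]
    field_simp; ring
  -- relation
  have rel : (d u + u ^ 2) + (-2 * d u + u ^ 2) * p + (d u - u ^ 2 - u * v) * (p * q) = 0 := by
    have h := congrArg d key
    rw [dmul, hP, dadd, dsub, done, dmul, dmul, dp, dq, dtwo] at h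
    have h2 : d u * (u * (f0 / f1)) + u * (u * (1 - p)) =
      u * (0 - (0 * p + 2 * (p * u)) + (p * u * q + p * (q * v))) := by
      rw [← h]; ring
    rw [key] at h2
    linear_combination h2
  have huS : u ∈ S := h0
  have hvS : v ∈ S := h1
  have mem2 : (2 : K) ∈ S := by
    have := S.add_mem S.one_mem S.one_mem
    rwa [one_add_one_eq_two] at this
  clear_value u v p q
  by_cases u0 : u = 0
  · have hpS : p ∈ S := hc _ (by rw [dp, u0, mul_zero])
    refine ⟨hpS, ?_⟩
    have : q = (2 * p - 1) / p := by
      rw [u0] at key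
      field_simp
      linear_combination -key
    rw [this]
    exact S.div_mem (S.sub_mem (S.mul_mem mem2 hpS) S.one_mem) hpS
  set α := d u + u ^ 2 with hα
  set β := -2 * d u + u ^ 2 with hβ
  set γ := d u - u ^ 2 - u * v with hγ
  have hαS : α ∈ S := S.add_mem (hd _ huS) (S.pow_mem huS 2)
  have hβS : β ∈ S := S.add_mem (S.mul_mem (S.neg_mem mem2) (hd _ huS)) (S.pow_mem huS 2)
  have hγS : γ ∈ S := S.sub_mem (S.sub_mem (hd _ huS) (S.pow_mem huS 2)) (S.mul_mem huS hvS)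
  clear_value α β γ
  have hpS : p ∈ S := by
    by_cases g0 : γ = 0
    · rw [g0] at rel
      by_cases b0 : β = 0
      · exfalso
        rw [b0] at rel
        have ha : α = 0 := by linear_combination rel
        have : 3 * u ^ 2 = 0 := by
          linear_combination 2 * ha + b0 - 2 * hα - hβ
        simp at this; exact u0 this
      · have : p = -α / β := by field_simp; linear_combination rel
        rw [this]; exact S.div_mem (S.neg_mem hαS) hβS
    · set τ := d γ + γ * u + γ * v with hτ
      have hτS : τ ∈ S := S.add_mem (S.add_mem (hd _ hγS) (S.mul_mem hγS huS)) (S.mul_mem hγS hvS)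
      have rel2 : (α * τ - γ * d α) + p * (β * τ - γ * d β - γ * β * u) = 0 := by
        have h := congrArg d rel
        rw [dzero, dadd, dadd, dmul, dmul, dmul, dp, dq] at h
        linear_combination τ * rel - γ * h + (-γ*(p*q))*hτ
      by_cases B0 : β * τ - γ * d β - γ * β * u = 0
      · rw [B0] at rel2
        by_cases a0 : α = 0
        · have h : d (p * u) = 0 := by
            rw [dmul, dp]; linear_combination p * a0 - p * hα
          have h := hc _ h
          have : p = p * u / u := by field_simp
          rw [this]; exact S.div_mem h huS
        by_cases b0 : β = 0
        · have h : d (p / u ^ 2) = 0 := by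
            rw [ddiv _ _ (by positivity), dp, sq, dmul]
            field_simp
            linear_combination p * (b0 - hβ)
          have h := hc _ h
          have : p = p / u ^ 2 * u ^ 2 := by field_simp
          rw [this]; exact S.mul_mem h (S.pow_mem huS 2)
        · have h : d (p * β / α) = 0 := by
            rw [ddiv _ _ a0, dmul, dp]
            have : (p * u * β + p * d β) * α - p * β * d α = 0 := by
              have : γ * ((p * u * β + p * d β) * α - p * β * d α) = 0 := by
                linear_combination p * β * rel2 - p * α * B0
              simpa [g0] using this
            rw [this]; simp
          have h := hc _ h
          have : p = p * β / α * α / β := by field_simp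
          rw [this]; exact S.div_mem (S.mul_mem h hαS) hβS
      · have : p = -(α * τ - γ * d α) / (β * τ - γ * d β - γ * β * u) := by
          rw [eq_div_iff B0]; linear_combination rel2
        rw [this]
        refine S.div_mem (S.neg_mem (S.sub_mem (S.mul_mem hαS hτS) (S.mul_mem hγS (hd _ hαS)))) ?_
        exact S.sub_mem (S.sub_mem (S.mul_mem hβS hτS) (S.mul_mem hγS (hd _ hβS)))
          (S.mul_mem (S.mul_mem hγS hβS) huS)
  refine ⟨hpS, ?_⟩
  by_cases g0 : γ = 0
  · have h : d (p * q / u) = 0 := by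
      rw [ddiv _ _ u0, dmul, dp, dq]
      field_simp
      linear_combination p * q * (-g0 + hγ)
    have h := hc _ h
    have : q = p * q / u * u / p := by field_simp
    rw [this]; exact S.div_mem (S.mul_mem h huS) hpS
  · have : q = -(α + β * p) / (γ * p) := by field_simp; linear_combination rel
    rw [this]
    exact S.div_mem (S.neg_mem (S.add_mem hαS (S.mul_mem hβS hpS))) (S.mul_mem hγS hpS)

/-! ### The field of meromorphic germs at `0` -/

/-- The ring of germs at `0` of functions meromorphic at `0`. -/
def MG : Subring (Germ (𝓝[≠] (0 : ℂ)) ℂ) where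
  carrier := {x | ∃ f : ℂ → ℂ, MeromorphicAt f 0 ∧ (f : Germ (𝓝[≠] (0 : ℂ)) ℂ) = x}
  mul_mem' := by
    rintro _ _ ⟨f, hf, rfl⟩ ⟨g, hg, rfl⟩
    exact ⟨f * g, hf.mul hg, rfl⟩
  one_mem' := ⟨fun _ => 1, MeromorphicAt.const 1 0, rfl⟩
  add_mem' := by
    rintro _ _ ⟨f, hf, rfl⟩ ⟨g, hg, rfl⟩
    exact ⟨f + g, hf.add hg, rfl⟩
  zero_mem' := ⟨fun _ => 0, MeromorphicAt.const 0 0, rfl⟩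
  neg_mem' := by
    rintro _ ⟨f, hf, rfl⟩
    exact ⟨-f, hf.neg, rfl⟩

/-- The germ of a function. -/
noncomputable def gm (f : ℂ → ℂ) (hf : MeromorphicAt f 0) : MG := ⟨(f : Germ _ _), f, hf, rfl⟩

theorem gm_eq {f g : ℂ → ℂ} {hf : MeromorphicAt f 0} {hg : MeromorphicAt g 0} :
    gm f hf = gm g hg ↔ f =ᶠ[𝓝[≠] 0] g := by
  constructor
  · intro h
    exact Germ.coe_eq.1 (congrArg Subtype.val h)
  · intro h
    exact Subtype.ext (Germ.coe_eq.2 h)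

theorem gm_surj (x : MG) : ∃ f, ∃ hf : MeromorphicAt f 0, x = gm f hf := by
  obtain ⟨x, f, hf, rfl⟩ := x
  exact ⟨f, hf, rfl⟩

theorem gm_mul {f g : ℂ → ℂ} (hf : MeromorphicAt f 0) (hg : MeromorphicAt g 0) :
    gm f hf * gm g hg = gm (fun z => f z * g z) (hf.mul hg) := rfl
theorem gm_add {f g : ℂ → ℂ} (hf : MeromorphicAt f 0) (hg : MeromorphicAt g 0) :
    gm f hf + gm g hg = gm (fun z => f z + g z) (hf.add hg) := rfl
theorem gm_neg {f : ℂ → ℂ} (hf : MeromorphicAt f 0) :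
    - gm f hf = gm (fun z => - f z) hf.neg := rfl
theorem gm_zero : (0 : MG) = gm (fun _ => 0) (MeromorphicAt.const 0 0) := rfl
theorem gm_one : (1 : MG) = gm (fun _ => 1) (MeromorphicAt.const 1 0) := rfl

noncomputable instance : Field MG :=
  { (inferInstance : CommRing MG) with
    inv := fun x => ⟨x.1⁻¹, by
      obtain ⟨x, f, hf, rfl⟩ := x
      exact ⟨f⁻¹, hf.inv, rfl⟩⟩
    exists_pair_ne := ⟨0, 1, by
      rw [gm_zero, gm_one, Ne, gm_eq]
      intro h
      have := h.exists
      simp at this⟩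
    mul_inv_cancel := by
      intro x hx
      obtain ⟨f, hf, rfl⟩ := gm_surj x
      rw [gm_zero, Ne, gm_eq] at hx
      have h2 : ∀ᶠ z in 𝓝[≠] (0:ℂ), f z ≠ 0 :=
        (hf.eventually_eq_zero_or_eventually_ne_zero).resolve_left hx
      have : gm (fun z => f z * (f z)⁻¹) (hf.mul hf.inv) = gm (fun _ => 1) (MeromorphicAt.const 1 0) := by
        rw [gm_eq]
        filter_upwards [h2] with z hz
        field_simp
      exact this
    inv_zero := by
      have : gm (fun z => (0:ℂ)⁻¹) (MeromorphicAt.const (0⁻¹) 0) = gm (fun _ => 0) (MeromorphicAt.const 0 0) := by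
        rw [gm_eq]; simp [EventuallyEq]
      exact this
    nnqsmul := _
    qsmul := _ }

theorem gm_inv {f : ℂ → ℂ} (hf : MeromorphicAt f 0) :
    (gm f hf)⁻¹ = gm (fun z => (f z)⁻¹) hf.inv := rfl
theorem gm_div {f g : ℂ → ℂ} (hf : MeromorphicAt f 0) (hg : MeromorphicAt g 0) :
    gm f hf / gm g hg = gm (fun z => f z / g z) (hf.div hg) := by
  rw [div_eq_mul_inv, gm_inv, gm_mul, gm_eq]
  simp [div_eq_mul_inv, EventuallyEq]
theorem gm_pow {f : ℂ → ℂ} (hf : MeromorphicAt f 0) (n : ℕ) :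
    gm f hf ^ n = gm (fun z => f z ^ n) (hf.pow n) := by
  induction n with
  | zero => simp [gm_one]
  | succ n ih => rw [pow_succ, ih, gm_mul, gm_eq]; simp [pow_succ, EventuallyEq]

theorem gm_ne_zero {f : ℂ → ℂ} {hf : MeromorphicAt f 0} :
    gm f hf ≠ 0 ↔ ∀ᶠ z in 𝓝[≠] (0:ℂ), f z ≠ 0 := by
  rw [gm_zero, Ne, gm_eq]
  constructor
  · intro h
    exact (hf.eventually_eq_zero_or_eventually_ne_zero).resolve_left h
  · intro h h2
    obtain ⟨z, h1, h2⟩ := (h.and h2).exists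
    exact h1 h2

instance : CharZero MG := by
  have hc : ∀ n : ℕ, (n : MG) = gm (fun _ => (n : ℂ)) (MeromorphicAt.const _ _) := by
    intro n
    induction n with
    | zero => simp [gm_zero]
    | succ n ih => push_cast; rw [ih, gm_one, gm_add]
  refine ⟨fun a b h => ?_⟩
  rw [hc, hc, gm_eq] at h
  obtain ⟨z, hz⟩ := h.exists
  simpa using hz

/-- `1 / cinv'`, where `cinv` is the inverse Cayley map. -/
noncomputable def kap (z : ℂ) : ℂ := (1 - z) ^ 2 / (2 * I)

theorem kap_analytic (z : ℂ) : AnalyticAt ℂ kap z := by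
  unfold kap; fun_prop (disch := simp)

/-- The derivation `kap * d/dz` on germs. -/
noncomputable def dd (x : MG) : MG :=
  gm (fun z => kap z * deriv (gm_surj x).choose z)
    ((kap_analytic 0).meromorphicAt.mul (gm_surj x).choose_spec.choose.deriv)

theorem dd_gm {f : ℂ → ℂ} (hf : MeromorphicAt f 0) :
    dd (gm f hf) = gm (fun z => kap z * deriv f z) ((kap_analytic 0).meromorphicAt.mul hf.deriv) := by
  unfold dd
  rw [gm_eq]
  have h := (gm_surj (gm f hf)).choose_spec.choose_spec
  rw [gm_eq] at h
  have h2 := h.nhdsNE_deriv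
  filter_upwards [h2] with z hz
  rw [hz]

theorem ev_diff {f : ℂ → ℂ} {a : ℂ} (hf : MeromorphicAt f a) :
    ∀ᶠ z in 𝓝[≠] a, DifferentiableAt ℂ f z := by
  filter_upwards [hf.eventually_analyticAt] with z hz using hz.differentiableAt

theorem dd_add (x y : MG) : dd (x + y) = dd x + dd y := by
  obtain ⟨f, hf, rfl⟩ := gm_surj x
  obtain ⟨g, hg, rfl⟩ := gm_surj y
  rw [gm_add, dd_gm, dd_gm, dd_gm, gm_add, gm_eq]
  filter_upwards [ev_diff hf, ev_diff hg] with z h1 h2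
  rw [deriv_fun_add h1 h2, mul_add]

theorem dd_mul (x y : MG) : dd (x * y) = dd x * y + x * dd y := by
  obtain ⟨f, hf, rfl⟩ := gm_surj x
  obtain ⟨g, hg, rfl⟩ := gm_surj y
  rw [gm_mul, dd_gm, dd_gm, dd_gm, gm_mul, gm_mul, gm_add, gm_eq]
  filter_upwards [ev_diff hf, ev_diff hg] with z h1 h2
  rw [deriv_fun_mul h1 h2]; ring

/-- A meromorphic germ with zero derivative is constant. -/
theorem const_of_deriv_zero {f : ℂ → ℂ} {a : ℂ} (hf : MeromorphicAt f a)
    (h : ∀ᶠ z in 𝓝[≠] a, deriv f z = 0) : ∃ c, ∀ᶠ z in 𝓝[≠] a, f z = c := by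
  by_cases htop : meromorphicOrderAt f a = ⊤
  · exact ⟨0, meromorphicOrderAt_eq_top_iff.1 htop⟩
  obtain ⟨n, hn⟩ := WithTop.ne_top_iff_exists.1 htop
  by_cases h0 : n = 0
  · subst h0
    obtain ⟨g, hg, -, hfg⟩ := (meromorphicOrderAt_eq_int_iff hf).1 hn.symm
    have hfg' : f =ᶠ[𝓝[≠] a] g := by
      filter_upwards [hfg] with z hz; simpa using hz
    have hd : ∀ᶠ z in 𝓝[≠] a, deriv g z = 0 := by
      filter_upwards [hfg'.nhdsNE_deriv, h] with z h1 h2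
      rw [← h1, h2]
    have hd2 : ∀ᶠ z in 𝓝 a, deriv g z = 0 :=
      hg.deriv.frequently_zero_iff_eventually_zero.1 hd.frequently
    obtain ⟨ε, hε, h1⟩ := Metric.eventually_nhds_iff_ball.1 (hd2.and hg.eventually_analyticAt)
    refine ⟨g a, ?_⟩
    filter_upwards [hfg', nhdsWithin_le_nhds (Metric.ball_mem_nhds a hε)] with z hz hz2
    rw [hz]
    exact Metric.isOpen_ball.is_const_of_deriv_eq_zero (convex_ball a ε).isPreconnected
      (fun w hw => (h1 w hw).2.differentiableAt.differentiableWithinAt) (fun w hw => (h1 w hw).1)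
      hz2 (Metric.mem_ball_self hε)
  · exfalso
    have := meromorphicOrderAt_deriv_eq_sub_one (n := n) (by exact_mod_cast h0) hn.symm
    rw [meromorphicOrderAt_eq_top_iff.2 h] at this
    exact WithTop.coe_ne_top this.symm

theorem dd_zero_const (x : MG) (h : dd x = 0) :
    ∃ c : ℂ, x = gm (fun _ => c) (MeromorphicAt.const c 0) := by
  obtain ⟨f, hf, rfl⟩ := gm_surj x
  rw [dd_gm, gm_zero, gm_eq] at h
  have hk : ∀ᶠ z in 𝓝[≠] (0:ℂ), kap z ≠ 0 := by
    apply Filter.Eventually.filter_mono nhdsWithin_le_nhds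
    apply (kap_analytic 0).continuousAt.eventually_ne
    simp [kap]
  obtain ⟨c, hc⟩ := const_of_deriv_zero hf (by
    filter_upwards [h, hk] with z hz hz2
    simpa [hz2] using hz)
  exact ⟨c, gm_eq.2 hc⟩

/-! ### Slowly growing functions on the disc -/

/-- Functions on the unit disc of growth controlled by `A`. -/
def Slow (A : ℝ → ℝ) (u : ℂ → ℂ) : Prop :=
  DifferentiableOn ℂ u (Metric.ball 0 1) ∧ ∃ n : ℕ, ∃ C : ℝ, 0 ≤ C ∧
    ∀ ρ r : ℝ, 0 ≤ ρ → ρ < r → r < 1 → ∀ ζ : ℂ, ‖ζ‖ ≤ ρ →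
      ‖u ζ‖ ≤ C * ((1 + A r) / (r - ρ)) ^ n

theorem Slow.mer {A : ℝ → ℝ} {u : ℂ → ℂ} (h : Slow A u) : MeromorphicAt u 0 := by
  have : AnalyticAt ℂ u 0 := h.1.analyticAt (Metric.ball_mem_nhds 0 one_pos)
  exact this.meromorphicAt

theorem slow_base {A : ℝ → ℝ} (hA : ∀ r, 0 ≤ A r) {ρ r : ℝ} (h0 : 0 ≤ ρ) (h1 : ρ < r)
    (h2 : r < 1) : 1 ≤ (1 + A r) / (r - ρ) := by
  rw [le_div_iff₀ (by linarith)]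
  have := hA r
  linarith

theorem slow_bdd {A : ℝ → ℝ} {u : ℂ → ℂ} (hu : DifferentiableOn ℂ u (Metric.ball 0 1))
    {C : ℝ} (h : ∀ ζ, ‖ζ‖ < 1 → ‖u ζ‖ ≤ C) : Slow A u := by
  refine ⟨hu, 0, C, (norm_nonneg _).trans (h 0 (by simp)), ?_⟩
  intro ρ r h0 h1 h2 ζ hζ
  simpa using h ζ (by linarith)

theorem Slow.add {A : ℝ → ℝ} (hA : ∀ r, 0 ≤ A r) {u v : ℂ → ℂ} (hu : Slow A u) (hv : Slow A v) :
    Slow A (fun z => u z + v z) := by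
  obtain ⟨hu, n, C, hC, hu2⟩ := hu
  obtain ⟨hv, k, D, hD, hv2⟩ := hv
  refine ⟨hu.add hv, n + k, C + D, by positivity, ?_⟩
  intro ρ r h0 h1 h2 ζ hζ
  have hb := slow_base hA h0 h1 h2
  have e1 := hu2 ρ r h0 h1 h2 ζ hζ
  have e2 := hv2 ρ r h0 h1 h2 ζ hζ
  set X := (1 + A r) / (r - ρ)
  calc ‖u ζ + v ζ‖ ≤ ‖u ζ‖ + ‖v ζ‖ := norm_add_le _ _
    _ ≤ C * X ^ n + D * X ^ k := by linarith
    _ ≤ C * X ^ (n + k) + D * X ^ (n + k) := by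
      gcongr <;> first | assumption | omega
    _ = _ := by ring

theorem Slow.mul {A : ℝ → ℝ} (hA : ∀ r, 0 ≤ A r) {u v : ℂ → ℂ} (hu : Slow A u) (hv : Slow A v) :
    Slow A (fun z => u z * v z) := by
  obtain ⟨hu, n, C, hC, hu2⟩ := hu
  obtain ⟨hv, k, D, hD, hv2⟩ := hv
  refine ⟨hu.mul hv, n + k, C * D, by positivity, ?_⟩
  intro ρ r h0 h1 h2 ζ hζ
  have hb := slow_base hA h0 h1 h2
  have e1 := hu2 ρ r h0 h1 h2 ζ hζ
  have e2 := hv2 ρ r h0 h1 h2 ζ hζ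
  set X := (1 + A r) / (r - ρ)
  calc ‖u ζ * v ζ‖ = ‖u ζ‖ * ‖v ζ‖ := norm_mul _ _
    _ ≤ (C * X ^ n) * (D * X ^ k) := by gcongr
    _ = _ := by rw [pow_add]; ring

theorem slow_const {A : ℝ → ℝ} (c : ℂ) : Slow A (fun _ => c) :=
  slow_bdd (differentiableOn_const c) (C := ‖c‖) (fun _ _ => le_rfl)

theorem Slow.neg {A : ℝ → ℝ} {u : ℂ → ℂ} (hu : Slow A u) : Slow A (fun z => - u z) := by
  obtain ⟨hu, n, C, hC, hu2⟩ := hu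
  exact ⟨hu.neg, n, C, hC, by simpa using hu2⟩

theorem Slow.deriv {A : ℝ → ℝ} (hA : ∀ r, 0 ≤ A r) {u : ℂ → ℂ} (hu : Slow A u) :
    Slow A (deriv u) := by
  obtain ⟨hu, n, C, hC, hu2⟩ := hu
  refine ⟨hu.deriv Metric.isOpen_ball, n + 1, C * 2 ^ (n + 1), by positivity, ?_⟩
  intro ρ r h0 h1 h2 ζ hζ
  have hb := slow_base hA h0 h1 h2
  have hδ : 0 < (r - ρ) / 2 := by linarith
  have hdist : Metric.closedBall ζ ((r - ρ) / 2) ⊆ Metric.ball 0 1 := by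
    intro w hw
    rw [Metric.mem_closedBall, dist_eq_norm] at hw
    rw [mem_ball_zero_iff]
    have := norm_le_norm_add_norm_sub' w ζ
    linarith
  have hdc : DiffContOnCl ℂ u (Metric.ball ζ ((r - ρ) / 2)) :=
    (hu.mono hdist).diffContOnCl_ball (subset_refl _)
  have := Complex.norm_deriv_le_of_forall_mem_sphere_norm_le hδ hdc
    (C := C * ((1 + A r) / (r - (ρ + r) / 2)) ^ n) (by
      intro w hw
      apply hu2 _ _ (by linarith) (by linarith) h2
      rw [mem_sphere_iff_norm] at hw
      have := norm_le_norm_add_norm_sub' w ζ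
      linarith)
  refine this.trans ?_
  have hX : (1 + A r) / (r - (ρ + r) / 2) = 2 * ((1 + A r) / (r - ρ)) := by
    have : r - ρ ≠ 0 := by linarith
    have : r - (ρ + r) / 2 = (r - ρ) / 2 := by ring
    rw [this]; field_simp
  rw [hX]
  have h3 : 1 / ((r - ρ) / 2) ≤ 2 * ((1 + A r) / (r - ρ)) := by
    have h4 : 0 < r - ρ := by linarith
    have : 1 / ((r - ρ) / 2) = 2 * (1 / (r - ρ)) := by field_simp
    rw [this]
    have := hA r
    gcongr; linarith
  set X := (1 + A r) / (r - ρ)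
  calc C * (2 * X) ^ n / ((r - ρ) / 2) = C * (2 * X) ^ n * (1 / ((r - ρ) / 2)) := by ring
    _ ≤ C * (2 * X) ^ n * (2 * X) := by gcongr
    _ = _ := by ring

/-- The subfield of germs of quotients of slowly growing functions. -/
noncomputable def SF (A : ℝ → ℝ) (hA : ∀ r, 0 ≤ A r) : Subfield MG where
  carrier := {x | ∃ N D, ∃ hN : Slow A N, ∃ hD : Slow A D, gm D hD.mer ≠ 0 ∧
    x = gm N hN.mer / gm D hD.mer}
  mul_mem' := by
    rintro _ _ ⟨N, D, hN, hD, h0, rfl⟩ ⟨N', D', hN', hD', h0', rfl⟩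
    refine ⟨_, _, hN.mul hA hN', hD.mul hA hD', ?_, ?_⟩
    · rw [← gm_mul hD.mer hD'.mer]; exact mul_ne_zero h0 h0'
    · rw [← gm_mul hD.mer hD'.mer, ← gm_mul hN.mer hN'.mer]; exact div_mul_div_comm _ _ _ _
  one_mem' := by
    refine ⟨fun _ => 1, fun _ => 1, slow_const 1, slow_const 1, ?_, ?_⟩
    · rw [← gm_one]; exact one_ne_zero
    · rw [← gm_one]; simp
  add_mem' := by
    rintro _ _ ⟨N, D, hN, hD, h0, rfl⟩ ⟨N', D', hN', hD', h0', rfl⟩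
    refine ⟨_, _, (hN.mul hA hD').add hA (hD.mul hA hN'), hD.mul hA hD', ?_, ?_⟩
    · rw [← gm_mul hD.mer hD'.mer]; exact mul_ne_zero h0 h0'
    · rw [← gm_mul hD.mer hD'.mer]
      change _ = (gm N hN.mer * gm D' hD'.mer + gm D hD.mer * gm N' hN'.mer) / _
      exact div_add_div _ _ h0 h0'
  zero_mem' := by
    refine ⟨fun _ => 0, fun _ => 1, slow_const 0, slow_const 1, ?_, ?_⟩
    · rw [← gm_one]; exact one_ne_zero
    · rw [← gm_zero]; simp
  neg_mem' := by
    rintro _ ⟨N, D, hN, hD, h0, rfl⟩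
    refine ⟨_, _, hN.neg, hD, h0, ?_⟩
    rw [← gm_neg hN.mer]; exact (neg_div _ _).symm
  inv_mem' := by
    rintro _ ⟨N, D, hN, hD, h0, rfl⟩
    by_cases h : gm N hN.mer = 0
    · refine ⟨fun _ => 0, fun _ => 1, slow_const 0, slow_const 1, ?_, ?_⟩
      · rw [← gm_one]; exact one_ne_zero
      · rw [← gm_zero, h]; simp
    · exact ⟨D, N, hD, hN, h, by rw [inv_div]⟩

theorem mem_SF {A : ℝ → ℝ} {hA : ∀ r, 0 ≤ A r} {x : MG} : x ∈ SF A hA ↔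
    ∃ N D, ∃ hN : Slow A N, ∃ hD : Slow A D, gm D hD.mer ≠ 0 ∧
    x = gm N hN.mer / gm D hD.mer := Iff.rfl

theorem slow_mem {A : ℝ → ℝ} {hA : ∀ r, 0 ≤ A r} {u : ℂ → ℂ} (hu : Slow A u)
    {hm : MeromorphicAt u 0} : gm u hm ∈ SF A hA := by
  refine ⟨u, fun _ => 1, hu, slow_const 1, ?_, ?_⟩
  · rw [← gm_one]; exact one_ne_zero
  · rw [← gm_one, div_one]

theorem dd_div (x y : MG) (hy : y ≠ 0) : dd (x / y) = (dd x * y - x * dd y) / y ^ 2 := by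
  have := dd_mul (x / y) y
  rw [div_mul_cancel₀ _ hy] at this
  rw [this]; field_simp; ring

theorem SF_dd {A : ℝ → ℝ} {hA : ∀ r, 0 ≤ A r} {x : MG} (hx : x ∈ SF A hA) : dd x ∈ SF A hA := by
  obtain ⟨N, D, hN, hD, h0, rfl⟩ := hx
  have hkap : Slow A kap := by
    refine slow_bdd (fun z _ => (kap_analytic z).differentiableAt.differentiableWithinAt) (C := 2) ?_
    intro ζ hζ
    unfold kap
    rw [norm_div, norm_pow]
    have : ‖1 - ζ‖ ≤ 2 := (norm_sub_le _ _).trans (by simp; linarith)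
    have h2 : ‖1 - ζ‖ ^ 2 ≤ 2 ^ 2 := by gcongr
    simp; linarith
  have key : ∀ u (hu : Slow A u), dd (gm u hu.mer) ∈ SF A hA := by
    intro u hu
    rw [dd_gm]
    exact slow_mem (hkap.mul hA (hu.deriv hA))
  rw [dd_div _ _ h0]
  exact div_mem (sub_mem (mul_mem (key N hN) (slow_mem hD)) (mul_mem (slow_mem hN) (key D hD)))
    (pow_mem (slow_mem hD) 2)

theorem SF_const {A : ℝ → ℝ} {hA : ∀ r, 0 ≤ A r} {x : MG} (hx : dd x = 0) : x ∈ SF A hA := by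
  obtain ⟨c, rfl⟩ := dd_zero_const x hx
  exact slow_mem (slow_const c)

/-- Mean of `|Re s|` on the circle of radius `r`. -/
noncomputable def cav (s : ℂ → ℂ) (r : ℝ) : ℝ := Real.circleAverage (fun z => |(s z).re|) 0 r

theorem cav_nonneg (s : ℂ → ℂ) (r : ℝ) : 0 ≤ cav s r :=
  Real.circleAverage_nonneg_of_nonneg (fun _ _ => abs_nonneg _)

theorem poisson_bound {s : ℂ → ℂ} (hs : DifferentiableOn ℂ s (Metric.ball 0 1)) {r : ℝ} {ζ : ℂ}
    (h1 : ‖ζ‖ < r) (h2 : r < 1) :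
    |(s ζ).re| ≤ (r + ‖ζ‖) / (r - ‖ζ‖) * cav s r := by
  have hr : 0 < r := (norm_nonneg _).trans_lt h1
  have hsub : Metric.closedBall (0:ℂ) r ⊆ Metric.ball 0 1 := Metric.closedBall_subset_ball h2
  have hd : DiffContOnCl ℂ s (Metric.ball 0 r) := (hs.mono hsub).diffContOnCl_ball le_rfl
  have hw : ζ ∈ Metric.ball (0:ℂ) r := by simpa using h1
  have hP := hd.circleAverage_re_herglotzRieszKernel_smul hw
  have hsph : Metric.sphere (0:ℂ) |r| ⊆ Metric.ball 0 1 := by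
    rw [abs_of_pos hr]; exact Metric.sphere_subset_closedBall.trans hsub
  have hsc : ContinuousOn s (Metric.sphere (0:ℂ) |r|) := hs.continuousOn.mono hsph
  have hkc : ContinuousOn (fun z => (herglotzRieszKernel 0 ζ z).re) (Metric.sphere (0:ℂ) |r|) :=
    Complex.continuous_re.comp_continuousOn (continuousOn_herglotzRieszKernel_sphere hw)
  have hci : CircleIntegrable ((re ∘ herglotzRieszKernel 0 ζ) • s) 0 r := by
    apply ContinuousOn.circleIntegrable'
    exact hkc.smul hsc
  have h3 := Complex.reCLM.circleAverage_comp_comm hci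
  rw [hP] at h3
  have hsr : ContinuousOn (fun z => (s z).re) (Metric.sphere (0:ℂ) |r|) :=
    Complex.continuous_re.comp_continuousOn hsc
  have h4 : (s ζ).re = Real.circleAverage
      (fun z => (herglotzRieszKernel 0 ζ z).re * (s z).re) 0 r := by
    rw [← Complex.reCLM_apply, ← h3]
    congr 1
    funext z
    simp
  rw [h4]
  refine Real.abs_circleAverage_le_circleAverage_abs.trans ?_
  unfold cav
  rw [← smul_eq_mul, ← Real.circleAverage_fun_smul]
  apply Real.circleAverage_mono
  · apply ContinuousOn.circleIntegrable'
    exact (hkc.mul hsr).abs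
  · apply ContinuousOn.circleIntegrable'
    exact hsr.abs.const_smul ((r + ‖ζ‖) / (r - ‖ζ‖))
  · intro z hz
    rw [abs_of_pos hr] at hz
    have e1 := re_herglotzRieszKernel_le hz hw
    have e2 := le_re_herglotzRieszKernel hz hw
    rw [← herglotzRieszKernel_def] at e1 e2
    rw [sub_zero] at e1 e2
    have e3 : 0 ≤ (herglotzRieszKernel 0 ζ z).re := le_trans (by
      apply div_nonneg <;> [linarith; positivity]) e2
    simp only [Pi.abs_apply, abs_mul, abs_of_nonneg e3, smul_eq_mul]
    gcongr

theorem slow_of_cav {A : ℝ → ℝ} (hA : ∀ r, 0 ≤ A r) {s : ℂ → ℂ}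
    (hs : DifferentiableOn ℂ s (Metric.ball 0 1)) (h : ∀ r, 0 < r → r < 1 → cav s r ≤ A r) :
    Slow A s := by
  refine ⟨hs, 2, 16 + 4 * ‖s 0‖, by positivity, ?_⟩
  intro ρ r h0 h1 h2 ζ hζ
  have hAr := hA r
  have hd : 0 < r - ρ := by linarith
  set R := (ρ + r) / 2 with hR
  have hM : 0 < 4 * (1 + A r) / (r - ρ) := by positivity
  have hre : Set.MapsTo s (Metric.ball 0 R) {z | z.re ≤ 4 * (1 + A r) / (r - ρ)} := by
    intro z hz
    have hz' : ‖z‖ < R := by simpa using hz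
    have := poisson_bound hs (ζ := z) (r := r) (by linarith) h2
    refine (le_abs_self _).trans (this.trans ?_)
    have e1 : (r + ‖z‖) / (r - ‖z‖) ≤ 4 / (r - ρ) := by
      rw [div_le_div_iff₀ (by linarith) hd]
      nlinarith [norm_nonneg z]
    calc _ ≤ 4 / (r - ρ) * (1 + A r) := by
            apply mul_le_mul e1 _ (cav_nonneg _ _) (by positivity)
            linarith [h r (by linarith) h2]
      _ = _ := by ring
  have hB := Complex.borelCaratheodory hM (hs.mono (Metric.ball_subset_ball (by linarith))) hre
    (by linarith) (z := ζ) (by simp; linarith)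
  have hb := slow_base hA h0 h1 h2
  set X := (1 + A r) / (r - ρ) with hX
  have e0 : 4 * (1 + A r) / (r - ρ) = 4 * X := by rw [hX]; ring
  have e4 : 1 / (r - ρ) ≤ X := by rw [hX]; gcongr; linarith
  have e5 : 0 < R - ‖ζ‖ := by linarith
  have e6 : 1 / (R - ‖ζ‖) ≤ 2 * X := by
    refine le_trans ?_ (mul_le_mul_of_nonneg_left e4 (by norm_num))
    rw [mul_one_div, div_le_div_iff₀ e5 hd]; linarith
  have e7 : ‖ζ‖ ≤ 1 := by linarith
  have e8 : R + ‖ζ‖ ≤ 2 := by linarith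
  rw [e0] at hB
  calc ‖s ζ‖ ≤ _ := hB
    _ = (8 * X * ‖ζ‖ + ‖s 0‖ * (R + ‖ζ‖)) * (1 / (R - ‖ζ‖)) := by field_simp; ring
    _ ≤ (8 * X * 1 + ‖s 0‖ * 2) * (2 * X) := by
        apply mul_le_mul _ e6 (by positivity) (by positivity)
        gcongr
    _ ≤ (16 + 4 * ‖s 0‖) * X ^ 2 := by
        nlinarith [mul_nonneg (norm_nonneg (s 0)) (by nlinarith : 0 ≤ X ^ 2 - X)]

theorem logder_mem {A : ℝ → ℝ} (hA : ∀ r, 0 ≤ A r) {s : ℂ → ℂ} (hs : Slow A s) {x : MG}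
    (hx : x ∈ SF A hA) (x0 : x ≠ 0) (he : MeromorphicAt (fun z => exp (s z)) 0) :
    dd (x * gm _ he) / (x * gm _ he) ∈ SF A hA := by
  have hsm := hs.mer
  have hne : gm _ he ≠ 0 := by
    rw [gm_ne_zero]; exact Eventually.of_forall (fun z => exp_ne_zero _)
  have h1 : dd (gm _ he) = dd (gm s hsm) * gm _ he := by
    rw [dd_gm, dd_gm, gm_mul, gm_eq]
    filter_upwards [ev_diff hsm] with z hz
    rw [show (fun z => exp (s z)) = (fun z => Complex.exp (s z)) from rfl, deriv_cexp hz]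
    ring
  have : dd (x * gm _ he) / (x * gm _ he) = dd x / x + dd (gm s hsm) := by
    rw [dd_mul, h1]; field_simp
  rw [this]
  exact add_mem (div_mem (SF_dd hx) hx) (SF_dd (slow_mem hs))

theorem jensen_abs {N : ℂ → ℂ} (hN : DifferentiableOn ℂ N (Metric.ball 0 1)) :
    ∃ C1 : ℝ, ∀ ρ : ℝ, 1/2 ≤ ρ → ρ < 1 → ∀ B : ℝ, 0 ≤ B →
      (∀ z, ‖z‖ = ρ → ‖N z‖ ≤ Real.exp B) →
      Real.circleAverage (fun z => |Real.log ‖N z‖|) 0 ρ ≤ 2 * B + C1 := by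
  have hNa : AnalyticOnNhd ℂ N (Metric.ball 0 1) := hN.analyticOnNhd Metric.isOpen_ball
  set n : ℤ := (meromorphicOrderAt N 0).untop₀ with hn
  set c : ℝ := Real.log ‖meromorphicTrailingCoeffAt N 0‖ with hc
  refine ⟨n * Real.log 2 - c, ?_⟩
  intro ρ h1 h2 B hB hb
  have hρ : 0 < ρ := by linarith
  have hsub : Metric.closedBall (0:ℂ) |ρ| ⊆ Metric.ball 0 1 := by
    rw [abs_of_pos hρ]; exact Metric.closedBall_subset_ball h2
  have hNb : AnalyticOnNhd ℂ N (Metric.closedBall 0 |ρ|) := hNa.mono hsub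
  have hJ := MeromorphicOn.circleAverage_log_norm hρ.ne' hNb.meromorphicOn
  have hdn := MeromorphicOn.AnalyticOnNhd.divisor_nonneg hNb
  have h00 : (0:ℂ) ∈ Metric.closedBall (0:ℂ) |ρ| := by simp
  have hd0 : MeromorphicOn.divisor N (Metric.closedBall 0 |ρ|) 0 = n :=
    MeromorphicOn.divisor_apply hNb.meromorphicOn h00
  have hn0 : 0 ≤ n := by rw [← hd0]; exact hdn 0
  have hsum : 0 ≤ ∑ᶠ u, (MeromorphicOn.divisor N (Metric.closedBall 0 |ρ|) u : ℝ)
      * Real.log (ρ * ‖0 - u‖⁻¹) := by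
    apply finsum_nonneg
    intro u
    by_cases hu : u ∈ Metric.closedBall (0:ℂ) |ρ|
    · apply mul_nonneg
      · exact_mod_cast hdn u
      · by_cases hu0 : u = 0
        · simp [hu0]
        · apply Real.log_nonneg
          have : ‖u‖ ≤ ρ := by simpa [abs_of_pos hρ] using hu
          have h3 : 0 < ‖u‖ := norm_pos_iff.2 hu0
          rw [zero_sub, norm_neg, ← div_eq_mul_inv, le_div_iff₀ h3]; linarith
    · rw [Function.locallyFinsuppWithin.apply_eq_zero_of_notMem _ hu]; simp
  rw [hd0] at hJ
  have hlow : - (n * Real.log 2 - c) ≤ Real.circleAverage (fun z => Real.log ‖N z‖) 0 ρ := by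
    rw [hJ]
    have : - Real.log 2 ≤ Real.log ρ := by
      rw [← Real.log_inv]; apply Real.log_le_log (by norm_num); norm_num at h1 ⊢; linarith
    have h4 : (n:ℝ) * (-Real.log 2) ≤ n * Real.log ρ :=
      mul_le_mul_of_nonneg_left this (by exact_mod_cast hn0)
    linarith
  have hNint : CircleIntegrable (fun z => Real.log ‖N z‖) 0 ρ := by
    apply MeromorphicOn.circleIntegrable_log_norm
    exact (hNb.mono Metric.sphere_subset_closedBall).meromorphicOn
  have hle : Real.circleAverage (fun z => |Real.log ‖N z‖|) 0 ρ ≤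
      Real.circleAverage (fun z => 2 * B - Real.log ‖N z‖) 0 ρ := by
    apply Real.circleAverage_mono
    · exact hNint.abs
    · exact (circleIntegrable_const _ _ _).sub hNint
    · intro z hz
      have hz' : ‖z‖ = ρ := by simpa [abs_of_pos hρ] using hz
      have : Real.log ‖N z‖ ≤ B := by
        by_cases h0 : N z = 0
        · simpa [h0] using hB
        · rw [Real.log_le_iff_le_exp (norm_pos_iff.2 h0)]; exact hb z hz'
      rcases abs_cases (Real.log ‖N z‖) with h | h <;> linarith
  refine hle.trans ?_
  rw [Real.circleAverage_fun_sub (circleIntegrable_const _ _ _) hNint, Real.circleAverage_const]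
  linarith

theorem slow_log_bound {A : ℝ → ℝ} (hA : ∀ r, 0 ≤ A r) {N : ℂ → ℂ} (hN : Slow A N) :
    ∃ C : ℝ, 0 ≤ C ∧ ∀ ρ r : ℝ, 1/2 ≤ ρ → ρ < r → r < 1 →
      Real.circleAverage (fun z => |Real.log ‖N z‖|) 0 ρ ≤
        C * (1 + Real.log ((1 + A r) / (r - ρ))) := by
  obtain ⟨C1, h1⟩ := jensen_abs hN.1
  obtain ⟨-, n, C, hC, h2⟩ := hN
  refine ⟨2 * (Real.log (1 + C) + n) + |C1|, by
    have := Real.log_nonneg (show 1 ≤ 1 + C by linarith); positivity, ?_⟩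
  intro ρ r hρ hr hr1
  have hX := slow_base hA (by linarith : 0 ≤ ρ) hr hr1
  set X := (1 + A r) / (r - ρ)
  have hl : 0 ≤ Real.log X := Real.log_nonneg hX
  have hlC := Real.log_nonneg (show 1 ≤ 1 + C by linarith)
  have := h1 ρ hρ (by linarith) (Real.log (1 + C) + n * Real.log X) (by positivity) (by
    intro z hz
    refine (h2 ρ r (by linarith) hr hr1 z hz.le).trans ?_
    rw [Real.exp_add, Real.exp_log (by linarith), mul_comm (n:ℝ), Real.exp_mul,
      Real.exp_log (by linarith), Real.rpow_natCast]
    gcongr; linarith)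
  refine this.trans ?_
  have h5 := le_abs_self C1
  have h6 := abs_nonneg C1
  have h7 : (0:ℝ) ≤ n := by positivity
  nlinarith [mul_nonneg hlC hl, mul_nonneg h6 hl]

theorem cav_bound {A : ℝ → ℝ} (hA : ∀ r, 0 ≤ A r) {s : ℂ → ℂ}
    (hs : DifferentiableOn ℂ s (Metric.ball 0 1))
    (he : MeromorphicAt (fun z => exp (s z)) 0) (hx : gm _ he ∈ SF A hA) :
    ∃ C : ℝ, 0 ≤ C ∧ ∀ ρ r : ℝ, 1/2 ≤ ρ → ρ < r → r < 1 →
      cav s ρ ≤ C * (1 + Real.log ((1 + A r) / (r - ρ))) := by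
  obtain ⟨N, D, hN, hD, hD0, hx⟩ := hx
  obtain ⟨C1, hC1, h1⟩ := slow_log_bound hA hN
  obtain ⟨C2, hC2, h2⟩ := slow_log_bound hA hD
  refine ⟨C1 + C2, by positivity, ?_⟩
  intro ρ r hρ hr hr1
  have hρ0 : 0 < ρ := by linarith
  rw [gm_ne_zero] at hD0
  have hDN : Set.EqOn (fun z => D z * exp (s z)) N (Metric.ball 0 1) := by
    have hp : IsPreconnected (Metric.ball (0:ℂ) 1) := (convex_ball 0 1).isPreconnected
    refine ((hD.1.mul hs.cexp).analyticOnNhd Metric.isOpen_ball).eqOn_of_preconnected_of_frequently_eq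
      (hN.1.analyticOnNhd Metric.isOpen_ball) hp (z₀ := 0) (by simp) ?_
    apply Eventually.frequently
    have hx2 := hx
    rw [gm_div, gm_eq] at hx2
    filter_upwards [hx2, hD0] with z h3 h4
    change D z * exp (s z) = N z
    rw [h3]; field_simp
  have hsub : Metric.sphere (0:ℂ) |ρ| ⊆ Metric.ball 0 1 := by
    intro z hz
    have : ‖z‖ = ρ := by simpa [abs_of_pos hρ0] using hz
    simp; linarith
  have hcod : ∀ᶠ z in codiscreteWithin (Metric.sphere (0:ℂ) |ρ|), D z ≠ 0 := by
    obtain ⟨x, hx1, hx2⟩ := (hD0.and (mem_nhdsWithin_of_mem_nhds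
      (Metric.ball_mem_nhds (0:ℂ) one_pos))).exists
    have := (hD.1.analyticOnNhd Metric.isOpen_ball).preimage_zero_mem_codiscreteWithin hx1 hx2
      ((convex_ball (0:ℂ) 1).isConnected ⟨0, by simp⟩)
    exact codiscreteWithin_mono hsub this
  have hNi : CircleIntegrable (fun z => Real.log ‖N z‖) 0 ρ :=
    MeromorphicOn.circleIntegrable_log_norm
      ((hN.1.analyticOnNhd Metric.isOpen_ball).mono hsub).meromorphicOn
  have hDi : CircleIntegrable (fun z => Real.log ‖D z‖) 0 ρ :=
    MeromorphicOn.circleIntegrable_log_norm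
      ((hD.1.analyticOnNhd Metric.isOpen_ball).mono hsub).meromorphicOn
  have hsi : CircleIntegrable (fun z => |(s z).re|) 0 ρ := by
    apply ContinuousOn.circleIntegrable'
    exact (Complex.continuous_re.comp_continuousOn (hs.continuousOn.mono hsub)).abs
  have hcongr : (fun z => |(s z).re|) =ᶠ[codiscreteWithin (Metric.sphere (0:ℂ) |ρ|)]
      (fun z => if D z = 0 then 0 else |(s z).re|) := by
    filter_upwards [hcod] with z hz
    simp [hz]
  have : cav s ρ ≤ Real.circleAverage (fun z => |Real.log ‖N z‖| + |Real.log ‖D z‖|) 0 ρ := by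
    unfold cav
    rw [Real.circleAverage_congr_codiscreteWithin hcongr hρ0.ne']
    apply Real.circleAverage_mono
    · exact hsi.congr_codiscreteWithin hcongr
    · exact hNi.abs.add hDi.abs
    · intro z hz
      by_cases h0 : D z = 0
      · simp only [h0, if_true]; positivity
      · simp only [h0, if_false]
        have e := hDN (hsub hz)
        simp only at e
        have : (s z).re = Real.log ‖N z‖ - Real.log ‖D z‖ := by
          rw [← e, norm_mul, Real.log_mul (norm_ne_zero_iff.2 h0) (by simp), Complex.norm_exp,
            Real.log_exp]; ring
        rw [this]; exact abs_sub _ _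
  have e3 : Real.circleAverage (fun z => |Real.log ‖N z‖| + |Real.log ‖D z‖|) 0 ρ =
      Real.circleAverage (fun z => |Real.log ‖N z‖|) 0 ρ +
      Real.circleAverage (fun z => |Real.log ‖D z‖|) 0 ρ :=
    Real.circleAverage_fun_add hNi.abs hDi.abs
  have e1 := h1 ρ r hρ hr hr1
  have e2 := h2 ρ r hρ hr hr1
  linarith

theorem boot {A : ℝ → ℝ} (hA : ∀ r, 0 ≤ A r) (hc : ContinuousOn A (Set.Ico 0 1)) {C : ℝ}
    (hC : 0 ≤ C) (h : ∀ ρ r : ℝ, 1/2 ≤ ρ → ρ < r → r < 1 →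
      A ρ ≤ C * (1 + Real.log ((1 + A r) / (r - ρ)))) :
    ∃ K : ℝ, 0 ≤ K ∧ ∀ ρ, 0 ≤ ρ → ρ < 1 → A ρ ≤ K / (1 - ρ) ^ 2 := by
  obtain ⟨B, hB⟩ := isCompact_Icc.bddAbove_image (hc.mono (show Set.Icc (0:ℝ) (1/2) ⊆ Set.Ico 0 1 by
    intro x hx; exact ⟨hx.1, by linarith [hx.2]⟩))
  have hB' : ∀ ρ, 0 ≤ ρ → ρ ≤ 1/2 → A ρ ≤ B := fun ρ h1 h2 => hB ⟨ρ, ⟨h1, h2⟩, rfl⟩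
  have hB0 : 0 ≤ B := (hA 0).trans (hB' 0 le_rfl (by norm_num))
  refine ⟨B + 4 * (2 + 40 * C + 64 * C ^ 2), by positivity, ?_⟩
  intro ρ0 h0 h1
  have hd : 0 < 1 - ρ0 := by linarith
  rw [le_div_iff₀ (by positivity)]
  rcases le_total ρ0 (1/2) with h2 | h2
  · have e1 := hB' ρ0 h0 h2
    have e2 : (1 - ρ0) ^ 2 ≤ 1 := by nlinarith
    have e3 : 0 ≤ 4 * (2 + 40 * C + 64 * C ^ 2) := by positivity
    nlinarith [hA ρ0]
  set ρ1 := (1 + ρ0) / 2 with hρ1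
  obtain ⟨t, ht, hmax⟩ := isCompact_Icc.exists_isMaxOn (s := Set.Icc ρ0 ρ1)
    (f := fun ρ => A ρ * (ρ1 - ρ) ^ 2) ⟨ρ0, le_rfl, by linarith⟩ (by
      apply ContinuousOn.mul (hc.mono _) (by fun_prop)
      intro x hx; exact ⟨by linarith [hx.1], by linarith [hx.2]⟩)
  set Φ := A t * (ρ1 - t) ^ 2 with hΦ
  have hΦ0 : 0 ≤ Φ := mul_nonneg (hA _) (sq_nonneg _)
  have hmax' : ∀ ρ, ρ0 ≤ ρ → ρ ≤ ρ1 → A ρ * (ρ1 - ρ) ^ 2 ≤ Φ := fun ρ a b => hmax ⟨a, b⟩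
  have key : Φ ≤ 2 + 40 * C + 64 * C ^ 2 := by
    rcases eq_or_lt_of_le ht.2 with h3 | h3
    · rw [hΦ, h3]; simp; positivity
    set δ := ρ1 - t with hδ
    have hδ0 : 0 < δ := by linarith
    have hδ1 : δ ≤ 1 := by linarith [ht.1]
    have e1 := h t ((t + ρ1) / 2) (by linarith [ht.1]) (by linarith) (by linarith)
    have e2 := hmax' ((t + ρ1) / 2) (by linarith [ht.1]) (by linarith)
    set r := (t + ρ1) / 2 with hr
    have e3 : ρ1 - r = δ / 2 := by rw [hr, hδ]; ring
    have e4 : r - t = δ / 2 := by rw [hr, hδ]; ring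
    rw [e3] at e2
    rw [e4] at e1
    have e5 : (1 + A r) / (δ / 2) ≤ 2 * (1 + 4 * Φ) * (1 / δ) ^ 3 := by
      rw [div_le_iff₀ (by positivity)]
      have : 2 * (1 + 4 * Φ) * (1 / δ) ^ 3 * (δ / 2) = (1 + 4 * Φ) / δ ^ 2 := by field_simp
      rw [this, le_div_iff₀ (by positivity)]
      nlinarith
    have e6 : Real.log ((1 + A r) / (δ / 2)) ≤ 1 + Real.log (1 + 4 * Φ) + 3 * (1 / δ) := by
      refine (Real.log_le_log (by have := hA r; positivity) e5).trans ?_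
      rw [Real.log_mul (by positivity) (by positivity), Real.log_mul (by norm_num) (by positivity),
        Real.log_pow]
      have l1 := Real.log_le_sub_one_of_pos (show (0:ℝ) < 2 by norm_num)
      have l2 := Real.log_le_sub_one_of_pos (show (0:ℝ) < 1 / δ by positivity)
      push_cast
      linarith
    set w := Real.sqrt (1 + 4 * Φ) with hw
    have hw2 : w ^ 2 = 1 + 4 * Φ := Real.sq_sqrt (by positivity)
    have hw0 : 0 < w := Real.sqrt_pos.2 (by positivity)
    have e7 : Real.log (1 + 4 * Φ) ≤ 2 * w := by
      rw [← hw2, Real.log_pow]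
      have := Real.log_le_sub_one_of_pos hw0
      push_cast; linarith
    have e8 : A t ≤ C * (1 + (1 + 2 * w + 3 * (1 / δ))) :=
      e1.trans (mul_le_mul_of_nonneg_left (by linarith) hC)
    have e9 : Φ ≤ C * (5 + 2 * w) := by
      calc Φ = A t * δ ^ 2 := hΦ
        _ ≤ C * (1 + (1 + 2 * w + 3 * (1 / δ))) * δ ^ 2 := by gcongr
        _ = C * ((2 + 2 * w) * δ ^ 2 + 3 * δ) := by field_simp; ring
        _ ≤ C * (5 + 2 * w) := by
          apply mul_le_mul_of_nonneg_left _ hC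
          nlinarith [pow_le_one₀ hδ0.le hδ1 (n := 2)]
    nlinarith [sq_nonneg (w - 8 * C)]
  have := hmax' ρ0 le_rfl (by linarith)
  have e : ρ1 - ρ0 = (1 - ρ0) / 2 := by rw [hρ1]; ring
  rw [e] at this
  nlinarith

theorem cav_cont {s : ℂ → ℂ} (hs : DifferentiableOn ℂ s (Metric.ball 0 1)) :
    ContinuousOn (cav s) (Set.Ico 0 1) := by
  apply Real.ContinuousOn.circleAverage
  · apply (Complex.continuous_re.comp_continuousOn (hs.continuousOn.mono _)).abs
    intro z hz
    have := hz.2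
    simpa using this
  · intro r hr; exact hr.1

theorem slow_zero {A : ℝ → ℝ} (hA : ∀ r, 0 ≤ A r) {K : ℝ} (hK : 0 ≤ K)
    (h : ∀ ρ, 0 ≤ ρ → ρ < 1 → A ρ ≤ K / (1 - ρ) ^ 2) {u : ℂ → ℂ} (hu : Slow A u) :
    Slow (fun _ => 0) u := by
  obtain ⟨hu, n, C, hC, h2⟩ := hu
  refine ⟨hu, 3 * n, C * (2 + 8 * K) ^ n, by positivity, ?_⟩
  intro ρ r h0 h1 h3 ζ hζ
  have hd : 0 < r - ρ := by linarith
  have e1 := h2 ρ ((ρ + r) / 2) h0 (by linarith) (by linarith) ζ hζ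
  have e2 := h ((ρ + r) / 2) (by linarith) (by linarith)
  refine e1.trans ?_
  rw [mul_assoc, pow_mul, ← mul_pow]
  gcongr C * ?_ ^ n
  · have := hA ((ρ + r) / 2)
    apply div_nonneg <;> linarith
  have e3 : A ((ρ + r) / 2) ≤ 4 * K / (r - ρ) ^ 2 := by
    refine e2.trans ?_
    rw [div_le_div_iff₀ (pow_pos (by linarith) 2) (by positivity)]
    have : (r - ρ) ^ 2 ≤ 4 * (1 - (ρ + r) / 2) ^ 2 := by nlinarith
    nlinarith
  have e4 : (ρ + r) / 2 - ρ = (r - ρ) / 2 := by ring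
  rw [e4, div_le_iff₀ (by positivity)]
  have e5 : (2 + 8 * K) * ((1 + 0) / (r - ρ)) ^ 3 * ((r - ρ) / 2) = (1 + 4 * K) / (r - ρ) ^ 2 := by
    field_simp; ring
  rw [e5]
  refine (add_le_add_right e3 1).trans ?_
  rw [le_div_iff₀ (by positivity), add_mul, div_mul_cancel₀ _ (by positivity)]
  nlinarith [pow_le_one₀ hd.le (by linarith : r - ρ ≤ 1) (n := 2)]

/-- The subfield of germs of quotients of functions of polynomial growth on the disc. -/
noncomputable abbrev S0 : Subfield MG := SF (fun _ => 0) (fun _ => le_rfl)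

theorem SF_le_S0 {A : ℝ → ℝ} (hA : ∀ r, 0 ≤ A r) {K : ℝ} (hK : 0 ≤ K)
    (h : ∀ ρ, 0 ≤ ρ → ρ < 1 → A ρ ≤ K / (1 - ρ) ^ 2) : SF A hA ≤ S0 := by
  rintro x ⟨N, D, hN, hD, hD0, rfl⟩
  exact ⟨N, D, slow_zero hA hK h hN, slow_zero hA hK h hD, hD0, rfl⟩

theorem slow_of_zero {A : ℝ → ℝ} (hA : ∀ r, 0 ≤ A r) {u : ℂ → ℂ} (hu : Slow (fun _ => 0) u) :
    Slow A u := by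
  obtain ⟨hu, n, C, hC, h2⟩ := hu
  refine ⟨hu, n, C, hC, ?_⟩
  intro ρ r h0 h1 h3 ζ hζ
  refine (h2 ρ r h0 h1 h3 ζ hζ).trans ?_
  have hd : 0 < r - ρ := by linarith
  have := hA r
  gcongr

theorem S0_le_SF {A : ℝ → ℝ} (hA : ∀ r, 0 ≤ A r) : S0 ≤ SF A hA := by
  rintro x ⟨N, D, hN, hD, hD0, rfl⟩
  exact ⟨N, D, slow_of_zero hA hN, slow_of_zero hA hD, hD0, rfl⟩

/-- The main conclusion of the bootstrapping argument on the disc. -/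
theorem disc_main (f0 f1 f2 f3 : MG) (n0 : f0 ≠ 0) (n1 : f1 ≠ 0) (n2 : f2 ≠ 0) (n3 : f3 ≠ 0)
    (e0 : dd f0 = f1) (e1 : dd f1 = f2) (e2 : dd f2 = f3)
    {s t : ℂ → ℂ} (hs : DifferentiableOn ℂ s (Metric.ball 0 1))
    (ht : DifferentiableOn ℂ t (Metric.ball 0 1))
    (hes : MeromorphicAt (fun z => exp (s z)) 0) (het : MeromorphicAt (fun z => exp (t z)) 0)
    {x y : MG} (hx : x ∈ S0) (hy : y ∈ S0) (x0 : x ≠ 0) (y0 : y ≠ 0)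
    (hφ : f0 * f2 / f1 ^ 2 = x * gm _ hes) (hψ : f1 * f3 / f2 ^ 2 = y * gm _ het) :
    f0 * f2 / f1 ^ 2 ∈ S0 ∧ f1 * f3 / f2 ^ 2 ∈ S0 := by
  set A : ℝ → ℝ := fun r => cav s r + cav t r with hAdef
  have hA : ∀ r, 0 ≤ A r := fun r => add_nonneg (cav_nonneg _ _) (cav_nonneg _ _)
  have hsS : Slow A s := slow_of_cav hA hs (fun r _ _ => le_add_of_nonneg_right (cav_nonneg _ _))
  have htS : Slow A t := slow_of_cav hA ht (fun r _ _ => le_add_of_nonneg_left (cav_nonneg _ _))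
  have hxA := S0_le_SF hA hx
  have hyA := S0_le_SF hA hy
  have hstep := alg_step dd dd_add dd_mul (SF A hA) (fun a ha => SF_dd ha) (fun a ha => SF_const ha)
    f0 f1 f2 f3 n0 n1 n2 n3 e0 e1 e2 (by rw [hφ]; exact logder_mem hA hsS hxA x0 hes)
    (by rw [hψ]; exact logder_mem hA htS hyA y0 het)
  have h1 : gm _ hes ∈ SF A hA := by
    have := div_mem hstep.1 hxA
    rwa [hφ, mul_div_cancel_left₀ _ x0] at this
  have h2 : gm _ het ∈ SF A hA := by
    have := div_mem hstep.2 hyA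
    rwa [hψ, mul_div_cancel_left₀ _ y0] at this
  obtain ⟨C1, hC1, b1⟩ := cav_bound hA hs hes h1
  obtain ⟨C2, hC2, b2⟩ := cav_bound hA ht het h2
  obtain ⟨K, hK, hb⟩ := boot (A := A) hA ((cav_cont hs).add (cav_cont ht)) (C := C1 + C2)
    (by positivity) (by
      intro ρ r a b c
      have e1 := b1 ρ r a b c
      have e2 := b2 ρ r a b c
      change cav s ρ + cav t ρ ≤ _
      linarith)
  exact ⟨SF_le_S0 hA hK hb hstep.1, SF_le_S0 hA hK hb hstep.2⟩

theorem exists_log_on {U : Set ℂ} (hU : IsOpen U) (hc : Convex ℝ U) (hne : U.Nonempty)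
    {g : ℂ → ℂ} (hg : DifferentiableOn ℂ g U) (h0 : ∀ z ∈ U, g z ≠ 0) :
    ∃ s : ℂ → ℂ, DifferentiableOn ℂ s U ∧ ∀ z ∈ U, exp (s z) = g z := by
  have hsc : IsSimplyConnected U := by
    have : ContractibleSpace U := hc.contractibleSpace hne
    exact (inferInstance : SimplyConnectedSpace U)
  obtain ⟨s, hs, he⟩ := exists_continuousOn_eqOn_exp_comp hsc hU hg.continuousOn (by
    rintro ⟨z, hz, h⟩; exact h0 z hz h)
  refine ⟨s, ?_, fun z hz => he hz⟩
  intro z hz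
  have hnz : U ∈ 𝓝 z := hU.mem_nhds hz
  have hgz : DifferentiableAt ℂ g z := hg.differentiableAt hnz
  have hsz : ContinuousAt s z := hs.continuousAt hnz
  have hev : s =ᶠ[𝓝 z] fun w => s z + Complex.log (g w / g z) := by
    have h1 : ∀ᶠ w in 𝓝 z, ‖s w - s z‖ < 1 := by
      have := hsz.eventually (Metric.ball_mem_nhds (s z) one_pos)
      filter_upwards [this] with w hw
      simpa [dist_eq_norm] using hw
    filter_upwards [h1, hnz] with w hw hwU
    have e1 : g w / g z = exp (s w - s z) := by
      rw [exp_sub]; rw [← he hz, ← he hwU]; rfl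
    have h2 := (abs_im_le_norm (s w - s z)).trans hw.le
    have h3 := abs_le.1 h2
    have h4 := Real.pi_gt_three
    rw [e1, Complex.log_exp (by linarith [h3.1]) (by linarith [h3.2])]
    ring
  refine (DifferentiableAt.congr_of_eventuallyEq ?_ hev).differentiableWithinAt
  apply (differentiableAt_const _).add
  apply DifferentiableAt.clog
  · exact hgz.div_const _
  · rw [div_self (h0 z hz)]; simp

/-- Factorisation of a meromorphic function with finitely many zeros and poles. -/
theorem mero_factor {U : Set ℂ} (hU : IsOpen U) (hc : Convex ℝ U) (hne : U.Nonempty)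
    {h : ℂ → ℂ} (hm : MeromorphicOn h U) (htop : ∀ z ∈ U, meromorphicOrderAt h z ≠ ⊤)
    (hfin : {z | z ∈ U ∧ meromorphicOrderAt h z ≠ 0}.Finite) :
    ∃ (T : Finset ℂ) (n : ℂ → ℤ) (s : ℂ → ℂ), DifferentiableOn ℂ s U ∧
      ∀ z ∈ U, ∀ᶠ w in 𝓝[≠] z, h w = (∏ u ∈ T, (w - u) ^ n u) * exp (s w) := by
  have hsf : (MeromorphicOn.divisor h U).support.Finite := by
    refine hfin.subset ?_
    intro z hz
    have hzU := (MeromorphicOn.divisor h U).supportWithinDomain hz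
    refine ⟨hzU, ?_⟩
    intro h0
    rw [Function.mem_support, MeromorphicOn.divisor_apply hm hzU, h0] at hz
    simp at hz
  obtain ⟨g, hg, hg0, hgeq⟩ := hm.extract_zeros_poles (fun u => htop u u.2) hsf
  obtain ⟨s, hs, he⟩ := exists_log_on hU hc hne hg.differentiableOn (fun z hz => hg0 ⟨z, hz⟩)
  refine ⟨hsf.toFinset, MeromorphicOn.divisor h U, s, hs, ?_⟩
  intro z hz
  have h1 := mem_codiscreteWithin_iff_forall_mem_nhdsNE.1 hgeq z hz
  filter_upwards [h1, mem_nhdsWithin_of_mem_nhds (hU.mem_nhds hz)] with w hw hwU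
  rcases hw with hw | hw
  · have hw' : h w = ((∏ᶠ u, (· - u) ^ MeromorphicOn.divisor h U u) • g) w := hw
    rw [hw', Pi.smul_apply', he w hwU, smul_eq_mul]
    congr 1
    rw [finprod_eq_prod_of_mulSupport_subset (s := hsf.toFinset)]
    · simp
    · intro u hu
      simp only [Set.Finite.coe_toFinset, Function.mem_support]
      intro h0
      apply hu
      simp only
      rw [h0, zpow_zero]
  · exact absurd hwU hw

theorem prod_mer (T : Finset ℂ) (n : ℂ → ℤ) (z : ℂ) :
    MeromorphicAt (fun w => ∏ u ∈ T, (w - u) ^ n u) z := by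
  fun_prop

theorem prod_ev_ne (T : Finset ℂ) (n : ℂ → ℤ) (z : ℂ) :
    ∀ᶠ w in 𝓝[≠] z, ∏ u ∈ T, (w - u) ^ n u ≠ 0 := by
  have : ∀ᶠ w in 𝓝[≠] z, ∀ u ∈ T, w - u ≠ 0 := by
    rw [Filter.eventually_all_finset]
    intro u _
    by_cases h : u = z
    · subst h
      filter_upwards [self_mem_nhdsWithin] with w hw using sub_ne_zero.2 hw
    · have : ∀ᶠ w in 𝓝 z, w ≠ u := (isOpen_ne.mem_nhds (Ne.symm h))
      filter_upwards [mem_nhdsWithin_of_mem_nhds this] with w hw using sub_ne_zero.2 hw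
  filter_upwards [this] with w hw
  exact Finset.prod_ne_zero_iff.2 (fun u hu => zpow_ne_zero _ (hw u hu))

theorem gm_zpow {f : ℂ → ℂ} (hf : MeromorphicAt f 0) (n : ℤ) :
    gm f hf ^ n = gm (fun z => f z ^ n) (hf.zpow n) := by
  cases n with
  | ofNat k => simp [gm_pow]
  | negSucc k => simp [zpow_negSucc, gm_pow, gm_inv]

theorem gm_lin_mem (u : ℂ) (h : MeromorphicAt (fun w => w - u) 0) : gm (fun w => w - u) h ∈ S0 := by
  apply slow_mem
  apply slow_bdd (C := 1 + ‖u‖) (by fun_prop)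
  intro ζ hζ
  exact (norm_sub_le _ _).trans (by linarith)

theorem gm_prod_mem (T : Finset ℂ) (n : ℂ → ℤ) :
    gm _ (prod_mer T n 0) ∈ S0 := by
  induction T using Finset.induction_on with
  | empty => simp only [Finset.prod_empty]; exact one_mem S0
  | insert a T ha ih =>
    have h1 : MeromorphicAt (fun w => w - a) 0 := by fun_prop
    have : gm _ (prod_mer (insert a T) n 0) = gm _ h1 ^ n a * gm _ (prod_mer T n 0) := by
      rw [gm_zpow, gm_mul, gm_eq]
      filter_upwards with z
      rw [Finset.prod_insert ha]
    rw [this]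
    exact mul_mem (zpow_mem (gm_lin_mem a h1) _) ih

/-- Factorisation on the disc in terms of germs. -/
theorem disc_factor {h : ℂ → ℂ} (hm : MeromorphicOn h (Metric.ball 0 1))
    (htop : ∀ z ∈ Metric.ball (0:ℂ) 1, meromorphicOrderAt h z ≠ ⊤)
    (hfin : {z | z ∈ Metric.ball (0:ℂ) 1 ∧ meromorphicOrderAt h z ≠ 0}.Finite)
    (hm0 : MeromorphicAt h 0) :
    ∃ s : ℂ → ℂ, DifferentiableOn ℂ s (Metric.ball 0 1) ∧
      ∃ hes : MeromorphicAt (fun z => exp (s z)) 0, ∃ x ∈ S0, x ≠ 0 ∧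
        gm h hm0 = x * gm _ hes := by
  obtain ⟨T, n, s, hs, he⟩ := mero_factor Metric.isOpen_ball (convex_ball 0 1) ⟨0, by simp⟩
    hm htop hfin
  have hes : MeromorphicAt (fun z => exp (s z)) 0 :=
    (hs.cexp.analyticAt (Metric.ball_mem_nhds 0 one_pos)).meromorphicAt
  refine ⟨s, hs, hes, gm _ (prod_mer T n 0), gm_prod_mem T n, ?_, ?_⟩
  · rw [gm_ne_zero]; exact prod_ev_ne T n 0
  · rw [gm_mul, gm_eq]
    exact he 0 (by simp)

/-- Meromorphic in the whole plane. -/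
def Mer (h : ℂ → ℂ) : Prop := ∀ z, MeromorphicAt h z

theorem Mer.deriv {h : ℂ → ℂ} (hh : Mer h) : Mer (deriv h) := fun z => (hh z).deriv

theorem Mer.iter {h : ℂ → ℂ} (hh : Mer h) (n : ℕ) : Mer (iteratedDeriv n h) := by
  induction n with
  | zero => simpa [iteratedDeriv_zero] using hh
  | succ n ih => rw [iteratedDeriv_succ]; exact ih.deriv

theorem Mer.order {h : ℂ → ℂ} (hh : Mer h) (z : ℂ) : meroOrder h z = meromorphicOrderAt h z := by
  unfold meroOrder; rw [dif_pos (hh z)]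

theorem MeroEq.symm {a b : ℂ → ℂ} (h : MeroEq a b) : MeroEq b a := fun z => by
  filter_upwards [h z] with w hw using hw.symm

theorem MeroEq.trans {a b c : ℂ → ℂ} (h : MeroEq a b) (h' : MeroEq b c) : MeroEq a c := fun z => by
  filter_upwards [h z, h' z] with w hw hw' using hw.trans hw'

theorem MeroEq.deriv {a b : ℂ → ℂ} (h : MeroEq a b) : MeroEq (deriv a) (deriv b) := fun z =>
  Filter.EventuallyEq.nhdsNE_deriv (h z)

theorem Mer.congr {a b : ℂ → ℂ} (ha : Mer a) (h : MeroEq a b) : Mer b := fun z => (ha z).congr (h z)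

theorem mer_zero {h : ℂ → ℂ} (hh : Mer h) {z : ℂ} (hz : ∃ᶠ w in 𝓝[≠] z, h w = 0) :
    MeroEq h (fun _ => 0) := by
  have h1 : meromorphicOrderAt h z = ⊤ := by
    by_contra hne
    rw [← ne_eq, meromorphicOrderAt_ne_top_iff_eventually_ne_zero (hh z)] at hne
    exact hz (by simpa using hne)
  intro w
  rw [← meromorphicOrderAt_eq_top_iff]
  by_contra hne
  exact MeromorphicOn.meromorphicOrderAt_ne_top_of_isPreconnected (U := Set.univ) (x := w) (y := z)
    (fun z _ => hh z) isPreconnected_univ (Set.mem_univ _) (Set.mem_univ _) hne h1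

theorem mer_eq {a b : ℂ → ℂ} (ha : Mer a) (hb : Mer b) {z : ℂ} (hz : ∃ᶠ w in 𝓝[≠] z, a w = b w) :
    MeroEq a b := by
  have := mer_zero (h := fun w => a w - b w) (fun z => (ha z).sub (hb z)) (z := z)
    (hz.mono fun w hw => by simp [hw])
  intro z
  filter_upwards [this z] with w hw using sub_eq_zero.1 hw

theorem Mer.ne_top {h : ℂ → ℂ} (hh : Mer h) (h0 : ¬ MeroEq h (fun _ => 0)) (z : ℂ) :
    meromorphicOrderAt h z ≠ ⊤ := by
  intro h1
  apply h0
  apply mer_zero hh (z := z)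
  exact (meromorphicOrderAt_eq_top_iff.1 h1).frequently

theorem Mer.ev_ne {h : ℂ → ℂ} (hh : Mer h) (h0 : ¬ MeroEq h (fun _ => 0)) (z : ℂ) :
    ∀ᶠ w in 𝓝[≠] z, h w ≠ 0 :=
  (meromorphicOrderAt_ne_top_iff_eventually_ne_zero (hh z)).1 (hh.ne_top h0 z)

theorem mer_const {h : ℂ → ℂ} (hh : Mer h) (hd : MeroEq (deriv h) (fun _ => 0)) :
    ∃ c, MeroEq h (fun _ => c) := by
  obtain ⟨c, hc⟩ := const_of_deriv_zero (hh 0) (hd 0)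
  exact ⟨c, mer_eq hh (fun z => MeromorphicAt.const c z) (z := 0) hc.frequently⟩

theorem poly_primitive (p : Polynomial ℂ) : ∃ P : Polynomial ℂ, P.derivative = p := by
  induction p using Polynomial.induction_on' with
  | add a b ha hb =>
    obtain ⟨A, rfl⟩ := ha
    obtain ⟨B, rfl⟩ := hb
    exact ⟨A + B, by simp⟩
  | monomial n a =>
    refine ⟨Polynomial.monomial (n + 1) (a / (n + 1)), ?_⟩
    rw [Polynomial.derivative_monomial]
    have : (n : ℂ) + 1 ≠ 0 := Nat.cast_add_one_ne_zero n
    simp; field_simp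

theorem mer_poly {h : ℂ → ℂ} (hh : Mer h) (p : Polynomial ℂ)
    (hd : MeroEq (deriv h) (fun z => p.eval z)) :
    ∃ q : Polynomial ℂ, MeroEq h (fun z => q.eval z) := by
  obtain ⟨P, hP⟩ := poly_primitive p
  have hPm : Mer (fun z => P.eval z) := fun z => P.differentiable.analyticAt z |>.meromorphicAt
  obtain ⟨c, hc⟩ := mer_const (h := fun z => h z - P.eval z) (fun z => (hh z).sub (hPm z)) (by
    intro z
    filter_upwards [hd z, ev_diff (hh z)] with w hw hw2
    rw [deriv_fun_sub hw2 P.differentiableAt, hw, Polynomial.deriv, hP, sub_self])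
  refine ⟨P + Polynomial.C c, fun z => ?_⟩
  filter_upwards [hc z] with w hw
  simp; linear_combination hw

theorem iter_ne {f : ℂ → ℂ} (hf : Mer f) (ht : ¬ IsRatFn f) (j : ℕ) :
    ¬ MeroEq (iteratedDeriv j f) (fun _ => 0) := by
  intro h
  have : ∀ i, i ≤ j → ∃ p : Polynomial ℂ, MeroEq (iteratedDeriv (j - i) f) (fun z => p.eval z) := by
    intro i
    induction i with
    | zero => intro _; exact ⟨0, by simpa using h⟩
    | succ i ih =>
      intro hi
      obtain ⟨p, hp⟩ := ih (by omega)
      have e : j - i = (j - (i + 1)) + 1 := by omega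
      rw [e, iteratedDeriv_succ] at hp
      exact mer_poly (hf.iter _) p hp
  obtain ⟨p, hp⟩ := this j le_rfl
  rw [Nat.sub_self, iteratedDeriv_zero] at hp
  exact ht ⟨p, 1, one_ne_zero, by simpa using hp⟩

/-! conjugation -/

theorem mtilde_mtilde (f : ℂ → ℂ) : mtilde (mtilde f) = f := by
  funext z; simp [mtilde]

theorem mtilde_deriv (f : ℂ → ℂ) : deriv (mtilde f) = mtilde (deriv f) := by
  exact deriv_conj_conj (f := f)

theorem mtilde_iter (f : ℂ → ℂ) (n : ℕ) : iteratedDeriv n (mtilde f) = mtilde (iteratedDeriv n f) := by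
  induction n with
  | zero => simp [iteratedDeriv_zero]
  | succ n ih => rw [iteratedDeriv_succ, iteratedDeriv_succ, ih, mtilde_deriv]

theorem tendsto_conj (z : ℂ) : Tendsto (starRingEnd ℂ) (𝓝 z) (𝓝 (starRingEnd ℂ z)) :=
  Complex.continuous_conj.tendsto z

theorem tendsto_conj_ne (z : ℂ) :
    Tendsto (starRingEnd ℂ) (𝓝[≠] z) (𝓝[≠] (starRingEnd ℂ z)) := by
  apply tendsto_nhdsWithin_of_tendsto_nhds_of_eventually_within
  · exact (tendsto_conj z).mono_left nhdsWithin_le_nhds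
  · filter_upwards [self_mem_nhdsWithin] with w hw
    exact fun h => hw (star_injective h)

theorem mtilde_analytic {f : ℂ → ℂ} {z : ℂ} (h : AnalyticAt ℂ f (starRingEnd ℂ z)) :
    AnalyticAt ℂ (mtilde f) z := by
  rw [Complex.analyticAt_iff_eventually_differentiableAt] at h ⊢
  filter_upwards [(tendsto_conj z).eventually h] with w hw
  have := hw.conj_conj
  rw [Complex.conj_conj] at this
  exact this

theorem mtilde_mer_at {f : ℂ → ℂ} {z : ℂ} (h : MeromorphicAt f (starRingEnd ℂ z)) :
    MeromorphicAt (mtilde f) z := by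
  obtain ⟨n, hn⟩ := h
  refine ⟨n, ?_⟩
  have := mtilde_analytic hn
  have e : (fun w => (w - z) ^ n • mtilde f w) =
      mtilde (fun w => (w - starRingEnd ℂ z) ^ n • f w) := by
    funext w
    simp [mtilde]
  rw [e]
  exact this

theorem Mer.tilde {f : ℂ → ℂ} (h : Mer f) : Mer (mtilde f) := fun z => mtilde_mer_at (h _)

theorem mtilde_order {f : ℂ → ℂ} (hf : Mer f) (z : ℂ) :
    meromorphicOrderAt (mtilde f) z = meromorphicOrderAt f (starRingEnd ℂ z) := by
  cases h : meromorphicOrderAt f (starRingEnd ℂ z) with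
  | top =>
    rw [meromorphicOrderAt_eq_top_iff] at h ⊢
    filter_upwards [(tendsto_conj_ne z).eventually h] with w hw
    simp [mtilde, hw]
  | coe n =>
    rw [meromorphicOrderAt_eq_int_iff (hf _)] at h
    rw [meromorphicOrderAt_eq_int_iff (hf.tilde _)]
    obtain ⟨g, hg, hg0, hfg⟩ := h
    refine ⟨mtilde g, mtilde_analytic hg, ?_, ?_⟩
    · simpa [mtilde] using hg0
    · filter_upwards [(tendsto_conj_ne z).eventually hfg] with w hw
      simp [mtilde, hw]

theorem MeroEq.tilde {a b : ℂ → ℂ} (h : MeroEq a b) : MeroEq (mtilde a) (mtilde b) := by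
  intro z
  filter_upwards [(tendsto_conj_ne z).eventually (h _)] with w hw
  simp [mtilde, hw]

theorem analytic_rep {h : ℂ → ℂ} {z : ℂ} (hh : MeromorphicAt h z) (h0 : 0 ≤ meromorphicOrderAt h z) :
    ∃ g, AnalyticAt ℂ g z ∧ h =ᶠ[𝓝[≠] z] g := by
  cases hn : meromorphicOrderAt h z with
  | top => exact ⟨fun _ => 0, analyticAt_const, meromorphicOrderAt_eq_top_iff.1 hn⟩
  | coe n =>
    rw [hn] at h0
    have h0' : 0 ≤ n := by exact_mod_cast h0
    obtain ⟨k, rfl⟩ := Int.eq_ofNat_of_zero_le h0'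
    obtain ⟨g, hg, -, hfg⟩ := (meromorphicOrderAt_eq_int_iff hh).1 hn
    refine ⟨fun w => (w - z) ^ k * g w, by fun_prop, ?_⟩
    filter_upwards [hfg] with w hw
    rw [hw]; simp

theorem order_deriv_nonneg {h : ℂ → ℂ} {z : ℂ} (hh : MeromorphicAt h z)
    (h0 : 0 ≤ meromorphicOrderAt h z) : 0 ≤ meromorphicOrderAt (deriv h) z := by
  obtain ⟨g, hg, he⟩ := analytic_rep hh h0
  rw [meromorphicOrderAt_congr he.nhdsNE_deriv]
  exact hg.deriv.meromorphicOrderAt_nonneg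

/-- The function `f_j f_{j+2} / f_{j+1}^2`. -/
noncomputable def phi (f : ℂ → ℂ) (j : ℕ) : ℂ → ℂ := fun z =>
  iteratedDeriv j f z * iteratedDeriv (j + 2) f z / iteratedDeriv (j + 1) f z ^ 2

theorem Mer.phi {f : ℂ → ℂ} (hf : Mer f) (j : ℕ) : Mer (phi f j) := fun z =>
  ((hf.iter j z).mul (hf.iter (j + 2) z)).div ((hf.iter (j + 1) z).pow 2)

theorem phi_order {h : ℂ → ℂ} {z : ℂ} (hh : MeromorphicAt h z)
    (t0 : ¬ 0 < meromorphicOrderAt h z) (t1 : ¬ 0 < meromorphicOrderAt (deriv h) z)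
    (t2 : ¬ 0 < meromorphicOrderAt (deriv (deriv h)) z) :
    meromorphicOrderAt (fun w => h w * deriv (deriv h) w / deriv h w ^ 2) z = 0 := by
  have hm1 := hh.deriv
  have hm2 := hm1.deriv
  have key : meromorphicOrderAt (fun w => h w * deriv (deriv h) w / deriv h w ^ 2) z =
      meromorphicOrderAt h z + meromorphicOrderAt (deriv (deriv h)) z +
      -((2:ℕ) * meromorphicOrderAt (deriv h) z) := by
    have e : (fun w => h w * deriv (deriv h) w / deriv h w ^ 2) =
      (h * deriv (deriv h)) * ((deriv h) ^ 2)⁻¹ := by funext w; simp [div_eq_mul_inv]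
    rw [e, meromorphicOrderAt_mul (hh.mul hm2) (hm1.pow 2).inv, meromorphicOrderAt_mul hh hm2,
      meromorphicOrderAt_inv, meromorphicOrderAt_pow hm1]
  rw [key]
  by_cases hneg : 0 ≤ meromorphicOrderAt h z
  · have e0 : meromorphicOrderAt h z = 0 := le_antisymm (not_lt.1 t0) hneg
    have g1 := order_deriv_nonneg hh hneg
    have e1 : meromorphicOrderAt (deriv h) z = 0 := le_antisymm (not_lt.1 t1) g1
    have g2 := order_deriv_nonneg hm1 g1
    have e2 : meromorphicOrderAt (deriv (deriv h)) z = 0 := le_antisymm (not_lt.1 t2) g2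
    rw [e0, e1, e2]; simp
  · cases hn : meromorphicOrderAt h z with
    | top => rw [hn] at hneg; simp at hneg
    | coe n =>
      rw [hn] at hneg
      have hn0 : n < 0 := by
        have := not_le.1 hneg
        exact_mod_cast this
      have e1 := meromorphicOrderAt_deriv_eq_sub_one (𝕜 := ℂ) (by exact_mod_cast hn0.ne) hn
      have e2 := meromorphicOrderAt_deriv_eq_sub_one (𝕜 := ℂ)
        (by exact_mod_cast (by omega : n - 1 ≠ 0)) e1
      rw [e1, e2]
      have : (n + (n - 1 - 1) + -(2 * (n - 1)) : ℤ) = 0 := by ring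
      have h3 : (((n + (n - 1 - 1) + -(2 * (n - 1)) : ℤ)) : WithTop ℤ) = 0 := by rw [this]; rfl
      rw [← h3]
      rfl

/-- The Cayley transform from the disc to the upper half plane. -/
noncomputable def cinv (z : ℂ) : ℂ := I * (1 + z) / (1 - z)

theorem one_sub_ne {z : ℂ} (hz : z ∈ Metric.ball (0:ℂ) 1) : 1 - z ≠ 0 := by
  intro h
  have : z = 1 := (sub_eq_zero.1 h).symm
  rw [this] at hz
  simp at hz

theorem cinv_analytic {z : ℂ} (hz : z ∈ Metric.ball (0:ℂ) 1) : AnalyticAt ℂ cinv z := by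
  unfold cinv
  have := one_sub_ne hz
  fun_prop (disch := assumption)

theorem cinv_hasDeriv {z : ℂ} (hz : z ∈ Metric.ball (0:ℂ) 1) :
    HasDerivAt cinv (2 * I / (1 - z) ^ 2) z := by
  have h := one_sub_ne hz
  have h1 : HasDerivAt (fun z : ℂ => I * (1 + z)) (I * 1) z :=
    ((hasDerivAt_id z).const_add 1).const_mul I
  have h2 : HasDerivAt (fun z : ℂ => 1 - z) (-1) z := (hasDerivAt_id z).const_sub 1
  convert! h1.div h2 h using 1
  ring

theorem cinv_deriv_ne {z : ℂ} (hz : z ∈ Metric.ball (0:ℂ) 1) : deriv cinv z ≠ 0 := by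
  rw [(cinv_hasDeriv hz).deriv]
  have h := one_sub_ne hz
  simp [h]

theorem cinv_im {z : ℂ} (hz : z ∈ Metric.ball (0:ℂ) 1) : 0 < (cinv z).im := by
  have h := one_sub_ne hz
  have h1 : ‖z‖ < 1 := by simpa using hz
  have e : (cinv z).im = (1 - ‖z‖ ^ 2) / Complex.normSq (1 - z) := by
    unfold cinv
    rw [Complex.div_im, ← Complex.normSq_eq_norm_sq, Complex.normSq_apply z]
    simp
    ring
  rw [e]
  apply div_pos _ (Complex.normSq_pos.2 h)
  nlinarith [norm_nonneg z]

theorem cinv_injOn : Set.InjOn cinv (Metric.ball 0 1) := by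
  intro a ha b hb hab
  have h1 := one_sub_ne ha
  have h2 := one_sub_ne hb
  unfold cinv at hab
  field_simp at hab
  linear_combination hab / 2

/-- The transferred germ. -/
noncomputable def tr (h : ℂ → ℂ) (hh : Mer h) : MG :=
  gm (fun z => h (cinv z)) ((hh (cinv 0)).comp_analyticAt (cinv_analytic (by simp)))

theorem dd_tr {h : ℂ → ℂ} (hh : Mer h) : dd (tr h hh) = tr (deriv h) hh.deriv := by
  unfold tr
  rw [dd_gm, gm_eq]
  have hb : ∀ᶠ z in 𝓝[≠] (0:ℂ), z ∈ Metric.ball (0:ℂ) 1 :=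
    nhdsWithin_le_nhds (Metric.ball_mem_nhds 0 one_pos)
  have hd : ∀ᶠ z in 𝓝[≠] (0:ℂ), DifferentiableAt ℂ h (cinv z) := by
    have ht : Tendsto cinv (𝓝[≠] 0) (𝓝[≠] (cinv 0)) := by
      apply tendsto_nhdsWithin_of_tendsto_nhds_of_eventually_within
      · exact (cinv_analytic (by simp)).continuousAt.tendsto.mono_left nhdsWithin_le_nhds
      · filter_upwards [hb, self_mem_nhdsWithin] with z hz h0 h1
        exact h0 (cinv_injOn hz (by simp) h1)
    exact ht.eventually (ev_diff (hh _))
  filter_upwards [hb, hd] with z hz hdz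
  have := (hdz.hasDerivAt.comp z (cinv_hasDeriv hz)).deriv
  have e : deriv (fun z => h (cinv z)) z = deriv h (cinv z) * (2 * I / (1 - z) ^ 2) := this
  rw [e]
  unfold kap
  have := one_sub_ne hz
  have hI := Complex.I_ne_zero
  field_simp

theorem tr_ne {h : ℂ → ℂ} (hh : Mer h) (h0 : ¬ MeroEq h (fun _ => 0)) : tr h hh ≠ 0 := by
  unfold tr
  rw [gm_ne_zero]
  refine (meromorphicOrderAt_ne_top_iff_eventually_ne_zero
    ((hh (cinv 0)).comp_analyticAt (cinv_analytic (by simp)))).1 ?_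
  have := meromorphicOrderAt_comp_of_deriv_ne_zero (f := h) (x := (0:ℂ)) (cinv_analytic (by simp))
    (cinv_deriv_ne (by simp))
  change meromorphicOrderAt (h ∘ cinv) 0 ≠ ⊤
  rw [this]
  exact hh.ne_top h0 _

theorem tr_disc {h : ℂ → ℂ} (hh : Mer h) (h0 : ¬ MeroEq h (fun _ => 0))
    (hfin : {z : ℂ | 0 < z.im ∧ meromorphicOrderAt h z ≠ 0}.Finite) :
    ∃ s, DifferentiableOn ℂ s (Metric.ball 0 1) ∧ ∃ hes : MeromorphicAt (fun z => exp (s z)) 0,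
      ∃ x ∈ S0, x ≠ 0 ∧ tr h hh = x * gm _ hes := by
  have ho : ∀ z ∈ Metric.ball (0:ℂ) 1, meromorphicOrderAt (fun z => h (cinv z)) z =
      meromorphicOrderAt h (cinv z) := fun z hz =>
    meromorphicOrderAt_comp_of_deriv_ne_zero (f := h) (cinv_analytic hz) (cinv_deriv_ne hz)
  apply disc_factor (h := fun z => h (cinv z))
    (fun z hz => (hh (cinv z)).comp_analyticAt (cinv_analytic hz))
  · intro z hz
    rw [ho z hz]
    exact hh.ne_top h0 _
  · apply Set.Finite.of_finite_image (f := cinv)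
    · apply hfin.subset
      rintro _ ⟨z, ⟨hz, hz2⟩, rfl⟩
      refine ⟨cinv_im hz, ?_⟩
      rw [ho z hz] at hz2
      exact hz2
    · exact cinv_injOn.mono fun z hz => hz.1

theorem phi_ne {f : ℂ → ℂ} (hf : Mer f) (ht : ¬ IsRatFn f) (j : ℕ) :
    ¬ MeroEq (phi f j) (fun _ => 0) := by
  intro h
  have := (h 0).and ((hf.iter j).ev_ne (iter_ne hf ht j) 0 |>.and
    ((hf.iter (j+1)).ev_ne (iter_ne hf ht (j+1)) 0 |>.and
    ((hf.iter (j+2)).ev_ne (iter_ne hf ht (j+2)) 0)))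
  obtain ⟨w, h1, h2, h3, h4⟩ := this.exists
  unfold phi at h1
  simp [h2, h3, h4] at h1

theorem phi_fin {f : ℂ → ℂ} (hf : Mer f) (j : ℕ)
    (h : ∀ i, i ≤ j + 2 → {z : ℂ | 0 < meromorphicOrderAt (iteratedDeriv i f) z ∧ z.im ≠ 0}.Finite) :
    {z : ℂ | z.im ≠ 0 ∧ meromorphicOrderAt (phi f j) z ≠ 0}.Finite := by
  apply ((h j (by omega)).union ((h (j+1) (by omega)).union (h (j+2) (by omega)))).subset
  rintro z ⟨hz, hz2⟩
  by_contra hc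
  simp only [Set.mem_union, Set.mem_setOf_eq, not_or, not_and, not_not] at hc
  obtain ⟨c0, c1, c2⟩ := hc
  apply hz2
  unfold phi
  have e1 : iteratedDeriv (j+1) f = deriv (iteratedDeriv j f) := iteratedDeriv_succ
  have e2 : iteratedDeriv (j+2) f = deriv (deriv (iteratedDeriv j f)) := by
    rw [← e1]; exact iteratedDeriv_succ
  rw [e1] at c1 ⊢
  rw [e2] at c2 ⊢
  exact phi_order (hf.iter j z) (fun h => hz (c0 h)) (fun h => hz (c1 h)) (fun h => hz (c2 h))

theorem tr_phi {f : ℂ → ℂ} (hf : Mer f) (j : ℕ) :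
    tr (phi f j) (hf.phi j) = tr _ (hf.iter j) * tr _ (hf.iter (j+2)) / tr _ (hf.iter (j+1)) ^ 2 := by
  unfold tr
  rw [gm_mul, gm_pow, gm_div, gm_eq]
  rfl

theorem phi_S0_pair {f : ℂ → ℂ} (hf : Mer f) (ht : ¬ IsRatFn f) (j : ℕ)
    (h : ∀ i, i ≤ j + 3 → {z : ℂ | 0 < meromorphicOrderAt (iteratedDeriv i f) z ∧ z.im ≠ 0}.Finite) :
    tr (phi f j) (hf.phi j) ∈ S0 ∧ tr (phi f (j+1)) (hf.phi (j+1)) ∈ S0 := by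
  obtain ⟨s, hs, hes, x, hx, x0, ex⟩ := tr_disc (hf.phi j) (phi_ne hf ht j)
    ((phi_fin hf j fun i hi => h i (by omega)).subset fun z hz => ⟨hz.1.ne', hz.2⟩)
  obtain ⟨t, hst, het, y, hy, y0, ey⟩ := tr_disc (hf.phi (j+1)) (phi_ne hf ht (j+1))
    ((phi_fin hf (j+1) fun i hi => h i (by omega)).subset fun z hz => ⟨hz.1.ne', hz.2⟩)
  rw [tr_phi hf] at ex ey
  rw [tr_phi hf, tr_phi hf]
  have ed : ∀ i, dd (tr _ (hf.iter i)) = tr _ (hf.iter (i+1)) := by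
    intro i
    rw [dd_tr]
    congr 1
    exact iteratedDeriv_succ.symm
  have hn : ∀ i, tr _ (hf.iter i) ≠ 0 := fun i => tr_ne _ (iter_ne hf ht i)
  exact disc_main _ _ _ _ (hn j) (hn (j+1)) (hn (j+2)) (hn (j+3)) (ed j) (ed (j+1)) (ed (j+2))
    hs hst hes het hx hy x0 y0 ex ey

theorem phi_S0 {f : ℂ → ℂ} (hf : Mer f) (ht : ¬ IsRatFn f) (M j : ℕ) (hj : j ≤ M + 1)
    (h : ∀ i, i ≤ M + 3 → {z : ℂ | 0 < meromorphicOrderAt (iteratedDeriv i f) z ∧ z.im ≠ 0}.Finite) :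
    tr (phi f j) (hf.phi j) ∈ S0 := by
  rcases j with _ | j
  · exact (phi_S0_pair hf ht 0 fun i hi => h i (by omega)).1
  · exact (phi_S0_pair hf ht j fun i hi => h i (by omega)).2

theorem disc_growth {s : ℂ → ℂ} (hs : DifferentiableOn ℂ s (Metric.ball 0 1))
    (he : MeromorphicAt (fun z => exp (s z)) 0) (hx : gm _ he ∈ S0) :
    ∃ C : ℝ, 0 ≤ C ∧ ∀ ζ : ℂ, ‖ζ‖ < 1 → ∀ v : ℝ, 0 < v → 1 ≤ v ^ 2 * (1 - ‖ζ‖) →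
      |(s ζ).re| ≤ C * v ^ 3 := by
  obtain ⟨C, hC, h⟩ := cav_bound (A := fun _ => 0) (fun _ => le_rfl) hs he hx
  refine ⟨20 * C, by positivity, ?_⟩
  intro ζ hζ v hv h1
  have hv1 : 1 ≤ v := by
    by_contra hlt
    push Not at hlt
    have : v ^ 2 < 1 := by nlinarith
    have h3 : v ^ 2 * (1 - ‖ζ‖) ≤ v ^ 2 * 1 := by
      apply mul_le_mul_of_nonneg_left _ (by positivity)
      linarith [norm_nonneg ζ]
    linarith
  set d : ℝ := 1 / v ^ 2 with hd
  have hd0 : 0 < d := by positivity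
  have hdv : d * v ^ 2 = 1 := by rw [hd]; field_simp
  have hd1 : d ≤ 1 := by rw [hd, div_le_one (by positivity)]; nlinarith
  have hd2 : d ≤ 1 - ‖ζ‖ := by
    rw [hd, div_le_iff₀ (by positivity)]; linarith
  have e : (1 + (0:ℝ)) / ((1 - d / 4) - (1 - d / 2)) = 4 * v ^ 2 := by
    have : (1 - d / 4) - (1 - d / 2) = d / 4 := by ring
    rw [this, hd]; field_simp; ring
  have hc := h (1 - d / 2) (1 - d / 4) (by linarith) (by linarith) (by linarith)
  rw [e] at hc
  have hp := poisson_bound hs (r := 1 - d / 2) (ζ := ζ) (by linarith) (by linarith)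
  have hl : Real.log (4 * v ^ 2) ≤ 4 * v := by
    have : (4 * v ^ 2 : ℝ) = (2 * v) ^ 2 := by ring
    rw [this, Real.log_pow]
    have := Real.log_le_sub_one_of_pos (show (0:ℝ) < 2 * v by positivity)
    push_cast; linarith
  have hq : (1 - d / 2 + ‖ζ‖) / (1 - d / 2 - ‖ζ‖) ≤ 4 * v ^ 2 := by
    rw [div_le_iff₀ (by linarith)]
    have : 4 * v ^ 2 * (1 - d / 2 - ‖ζ‖) ≥ 4 * v ^ 2 * (d / 2) :=
      mul_le_mul_of_nonneg_left (by linarith) (by positivity)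
    have h5 : 4 * v ^ 2 * (d / 2) = 2 := by linear_combination 2 * hdv
    linarith
  have hc2 : cav s (1 - d / 2) ≤ C * (5 * v) := by
    refine hc.trans ?_
    apply mul_le_mul_of_nonneg_left _ hC
    linarith
  calc |(s ζ).re| ≤ _ := hp
    _ ≤ (4 * v ^ 2) * (C * (5 * v)) :=
      mul_le_mul hq hc2 (cav_nonneg _ _) (by positivity)
    _ = 20 * C * v ^ 3 := by ring

theorem half_growth {S : ℂ → ℂ} (hS : Differentiable ℂ S)
    (he : MeromorphicAt (fun z => exp (S (cinv z))) 0) (hx : gm _ he ∈ S0) :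
    ∃ C : ℝ, 0 ≤ C ∧ ∀ z : ℂ, 0 < z.im → ∀ η : ℝ, 0 < η → η ^ 2 ≤ 2 * z.im →
      |(S z).re| ≤ C * (‖z + I‖ / η) ^ 3 := by
  obtain ⟨C, hC, h⟩ := disc_growth (s := fun z => S (cinv z))
    (fun z hz => (hS.differentiableAt.comp z
      (cinv_hasDeriv hz).differentiableAt).differentiableWithinAt) he hx
  refine ⟨C, hC, ?_⟩
  intro z hz η hη h2
  have hne : z + I ≠ 0 := by
    intro h0
    have := congrArg Complex.im h0
    simp at this
    linarith
  have hN : 0 < ‖z + I‖ := norm_pos_iff.2 hne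
  set ζ : ℂ := (z - I) / (z + I) with hζ
  have hcz : cinv ζ = z := by
    have h1 : 1 - ζ = 2 * I / (z + I) := by rw [hζ]; field_simp; ring
    have h3 : 1 + ζ = 2 * z / (z + I) := by rw [hζ]; field_simp; ring
    unfold cinv
    rw [h1, h3]
    have hI := Complex.I_ne_zero
    field_simp
  have hsq : ‖z - I‖ ^ 2 = ‖z + I‖ ^ 2 - 4 * z.im := by
    rw [← Complex.normSq_eq_norm_sq, ← Complex.normSq_eq_norm_sq, Complex.normSq_apply,
      Complex.normSq_apply]
    simp; ring
  have hn : ‖ζ‖ * ‖z + I‖ = ‖z - I‖ := by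
    rw [hζ, norm_div]; field_simp
  have hlt : ‖ζ‖ < 1 := by
    by_contra hge
    push Not at hge
    have : ‖z + I‖ ≤ ‖z - I‖ := by rw [← hn]; nlinarith
    nlinarith
  have hd : 2 * z.im ≤ (1 - ‖ζ‖) * ‖z + I‖ ^ 2 := by
    have : (1 - ‖ζ‖) * (1 + ‖ζ‖) * ‖z + I‖ ^ 2 = 4 * z.im := by
      have : (1 - ‖ζ‖) * (1 + ‖ζ‖) * ‖z + I‖ ^ 2 = ‖z + I‖ ^ 2 - (‖ζ‖ * ‖z + I‖) ^ 2 := by ring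
      rw [this, hn, hsq]; ring
    have h6 : (1 - ‖ζ‖) * (1 + ‖ζ‖) * ‖z + I‖ ^ 2 ≤ (1 - ‖ζ‖) * 2 * ‖z + I‖ ^ 2 := by
      apply mul_le_mul_of_nonneg_right _ (by positivity)
      apply mul_le_mul_of_nonneg_left _ (by linarith)
      linarith
    linarith
  have := h ζ hlt (‖z + I‖ / η) (by positivity) (by
    rw [div_pow, div_mul_eq_mul_div, le_div_iff₀ (by positivity)]
    linarith)
  rw [hcz] at this
  exact this

theorem half_deriv {S : ℂ → ℂ} (hS : Differentiable ℂ S)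
    (he : MeromorphicAt (fun z => exp (S (cinv z))) 0) (hx : gm _ he ∈ S0) :
    ∃ C : ℝ, 0 ≤ C ∧ ∀ z : ℂ, 0 < z.im → ∀ t : ℝ, 1 ≤ t → ‖z‖ = t ^ 2 →
      ‖deriv S z‖ * z.im ^ 3 ≤ C * t ^ 7 := by
  obtain ⟨C, hC, h⟩ := half_growth hS he hx
  refine ⟨432 * (C + 1), by positivity, ?_⟩
  intro z hz t ht hzt
  set y := z.im with hy
  obtain ⟨η, hη, hηy⟩ : ∃ η : ℝ, 0 < η ∧ η ^ 2 = y :=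
    ⟨Real.sqrt y, Real.sqrt_pos.2 hz, Real.sq_sqrt hz.le⟩
  have hyρ : y ≤ t ^ 2 := by
    rw [← hzt]; exact (le_abs_self _).trans (Complex.abs_im_le_norm z)
  have hηt : η ≤ t := by
    by_contra hlt
    push Not at hlt
    nlinarith
  set B : ℝ := (C + 1) * (3 * t ^ 2 / η) ^ 3 with hB
  have hB0 : 0 < B := by positivity
  have hre : ∀ w, ‖w‖ < y / 2 → |(S (z + w)).re| ≤ B := by
    intro w hw
    have h1 : |w.im| ≤ ‖w‖ := Complex.abs_im_le_norm w
    have h2 := (abs_le.1 h1).1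
    have h3 : (z + w).im = y + w.im := by simp [hy]
    have h4 : y / 2 < (z + w).im := by rw [h3]; linarith
    have h5 := h (z + w) (by linarith) η hη (by linarith)
    have h6 : ‖z + w + I‖ ≤ 3 * t ^ 2 := by
      calc ‖z + w + I‖ ≤ ‖z‖ + ‖w‖ + ‖I‖ := norm_add₃_le
        _ ≤ t ^ 2 + t ^ 2 / 2 + 1 := by rw [hzt, Complex.norm_I]; linarith
        _ ≤ 3 * t ^ 2 := by nlinarith
    calc |(S (z + w)).re| ≤ C * (‖z + w + I‖ / η) ^ 3 := h5
      _ ≤ (C + 1) * (3 * t ^ 2 / η) ^ 3 := by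
        apply mul_le_mul (by linarith) _ (by positivity) (by positivity)
        gcongr
  have hbc : ∀ w, ‖w‖ ≤ y / 4 → ‖S (z + w) - S z‖ ≤ 4 * B := by
    intro w hw
    have := Complex.borelCaratheodory (f := fun w => S (z + w) - S z) (M := 2 * B) (R := y / 2)
      (z := w) (by linarith)
      (by
        have : Differentiable ℂ (fun w => S (z + w) - S z) :=
          (hS.comp (differentiable_id.const_add z)).sub_const _
        exact this.differentiableOn)
      (by
        intro w hw
        have hw' : ‖w‖ < y / 2 := by simpa using hw
        have h1 := hre w hw'
        have h2 := hre 0 (by simp; linarith)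
        rw [add_zero] at h2
        simp only [Set.mem_setOf_eq, Complex.sub_re]
        linarith [(abs_le.1 h1).2, (abs_le.1 h2).1])
      (by linarith) (by simp; linarith)
    simp only [add_zero, sub_self, norm_zero, zero_mul, zero_div, add_zero] at this
    refine this.trans ?_
    rw [div_le_iff₀ (by linarith)]
    nlinarith
  have hcau := Complex.norm_deriv_le_of_forall_mem_sphere_norm_le (f := fun w => S w - S z)
    (c := z) (R := y / 4) (C := 4 * B) (by linarith)
    ((hS.sub_const _).diffContOnCl) (by
      intro w hw
      have hw' : ‖w - z‖ = y / 4 := by simpa [dist_eq_norm] using hw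
      have := hbc (w - z) hw'.le
      simpa using this)
  rw [deriv_sub_const] at hcau
  have hy3 : 0 ≤ y ^ 3 := by positivity
  calc ‖deriv S z‖ * y ^ 3 ≤ 4 * B / (y / 4) * y ^ 3 := mul_le_mul_of_nonneg_right hcau hy3
    _ = 432 * (C + 1) * t ^ 6 * η := by
      rw [hB, ← hηy]; field_simp; ring
    _ ≤ 432 * (C + 1) * t ^ 6 * t := by gcongr
    _ = _ := by ring

theorem entire_const {H : ℂ → ℂ} (hH : Differentiable ℂ H) {C : ℝ} (hC : 0 ≤ C)
    (h : ∀ z : ℂ, ∀ t : ℝ, 1 ≤ t → ‖z‖ = t ^ 2 → ‖H z‖ * |z.im| ^ 3 ≤ C * t ^ 7) :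
    ∀ z, H z = H 0 := by
  have hb : ∀ t : ℝ, 1 ≤ t → ∀ z, ‖z‖ ≤ t ^ 2 / 2 → ‖H z‖ ≤ 64 * C * t := by
    intro t ht z hz
    have ht0 : 0 < t := by linarith
    have hG : Differentiable ℂ (fun w => H w * (w ^ 2 - (t:ℂ) ^ 4) ^ 3) := by fun_prop
    have hm := Complex.norm_le_of_forall_mem_frontier_norm_le (f := fun w => H w * (w ^ 2 - (t:ℂ) ^ 4) ^ 3)
      (U := Metric.ball (0:ℂ) (t ^ 2)) Metric.isBounded_ball hG.diffContOnCl (C := 8 * C * t ^ 13)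
      (by
        intro w hw
        rw [frontier_ball _ (by positivity)] at hw
        have hw' : ‖w‖ = t ^ 2 := by simpa using hw
        have h1 := h w t ht hw'
        have h2 : ‖w ^ 2 - (t:ℂ) ^ 4‖ = 2 * t ^ 2 * |w.im| := by
          have e1 : (t:ℂ) ^ 4 = w * (starRingEnd ℂ) w := by
            rw [Complex.mul_conj, Complex.normSq_eq_norm_sq, hw']; push_cast; ring
          have e2 : w ^ 2 - (t:ℂ) ^ 4 = w * (w - (starRingEnd ℂ) w) := by rw [e1]; ring
          rw [e2, norm_mul, hw', Complex.sub_conj]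
          simp
          ring
        simp only [norm_mul, norm_pow]
        rw [h2]
        calc ‖H w‖ * (2 * t ^ 2 * |w.im|) ^ 3 = 8 * t ^ 6 * (‖H w‖ * |w.im| ^ 3) := by ring
          _ ≤ 8 * t ^ 6 * (C * t ^ 7) := by gcongr
          _ = _ := by ring)
      (z := z) (subset_closure (by simp; nlinarith [sq_pos_of_pos ht0]))
    simp only [norm_mul, norm_pow] at hm
    have h3 : t ^ 4 / 2 ≤ ‖z ^ 2 - (t:ℂ) ^ 4‖ := by
      have e1 : ‖(t:ℂ) ^ 4‖ = t ^ 4 := by rw [norm_pow, Complex.norm_real, Real.norm_of_nonneg ht0.le]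
      have e2 : ‖z ^ 2‖ ≤ t ^ 4 / 4 := by
        rw [norm_pow]
        calc ‖z‖ ^ 2 ≤ (t ^ 2 / 2) ^ 2 := by gcongr
          _ = _ := by ring
      have e3 := norm_sub_norm_le ((t:ℂ) ^ 4) (z ^ 2)
      rw [norm_sub_rev] at e3
      have : 0 < t ^ 4 := by positivity
      linarith
    have h4 : ‖H z‖ * (t ^ 4 / 2) ^ 3 ≤ 8 * C * t ^ 13 := by
      refine le_trans ?_ hm
      gcongr
    have h5 : ‖H z‖ * (t ^ 12) ≤ 64 * C * t * t ^ 12 := by nlinarith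
    exact le_of_mul_le_mul_right h5 (by positivity)
  have hd : ∀ z, deriv H z = 0 := by
    intro z
    by_contra hne
    have hpos : 0 < ‖deriv H z‖ := norm_pos_iff.2 hne
    obtain ⟨t, h1, h2, h3⟩ : ∃ t : ℝ, 1 ≤ t ∧ 4 * ‖z‖ ≤ t ∧ 256 * C / ‖deriv H z‖ < t := by
      refine ⟨max 1 (max (4 * ‖z‖) (256 * C / ‖deriv H z‖ + 1)), le_max_left _ _, ?_, ?_⟩
      · exact (le_max_left _ _).trans (le_max_right _ _)
      · refine lt_of_lt_of_le (lt_add_one _) ((le_max_right _ _).trans (le_max_right _ _))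
    have ht0 : 0 < t := by linarith
    have := Complex.norm_deriv_le_of_forall_mem_sphere_norm_le (f := H) (c := z) (R := t ^ 2 / 4)
      (C := 64 * C * t) (by positivity) hH.diffContOnCl (by
        intro w hw
        have hw' : ‖w - z‖ = t ^ 2 / 4 := by simpa [dist_eq_norm] using hw
        apply hb t h1
        have : ‖w‖ ≤ ‖w - z‖ + ‖z‖ := by simpa using norm_add_le (w - z) z
        nlinarith)
    have e : 64 * C * t / (t ^ 2 / 4) = 256 * C / t := by field_simp; ring
    rw [e, le_div_iff₀ ht0] at this
    rw [div_lt_iff₀ hpos] at h3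
    linarith
  intro z
  exact is_const_of_deriv_eq_zero hH hd z 0

theorem tr_prod_mem (T : Finset ℂ) (n : ℂ → ℤ) :
    tr (fun w => ∏ u ∈ T, (w - u) ^ n u) (prod_mer T n) ∈ S0 := by
  have hlin : ∀ u : ℂ, ∀ hm : Mer (fun w => w - u), tr (fun w => w - u) hm ∈ S0 := by
    intro u hm
    have h1 : MeromorphicAt (fun w : ℂ => w - (-1)) 0 := by fun_prop
    have h2 : MeromorphicAt (fun w : ℂ => w - 1) 0 := by fun_prop
    have hc : ∀ c : ℂ, gm (fun _ => c) (MeromorphicAt.const c 0) ∈ S0 := fun c => slow_mem (slow_const c)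
    have : tr (fun w => w - u) hm =
        gm (fun _ => -I) (MeromorphicAt.const _ 0) * gm _ h1 / gm _ h2 +
        gm (fun _ => -u) (MeromorphicAt.const _ 0) := by
      unfold tr
      rw [gm_mul, gm_div, gm_add, gm_eq]
      have hb : ∀ᶠ z in 𝓝[≠] (0:ℂ), z ∈ Metric.ball (0:ℂ) 1 :=
        nhdsWithin_le_nhds (Metric.ball_mem_nhds 0 one_pos)
      filter_upwards [hb] with z hz
      have h3 := one_sub_ne hz
      have h4 : z - 1 ≠ 0 := fun h => h3 (by linear_combination -h)
      unfold cinv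
      field_simp
      ring
    rw [this]
    exact add_mem (div_mem (mul_mem (hc _) (gm_lin_mem _ _)) (gm_lin_mem _ _)) (hc _)
  induction T using Finset.induction_on with
  | empty => simp only [Finset.prod_empty]; exact one_mem S0
  | insert a T ha ih =>
    have h1 : Mer (fun w => w - a) := fun z => by fun_prop
    have : tr _ (prod_mer (insert a T) n) = tr _ h1 ^ n a * tr _ (prod_mer T n) := by
      unfold tr
      rw [gm_zpow, gm_mul, gm_eq]
      filter_upwards with w
      rw [Finset.prod_insert ha]
    rw [this]
    exact mul_mem (zpow_mem (hlin _ _) _) ih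

theorem tr_congr {a b : ℂ → ℂ} (ha : Mer a) (hb : Mer b) (h : MeroEq a b) : tr a ha = tr b hb := by
  have hs : Mer (fun w => a w - b w) := fun z => (ha z).sub (hb z)
  have h0 : MeroEq (fun w => a w - b w) (fun _ => 0) := fun z => by
    filter_upwards [h z] with w hw; simp [hw]
  have := meromorphicOrderAt_comp_of_deriv_ne_zero (f := fun w => a w - b w) (x := (0:ℂ))
    (cinv_analytic (by simp)) (cinv_deriv_ne (by simp))
  rw [meromorphicOrderAt_eq_top_iff.2 (h0 (cinv 0)), meromorphicOrderAt_eq_top_iff] at this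
  unfold tr
  rw [gm_eq]
  filter_upwards [this] with w hw
  exact sub_eq_zero.1 hw

theorem exp_mem_S0 {a b S : ℂ → ℂ} (hS : Differentiable ℂ S) (ha : Mer a) (hb : Mer b)
    (ta : tr a ha ∈ S0) (tb : tr b hb ∈ S0) (b0 : ¬ MeroEq b (fun _ => 0)) (T : Finset ℂ) (n : ℂ → ℤ)
    (h : MeroEq a (fun z => (∏ u ∈ T, (z - u) ^ n u) * exp (S z) * b z)) :
    ∃ he : MeromorphicAt (fun z => exp (S (cinv z))) 0, gm _ he ∈ S0 := by
  have hE : Mer (fun z => exp (S z)) := fun z => (hS.cexp.analyticAt z).meromorphicAt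
  refine ⟨(hE (cinv 0)).comp_analyticAt (cinv_analytic (by simp)), ?_⟩
  have e : tr a ha = tr _ (prod_mer T n) * tr _ hE * tr b hb := by
    rw [tr_congr ha (fun z => ((prod_mer T n z).mul (hE z)).mul (hb z)) h]
    rfl
  have h1 : tr b hb ≠ 0 := tr_ne hb b0
  have h2 : tr _ (prod_mer T n) ≠ 0 := by
    apply tr_ne
    intro h0
    obtain ⟨w, h3, h4⟩ := ((h0 0).and (prod_ev_ne T n 0)).exists
    exact h4 h3
  have : tr _ hE = tr a ha / (tr _ (prod_mer T n) * tr b hb) := by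
    rw [e]; field_simp
  change tr _ hE ∈ S0
  rw [this]
  exact div_mem ta (mul_mem (tr_prod_mem T n) tb)

theorem mtilde_rat {f : ℂ → ℂ} (h : IsRatFn f) : IsRatFn (mtilde f) := by
  obtain ⟨p, q, hq, h⟩ := h
  have hc : ∀ (p : Polynomial ℂ) z, (p.map (starRingEnd ℂ)).eval z =
      (starRingEnd ℂ) (p.eval ((starRingEnd ℂ) z)) := by
    intro p z
    rw [Polynomial.eval_map, ← Polynomial.eval₂_at_apply, Complex.conj_conj]
  refine ⟨p.map (starRingEnd ℂ), q.map (starRingEnd ℂ),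
    (Polynomial.map_ne_zero_iff (starRingEnd ℂ).injective).2 hq, ?_⟩
  intro z
  filter_upwards [(tendsto_conj_ne z).eventually (h _)] with w hw
  rw [hc, hc, mtilde, hw, map_div₀]

theorem phi_tilde (f : ℂ → ℂ) (j : ℕ) : phi (mtilde f) j = mtilde (phi f j) := by
  funext z
  unfold phi
  simp only [mtilde_iter]
  simp [mtilde]

theorem Fm_deriv {f : ℂ → ℂ} (hf : Mer f) (j : ℕ) (h1 : ¬ MeroEq (iteratedDeriv (j+1) f) (fun _ => 0)) :
    MeroEq (deriv (Fm f j)) (phi f j) := by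
  intro z
  filter_upwards [ev_diff (hf.iter j z), ev_diff (hf.iter (j+1) z), (hf.iter (j+1)).ev_ne h1 z]
    with w d0 d1 hn
  have e0 : deriv (iteratedDeriv j f) w = iteratedDeriv (j+1) f w := by rw [iteratedDeriv_succ]
  have e1 : deriv (iteratedDeriv (j+1) f) w = iteratedDeriv (j+2) f w := by
    rw [← iteratedDeriv_succ]
  have hd : HasDerivAt (Fm f j) (1 - (iteratedDeriv (j+1) f w * iteratedDeriv (j+1) f w
      - iteratedDeriv j f w * iteratedDeriv (j+2) f w) / iteratedDeriv (j+1) f w ^ 2) w := by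
    rw [← e1]
    nth_rewrite 1 [← e0]
    exact (hasDerivAt_id w).sub (d0.hasDerivAt.div d1.hasDerivAt hn)
  rw [hd.deriv]
  unfold phi
  field_simp
  ring

theorem MeroEq.tilde' {a b : ℂ → ℂ} (h : MeroEq a b) : MeroEq (mtilde a) (mtilde b) := fun z => by
  filter_upwards [(tendsto_conj_ne z).eventually (h _)] with w hw
  simp [mtilde, hw]

/-- Standing hypotheses. -/
structure Std (M : ℕ) (f : ℂ → ℂ) : Prop where
  mer : Mer f
  tra : ¬ IsRatFn f
  fin : ∀ i, i ≤ M + 3 → {z : ℂ | 0 < meromorphicOrderAt (iteratedDeriv i f) z ∧ z.im ≠ 0}.Finite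

theorem Std.tilde {M : ℕ} {f : ℂ → ℂ} (h : Std M f) : Std M (mtilde f) := by
  refine ⟨h.mer.tilde, fun hr => h.tra ?_, fun i hi => ?_⟩
  · have := mtilde_rat hr
    rwa [mtilde_mtilde] at this
  · apply Set.Finite.of_finite_image (f := starRingEnd ℂ)
    · apply (h.fin i hi).subset
      rintro _ ⟨z, ⟨h1, h2⟩, rfl⟩
      rw [mtilde_iter, mtilde_order (h.mer.iter i)] at h1
      exact ⟨h1, by simpa using h2⟩
    · exact (starRingEnd ℂ).injective.injOn

theorem Std.ne {M : ℕ} {f : ℂ → ℂ} (h : Std M f) (j : ℕ) :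
    ¬ MeroEq (iteratedDeriv j f) (fun _ => 0) := iter_ne h.mer h.tra j

theorem Km_eq {M : ℕ} {f : ℂ → ℂ} (h : Std M f) {j : ℕ} {K : ℂ → ℂ} (hK : IsKm f j K) :
    MeroEq (phi f j) (fun z => K z * phi (mtilde f) j z) := by
  intro z
  filter_upwards [hK.2.2.2 z, Fm_deriv h.mer j (h.ne _) z, Fm_deriv h.tilde.mer j (h.tilde.ne _) z]
    with w h1 h2 h3
  rw [← h2, h1, h3]

theorem Km_ne {M : ℕ} {f : ℂ → ℂ} (h : Std M f) {j : ℕ} {K : ℂ → ℂ} (hK : IsKm f j K) :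
    ¬ MeroEq K (fun _ => 0) := by
  intro h0
  apply phi_ne h.mer h.tra j
  intro z
  filter_upwards [Km_eq h hK z, h0 z] with w h1 h2
  rw [h1, h2, zero_mul]

theorem Km_form {M : ℕ} {f : ℂ → ℂ} (h : Std M f) {j : ℕ} (hj : j ≤ M + 1) {K : ℂ → ℂ}
    (hK : IsKm f j K) :
    ∃ (T : Finset ℂ) (n : ℂ → ℤ) (l b : ℂ),
      MeroEq K (fun z => (∏ u ∈ T, (z - u) ^ n u) * exp (l * z + b)) := by
  have hKm : Mer K := hK.1
  obtain ⟨T, n, S, hS, hKS⟩ := mero_factor (U := Set.univ) isOpen_univ convex_univ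
    Set.univ_nonempty (fun z _ => hKm z) (fun z _ => hKm.ne_top (Km_ne h hK) z) (by
      apply (hK.2.1.union hK.2.2.1).subset
      rintro z ⟨-, hz⟩
      rw [← hKm.order] at hz
      rcases lt_or_gt_of_ne hz with h1 | h1
      · exact Or.inr h1
      · exact Or.inl h1)
  have hS : Differentiable ℂ S := differentiableOn_univ.1 hS
  have hKS : MeroEq K (fun w => (∏ u ∈ T, (w - u) ^ n u) * exp (S w)) := fun z => hKS z (Set.mem_univ z)
  have ha := phi_S0 h.mer h.tra M j hj h.fin
  have hb := phi_S0 h.tilde.mer h.tilde.tra M j hj h.tilde.fin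
  have hq := Km_eq h hK
  obtain ⟨he1, hm1⟩ := exp_mem_S0 hS _ _ ha hb (phi_ne h.tilde.mer h.tilde.tra j) T n (by
    intro z
    filter_upwards [hq z, hKS z] with w h1 h2
    rw [h1, h2])
  have hSt : Differentiable ℂ (mtilde S) := fun z =>
    (mtilde_analytic (hS.analyticAt _)).differentiableAt
  obtain ⟨he2, hm2⟩ := exp_mem_S0 hSt _ _ hb ha (phi_ne h.mer h.tra j)
    (T.image (starRingEnd ℂ)) (fun u => n (starRingEnd ℂ u)) (by
    intro z
    filter_upwards [hq.tilde' z, hKS.tilde' z] with w h1 h2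
    rw [phi_tilde, h1]
    rw [show mtilde (fun z => K z * phi (mtilde f) j z) w = mtilde K w * mtilde (phi (mtilde f) j) w by
      simp [mtilde], h2, phi_tilde, mtilde_mtilde]
    congr 1
    rw [Finset.prod_image (fun a _ b _ hab => (starRingEnd ℂ).injective hab)]
    simp only [mtilde, map_mul, map_prod, map_zpow₀, map_sub, Complex.conj_conj, ← Complex.exp_conj])
  obtain ⟨C1, hC1, g1⟩ := half_deriv hS he1 hm1
  obtain ⟨C2, hC2, g2⟩ := half_deriv hSt he2 hm2
  have hconst := entire_const (H := deriv S) (by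
      intro z; exact (hS.analyticAt z).deriv.differentiableAt) (C := C1 + C2) (by positivity) (by
    intro z t ht hzt
    rcases lt_trichotomy z.im 0 with h1 | h1 | h1
    · have := g2 (starRingEnd ℂ z) (by simpa using h1) t ht (by simpa using hzt)
      rw [mtilde_deriv] at this
      simp only [mtilde, Complex.conj_conj, Complex.conj_im, RCLike.norm_conj] at this
      rw [abs_of_neg h1]
      have : 0 ≤ C1 * t ^ 7 := by positivity
      linarith
    · rw [h1]; simp; positivity
    · have := g1 z h1 t ht hzt
      rw [abs_of_pos h1]
      have : 0 ≤ C2 * t ^ 7 := by positivity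
      linarith)
  refine ⟨T, n, deriv S 0, S 0, ?_⟩
  have hlin : ∀ z, S z = deriv S 0 * z + S 0 := by
    have hd : Differentiable ℂ (fun z => S z - deriv S 0 * z) := by fun_prop
    intro z
    have := is_const_of_deriv_eq_zero hd (fun z => by
      have h1 : HasDerivAt (fun z => S z - deriv S 0 * z) (deriv S z - deriv S 0 * 1) z :=
        hS.differentiableAt.hasDerivAt.sub ((hasDerivAt_id z).const_mul _)
      rw [h1.deriv, hconst z]; ring) z 0
    linear_combination this
  intro z
  filter_upwards [hKS z] with w hw
  rw [hw, hlin w]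

/-- The functions `R e^{lz+b}`. -/
noncomputable def kf (T : Finset ℂ) (n : ℂ → ℤ) (l b : ℂ) : ℂ → ℂ := fun z =>
  (∏ u ∈ T, (z - u) ^ n u) * exp (l * z + b)

/-- Logarithmic derivative of `kf`. -/
noncomputable def Lf (T : Finset ℂ) (n : ℂ → ℤ) (l : ℂ) : ℂ → ℂ := fun z =>
  l + ∑ u ∈ T, (n u : ℂ) / (z - u)

theorem prod_hasDeriv (T : Finset ℂ) (n : ℂ → ℤ) {z : ℂ} (hz : z ∉ T) :
    HasDerivAt (fun z => ∏ u ∈ T, (z - u) ^ n u)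
      ((∑ u ∈ T, (n u : ℂ) / (z - u)) * ∏ u ∈ T, (z - u) ^ n u) z := by
  induction T using Finset.induction_on with
  | empty => simpa using hasDerivAt_const z (1:ℂ)
  | insert a T ha ih =>
    rw [Finset.mem_insert, not_or] at hz
    have h1 := ih hz.2
    have hne : z - a ≠ 0 := sub_ne_zero.2 hz.1
    have h2 : HasDerivAt (fun z : ℂ => (z - a) ^ n a) ((n a : ℂ) * (z - a) ^ (n a - 1) * 1) z := by
      have h3 := hasDerivAt_zpow (n a) (z - a) (Or.inl hne)
      exact HasDerivAt.comp z (h₂ := fun y : ℂ => y ^ n a) (h := fun y => y - a) h3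
        ((hasDerivAt_id z).sub_const a)
    have h3 := h2.mul h1
    have e : (fun z => ∏ u ∈ insert a T, (z - u) ^ n u) =
      (fun z : ℂ => (z - a) ^ n a) * (fun z => ∏ u ∈ T, (z - u) ^ n u) := by
      funext w; simp [Finset.prod_insert ha]
    rw [e]
    convert! h3 using 1
    rw [Finset.sum_insert ha, Finset.prod_insert ha, zpow_sub_one₀ hne]
    field_simp

theorem kf_hasDeriv (T : Finset ℂ) (n : ℂ → ℤ) (l b : ℂ) {z : ℂ} (hz : z ∉ T) :
    HasDerivAt (kf T n l b) (Lf T n l z * kf T n l b z) z := by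
  have h1 := prod_hasDeriv T n hz
  have h2 : HasDerivAt (fun z : ℂ => exp (l * z + b)) (exp (l * z + b) * (l * 1)) z :=
    (((hasDerivAt_id z).const_mul l).add_const b).cexp
  convert! h1.mul h2 using 1
  unfold Lf kf
  ring

theorem kf_ne (T : Finset ℂ) (n : ℂ → ℤ) (l b : ℂ) {z : ℂ} (hz : z ∉ T) : kf T n l b z ≠ 0 := by
  apply mul_ne_zero _ (exp_ne_zero _)
  rw [Finset.prod_ne_zero_iff]
  intro u hu
  apply zpow_ne_zero
  rw [sub_ne_zero]
  rintro rfl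
  exact hz hu

theorem off_open (T : Finset ℂ) {z : ℂ} (hz : z ∉ T) : ∀ᶠ w in 𝓝 z, w ∉ T :=
  (T.finite_toSet.isClosed.isOpen_compl).mem_nhds hz

theorem off_ev (T : Finset ℂ) (z : ℂ) : ∀ᶠ w in 𝓝[≠] z, w ∉ T := by
  have : ∀ᶠ w in 𝓝[≠] z, ∀ u ∈ T, w ≠ u := by
    rw [Filter.eventually_all_finset]
    intro u _
    by_cases h : u = z
    · subst h
      exact self_mem_nhdsWithin
    · exact nhdsWithin_le_nhds (isOpen_ne.mem_nhds (Ne.symm h))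
  filter_upwards [this] with w hw hwT using hw w hwT rfl

theorem kf_analytic (T : Finset ℂ) (n : ℂ → ℤ) (l b : ℂ) {z : ℂ} (hz : z ∉ T) :
    AnalyticAt ℂ (kf T n l b) z := by
  rw [Complex.analyticAt_iff_eventually_differentiableAt]
  filter_upwards [off_open T hz] with w hw using (kf_hasDeriv T n l b hw).differentiableAt

theorem kf_mer (T : Finset ℂ) (n : ℂ → ℤ) (l b : ℂ) : Mer (kf T n l b) := fun z => by
  unfold kf
  exact (prod_mer T n z).mul (by fun_prop)

theorem Lf_poly (T : Finset ℂ) (n : ℂ → ℤ) (l : ℂ) :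
    ∃ P : Polynomial ℂ, ∀ z, z ∉ T → P.eval z = Lf T n l z * ∏ u ∈ T, (z - u) := by
  induction T using Finset.induction_on with
  | empty => exact ⟨Polynomial.C l, by simp [Lf]⟩
  | insert a T ha ih =>
    obtain ⟨P, hP⟩ := ih
    refine ⟨P * (Polynomial.X - Polynomial.C a) + Polynomial.C (n a : ℂ) *
      ∏ u ∈ T, (Polynomial.X - Polynomial.C u), ?_⟩
    intro z hz
    rw [Finset.mem_insert, not_or] at hz
    have hne : z - a ≠ 0 := sub_ne_zero.2 hz.1
    have := hP z hz.2
    unfold Lf at this ⊢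
    rw [Finset.sum_insert ha, Finset.prod_insert ha]
    simp only [Polynomial.eval_add, Polynomial.eval_mul, Polynomial.eval_sub, Polynomial.eval_X,
      Polynomial.eval_C, Polynomial.eval_prod, this]
    field_simp
    ring

theorem Lf_fin (T : Finset ℂ) (n : ℂ → ℤ) (l b : ℂ)
    (hc : ¬ ∃ c : ℂ, MeroEq (kf T n l b) (fun _ => c)) : {z | z ∉ T ∧ Lf T n l z = 0}.Finite := by
  obtain ⟨P, hP⟩ := Lf_poly T n l
  have hP0 : P ≠ 0 := by
    rintro rfl
    apply hc
    apply mer_const (kf_mer T n l b)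
    intro z
    filter_upwards [off_ev T z] with w hw
    have h1 := hP w hw
    have h2 : ∏ u ∈ T, (w - u) ≠ 0 := by
      rw [Finset.prod_ne_zero_iff]
      intro u hu
      rw [sub_ne_zero]
      rintro rfl
      exact hw hu
    have h3 : Lf T n l w = 0 := by
      rw [Polynomial.eval_zero] at h1
      exact (mul_eq_zero.1 h1.symm).resolve_right h2
    rw [(kf_hasDeriv T n l b hw).deriv, h3, zero_mul]
  apply (P.roots.toFinset.finite_toSet).subset
  rintro z ⟨h1, h2⟩
  have := hP z h1
  simp [hP0, this, h2]

theorem tendsto_inv_cob (u : ℂ) (k : ℕ) (hk : k ≠ 0) :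
    Tendsto (fun z : ℂ => 1 / (z - u) ^ k) (Bornology.cobounded ℂ) (𝓝 0) := by
  have h1 : Tendsto (fun z : ℂ => z - u) (Bornology.cobounded ℂ) (Bornology.cobounded ℂ) := by
    rw [← tendsto_norm_atTop_iff_cobounded]
    apply tendsto_atTop_mono (f := fun z : ℂ => ‖z‖ - ‖u‖) (fun z => norm_sub_norm_le z u)
    exact tendsto_atTop_add_const_right _ _ tendsto_norm_cobounded_atTop
  have h2 := (tendsto_inv₀_cobounded (α := ℂ)).comp h1
  have h3 := h2.pow k
  rw [zero_pow hk] at h3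
  refine h3.congr fun z => ?_
  simp

/-- Derivatives of `Lf`. -/
noncomputable def Lf1 (T : Finset ℂ) (n : ℂ → ℤ) : ℂ → ℂ := fun z =>
  ∑ u ∈ T, (-(n u : ℂ)) * (1 / (z - u) ^ 2)

/-- Second derivative of `Lf`. -/
noncomputable def Lf2 (T : Finset ℂ) (n : ℂ → ℤ) : ℂ → ℂ := fun z =>
  ∑ u ∈ T, (2 * (n u : ℂ)) * (1 / (z - u) ^ 3)

theorem Lf_hasDeriv (T : Finset ℂ) (n : ℂ → ℤ) (l : ℂ) {z : ℂ} (hz : z ∉ T) :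
    HasDerivAt (Lf T n l) (Lf1 T n z) z := by
  unfold Lf Lf1
  apply HasDerivAt.const_add
  apply HasDerivAt.fun_sum
  intro u hu
  have hne : z - u ≠ 0 := by rw [sub_ne_zero]; rintro rfl; exact hz hu
  convert! (hasDerivAt_const z (n u : ℂ)).div ((hasDerivAt_id z).sub_const u) hne using 1
  simp; field_simp

theorem Lf1_hasDeriv (T : Finset ℂ) (n : ℂ → ℤ) {z : ℂ} (hz : z ∉ T) :
    HasDerivAt (Lf1 T n) (Lf2 T n z) z := by
  unfold Lf1 Lf2
  apply HasDerivAt.fun_sum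
  intro u hu
  have hne : z - u ≠ 0 := by rw [sub_ne_zero]; rintro rfl; exact hz hu
  convert! (((hasDerivAt_const z (1 : ℂ)).div (((hasDerivAt_id z).sub_const u).pow 2)
    (pow_ne_zero 2 hne)).const_mul (-(n u : ℂ))) using 1
  simp; field_simp

theorem Lf_tendsto (T : Finset ℂ) (n : ℂ → ℤ) (l : ℂ) :
    Tendsto (Lf T n l) (Bornology.cobounded ℂ) (𝓝 l) := by
  unfold Lf
  have : Tendsto (fun z : ℂ => ∑ u ∈ T, (n u : ℂ) / (z - u)) (Bornology.cobounded ℂ)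
      (𝓝 (∑ u ∈ T, (n u : ℂ) * 0)) := by
    apply tendsto_finset_sum
    intro u _
    refine ((tendsto_inv_cob u 1 one_ne_zero).const_mul (n u : ℂ)).congr fun z => ?_
    rw [pow_one, mul_one_div]
  simpa using this.const_add l

theorem Lf1_tendsto (T : Finset ℂ) (n : ℂ → ℤ) :
    Tendsto (Lf1 T n) (Bornology.cobounded ℂ) (𝓝 0) := by
  unfold Lf1
  have : Tendsto (fun z : ℂ => ∑ u ∈ T, (-(n u : ℂ)) * (1 / (z - u) ^ 2)) (Bornology.cobounded ℂ)
      (𝓝 (∑ u ∈ T, (-(n u : ℂ)) * 0)) := by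
    apply tendsto_finset_sum
    intro u _
    exact (tendsto_inv_cob u 2 two_ne_zero).const_mul _
  simpa using this

theorem Lf2_tendsto (T : Finset ℂ) (n : ℂ → ℤ) :
    Tendsto (Lf2 T n) (Bornology.cobounded ℂ) (𝓝 0) := by
  unfold Lf2
  have : Tendsto (fun z : ℂ => ∑ u ∈ T, (2 * (n u : ℂ)) * (1 / (z - u) ^ 3)) (Bornology.cobounded ℂ)
      (𝓝 (∑ u ∈ T, (2 * (n u : ℂ)) * 0)) := by
    apply tendsto_finset_sum
    intro u _
    exact (tendsto_inv_cob u 3 three_ne_zero).const_mul _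
  simpa using this

/-! rational functions -/

theorem poly_ev_ne {q : Polynomial ℂ} (hq : q ≠ 0) (z : ℂ) : ∀ᶠ w in 𝓝[≠] z, q.eval w ≠ 0 := by
  filter_upwards [off_ev q.roots.toFinset z] with w hw h0
  exact hw (by simp [hq, h0])

theorem IsRatFn.congr {a b : ℂ → ℂ} (h : IsRatFn a) (hab : MeroEq b a) : IsRatFn b := by
  obtain ⟨p, q, hq, h⟩ := h
  exact ⟨p, q, hq, hab.trans h⟩

theorem ratfn_const (c : ℂ) : IsRatFn (fun _ => c) :=
  ⟨Polynomial.C c, 1, one_ne_zero, fun z => by simp⟩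

theorem ratfn_lin (u : ℂ) : IsRatFn (fun z => z - u) :=
  ⟨Polynomial.X - Polynomial.C u, 1, one_ne_zero, fun z => by simp⟩

theorem IsRatFn.mul {a b : ℂ → ℂ} (ha : IsRatFn a) (hb : IsRatFn b) : IsRatFn (fun z => a z * b z) := by
  obtain ⟨p, q, hq, h⟩ := ha
  obtain ⟨p', q', hq', h'⟩ := hb
  refine ⟨p * p', q * q', mul_ne_zero hq hq', fun z => ?_⟩
  filter_upwards [h z, h' z] with w h1 h2
  rw [h1, h2, Polynomial.eval_mul, Polynomial.eval_mul, div_mul_div_comm]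

theorem IsRatFn.add {a b : ℂ → ℂ} (ha : IsRatFn a) (hb : IsRatFn b) : IsRatFn (fun z => a z + b z) := by
  obtain ⟨p, q, hq, h⟩ := ha
  obtain ⟨p', q', hq', h'⟩ := hb
  refine ⟨p * q' + q * p', q * q', mul_ne_zero hq hq', fun z => ?_⟩
  filter_upwards [h z, h' z, poly_ev_ne hq z, poly_ev_ne hq' z] with w h1 h2 h3 h4
  rw [h1, h2, Polynomial.eval_mul, Polynomial.eval_add, Polynomial.eval_mul, Polynomial.eval_mul,
    div_add_div _ _ h3 h4]

theorem IsRatFn.inv {a : ℂ → ℂ} (ha : IsRatFn a) : IsRatFn (fun z => (a z)⁻¹) := by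
  obtain ⟨p, q, hq, h⟩ := ha
  by_cases hp : p = 0
  · subst hp
    refine ⟨0, 1, one_ne_zero, fun z => ?_⟩
    filter_upwards [h z] with w h1
    rw [h1]; simp
  · refine ⟨q, p, hp, fun z => ?_⟩
    filter_upwards [h z] with w h1
    rw [h1, inv_div]

theorem IsRatFn.zpow {a : ℂ → ℂ} (ha : IsRatFn a) (k : ℤ) : IsRatFn (fun z => (a z) ^ k) := by
  have hn : ∀ k : ℕ, IsRatFn (fun z => (a z) ^ k) := by
    intro k
    induction k with
    | zero => simpa using ratfn_const 1
    | succ k ih => simpa [pow_succ] using ih.mul ha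
  cases k with
  | ofNat k => simpa using hn k
  | negSucc k => simpa [zpow_negSucc] using (hn (k+1)).inv

theorem kf_rat (T : Finset ℂ) (n : ℂ → ℤ) (b : ℂ) : IsRatFn (kf T n 0 b) := by
  have : IsRatFn (fun z => ∏ u ∈ T, (z - u) ^ n u) := by
    induction T using Finset.induction_on with
    | empty => simpa using ratfn_const 1
    | insert a T ha ih =>
      simp only [Finset.prod_insert ha]
      exact ((ratfn_lin a).zpow (n a)).mul ih
  unfold kf
  simp only [zero_mul, zero_add]
  exact this.mul (ratfn_const _)

theorem IsRatFn.deriv {a : ℂ → ℂ} (ha : IsRatFn a) : IsRatFn (deriv a) := by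
  obtain ⟨p, q, hq, h⟩ := ha
  refine ⟨p.derivative * q - p * q.derivative, q ^ 2, pow_ne_zero 2 hq, fun z => ?_⟩
  filter_upwards [MeroEq.deriv h z, poly_ev_ne hq z] with w h1 h2
  rw [h1, deriv_fun_div p.differentiableAt q.differentiableAt h2]
  simp

theorem IsRatFn.mer {a : ℂ → ℂ} (ha : IsRatFn a) : Mer a := by
  obtain ⟨p, q, hq, h⟩ := ha
  apply Mer.congr _ h.symm
  intro z
  exact (p.differentiable.analyticAt z).meromorphicAt.div (q.differentiable.analyticAt z).meromorphicAt

theorem IsRatFn.zeros {a : ℂ → ℂ} (ha : IsRatFn a) (h0 : ¬ MeroEq a (fun _ => 0)) :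
    {z | 0 < meromorphicOrderAt a z}.Finite := by
  obtain ⟨p, q, hq, h⟩ := ha
  have hp : p ≠ 0 := by
    rintro rfl
    apply h0
    intro z
    filter_upwards [h z] with w hw
    rw [hw]; simp
  apply (p.roots.toFinset ∪ q.roots.toFinset).finite_toSet.subset
  intro z hz
  by_contra hc
  simp only [Finset.coe_union, Set.mem_union, Finset.mem_coe, Multiset.mem_toFinset,
    Polynomial.mem_roots hp, Polynomial.mem_roots hq, not_or] at hc
  have hc1 : p.eval z ≠ 0 := hc.1
  have hc2 : q.eval z ≠ 0 := hc.2
  have ha : AnalyticAt ℂ (fun z => p.eval z / q.eval z) z :=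
    (p.differentiable.analyticAt z).div (q.differentiable.analyticAt z) hc2
  simp only [Set.mem_setOf_eq] at hz
  rw [meromorphicOrderAt_congr (h z), ← tendsto_zero_iff_meromorphicOrderAt_pos ha.meromorphicAt] at hz
  have := tendsto_nhds_unique hz (ha.continuousAt.tendsto.mono_left nhdsWithin_le_nhds)
  exact div_ne_zero hc1 hc2 this.symm

theorem deriv_pow_mul {a : ℂ → ℂ} {x : ℂ} (ha : AnalyticAt ℂ a x) (k : ℕ) :
    ∀ᶠ w in 𝓝 x, deriv (fun w => (w - x) ^ (k + 1) * a w) w =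
      (w - x) ^ k * (((k : ℂ) + 1) * a w + (w - x) * deriv a w) := by
  filter_upwards [ha.eventually_analyticAt] with w hw
  have h1 : HasDerivAt (fun w : ℂ => (w - x) ^ (k + 1)) (((k + 1 : ℕ) : ℂ) * (w - x) ^ k * 1) w :=
    ((hasDerivAt_id w).sub_const x).pow (k + 1)
  have h2 := h1.mul hw.differentiableAt.hasDerivAt
  have e : deriv (fun w => (w - x) ^ (k + 1) * a w) w = _ := h2.deriv
  rw [e]
  push_cast
  ring

theorem ev_nhdsNE_deriv {h g : ℂ → ℂ} {x : ℂ} (e : h =ᶠ[𝓝[≠] x] g) : deriv h =ᶠ[𝓝[≠] x] deriv g :=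
  e.nhdsNE_deriv

theorem phi_zero {h : ℂ → ℂ} {x : ℂ} (hh : MeromorphicAt h x) (k : ℕ)
    (ho : meromorphicOrderAt h x = ((k + 2 : ℕ) : ℤ)) :
    ∃ U, AnalyticAt ℂ U x ∧ (fun w => h w * deriv (deriv h) w / deriv h w ^ 2) =ᶠ[𝓝[≠] x] U ∧
      U x = ((k : ℂ) + 1) / (k + 2) := by
  obtain ⟨a, ha, ha0, hfa⟩ := (meromorphicOrderAt_eq_int_iff hh).1 ho
  have e0 : h =ᶠ[𝓝[≠] x] fun w => (w - x) ^ (k + 1 + 1) * a w := by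
    filter_upwards [hfa] with w hw
    rw [hw, zpow_natCast, smul_eq_mul]
  set c : ℂ → ℂ := fun w => (((k + 1 : ℕ) : ℂ) + 1) * a w + (w - x) * deriv a w with hc
  have hca : AnalyticAt ℂ c x := by
    have := ha.deriv
    rw [hc]; fun_prop
  have hcx : c x = ((k : ℂ) + 2) * a x := by
    simp only [hc, sub_self, zero_mul, add_zero]; push_cast; ring
  have hk2 : (k : ℂ) + 2 ≠ 0 := by
    have := Nat.cast_ne_zero (R := ℂ).2 (show k + 2 ≠ 0 by omega)
    push_cast at this; exact this
  have e1 : deriv h =ᶠ[𝓝[≠] x] fun w => (w - x) ^ (k + 1) * c w :=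
    (ev_nhdsNE_deriv e0).trans ((deriv_pow_mul ha (k + 1)).filter_mono nhdsWithin_le_nhds)
  have e2 : deriv (deriv h) =ᶠ[𝓝[≠] x] fun w => (w - x) ^ k * (((k : ℂ) + 1) * c w + (w - x) * deriv c w) :=
    (ev_nhdsNE_deriv e1).trans ((deriv_pow_mul hca k).filter_mono nhdsWithin_le_nhds)
  have hcx0 : c x ≠ 0 := by rw [hcx]; exact mul_ne_zero hk2 ha0
  refine ⟨fun w => a w * (((k : ℂ) + 1) * c w + (w - x) * deriv c w) / c w ^ 2, ?_, ?_, ?_⟩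
  · have := hca.deriv
    have h3 : c x ^ 2 ≠ 0 := pow_ne_zero 2 hcx0
    exact (ha.mul ((analyticAt_const.mul hca).add
      ((analyticAt_id.sub analyticAt_const).mul this))).div (hca.pow 2) h3
  · filter_upwards [e0, e1, e2, self_mem_nhdsWithin,
      (hca.continuousAt.eventually_ne hcx0).filter_mono nhdsWithin_le_nhds] with w h0 h1 h2 hne hcw
    have ht : w - x ≠ 0 := sub_ne_zero.2 hne
    rw [h2, h1, h0]
    clear_value c
    field_simp
    ring
  · simp only [sub_self, zero_mul, add_zero, hcx]
    clear_value c
    field_simp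

theorem phi_crit {h : ℂ → ℂ} {x : ℂ} (hh : MeromorphicAt h x)
    (ho : meromorphicOrderAt h x = 0) (ho1 : meromorphicOrderAt (deriv h) x = 1) :
    ∃ U, AnalyticAt ℂ U x ∧
      (fun w => h w * deriv (deriv h) w / deriv h w ^ 2) =ᶠ[𝓝[≠] x] (fun w => U w / (w - x) ^ 2) ∧
      U x ≠ 0 ∧ deriv U x = 0 := by
  obtain ⟨e, he, he0, hfe⟩ := (meromorphicOrderAt_eq_int_iff hh).1
    (show meromorphicOrderAt h x = ((0 : ℤ) : WithTop ℤ) from ho)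
  obtain ⟨a, ha, ha0, hfa⟩ := (meromorphicOrderAt_eq_int_iff hh.deriv).1
    (show meromorphicOrderAt (deriv h) x = ((1 : ℤ) : WithTop ℤ) from ho1)
  have e0 : h =ᶠ[𝓝[≠] x] e := by
    filter_upwards [hfe] with w hw
    rw [hw]; simp
  have e1 : deriv h =ᶠ[𝓝[≠] x] fun w => (w - x) ^ (0 + 1) * a w := by
    filter_upwards [hfa] with w hw
    rw [hw]; simp
  have e2 : deriv (deriv h) =ᶠ[𝓝[≠] x] fun w => (w - x) ^ 0 * (((0 : ℕ) + 1 : ℂ) * a w + (w - x) * deriv a w) :=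
    (ev_nhdsNE_deriv e1).trans ((deriv_pow_mul ha 0).filter_mono nhdsWithin_le_nhds)
  have hex : deriv e x = 0 := by
    have h1 : deriv e =ᶠ[𝓝[≠] x] fun w => (w - x) ^ (0 + 1) * a w :=
      (ev_nhdsNE_deriv e0).symm.trans e1
    have hc : ContinuousAt (fun w => (w - x) ^ (0 + 1) * a w) x := by
      have := ha.continuousAt
      fun_prop
    have h2 := (he.deriv.continuousAt.eventuallyEq_nhds_iff_eventuallyEq_nhdsNE hc).1 h1
    have := h2.eq_of_nhds
    rw [this]; simp
  set b : ℂ → ℂ := fun w => a w + (w - x) * deriv a w with hb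
  have hba : AnalyticAt ℂ b x := by
    have := ha.deriv
    rw [hb]; fun_prop
  have hbx : b x = a x := by simp [hb]
  have hbd : HasDerivAt b (deriv a x + (1 * deriv a x + (x - x) * deriv (deriv a) x)) x :=
    ha.differentiableAt.hasDerivAt.add
      (((hasDerivAt_id x).sub_const x).mul ha.deriv.differentiableAt.hasDerivAt)
  have ha2 : a x ^ 2 ≠ 0 := pow_ne_zero 2 ha0
  refine ⟨fun w => e w * b w / a w ^ 2, (he.mul hba).div (ha.pow 2) ha2, ?_, ?_, ?_⟩
  · filter_upwards [e0, e1, e2, self_mem_nhdsWithin,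
      (ha.continuousAt.eventually_ne ha0).filter_mono nhdsWithin_le_nhds] with w h0 h1 h2 hne hcw
    have ht : w - x ≠ 0 := sub_ne_zero.2 hne
    rw [h2, h1, h0, hb]
    simp
    field_simp
  · simp only [hbx]
    exact div_ne_zero (mul_ne_zero he0 ha0) ha2
  · have := ((he.differentiableAt.hasDerivAt.mul hbd).div
      (ha.differentiableAt.hasDerivAt.pow 2) ha2).deriv
    have h3 : deriv (fun w => e w * b w / a w ^ 2) x = _ := this
    rw [h3, hex]
    simp [hbx]
    ring_nf
    simp

theorem K_rel {P K E U : ℂ → ℂ} {x : ℂ} (hx : starRingEnd ℂ x = x) (k : ℕ)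
    (hP : MeroEq P (fun z => K z * mtilde P z)) (hKE : MeroEq K E) (hE : AnalyticAt ℂ E x)
    (hU : AnalyticAt ℂ U x) (hPU : P =ᶠ[𝓝[≠] x] fun w => U w / (w - x) ^ k) :
    (fun w => E w * mtilde U w) =ᶠ[𝓝 x] U := by
  have hUt : AnalyticAt ℂ (mtilde U) x := mtilde_analytic (by rw [hx]; exact hU)
  refine (ContinuousAt.eventuallyEq_nhds_iff_eventuallyEq_nhdsNE (f := fun w => E w * mtilde U w)
    (hE.mul hUt).continuousAt hU.continuousAt).1 ?_
  have hc := tendsto_conj_ne x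
  rw [hx] at hc
  filter_upwards [hP x, hKE x, hPU, hc.eventually hPU, self_mem_nhdsWithin] with w h1 h2 h3 h4 h5
  have ht : w - x ≠ 0 := sub_ne_zero.2 h5
  have h6 : mtilde P w = mtilde U w / (w - x) ^ k := by
    simp only [mtilde, h4]
    simp [hx]
  rw [h2, h6, h3] at h1
  field_simp at h1
  exact h1.symm

theorem K_one {P K E U : ℂ → ℂ} {x : ℂ} (hx : starRingEnd ℂ x = x) (k : ℕ)
    (hP : MeroEq P (fun z => K z * mtilde P z)) (hKE : MeroEq K E) (hE : AnalyticAt ℂ E x)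
    (hU : AnalyticAt ℂ U x) (hPU : P =ᶠ[𝓝[≠] x] fun w => U w / (w - x) ^ k)
    (h0 : U x ≠ 0) (hr : starRingEnd ℂ (U x) = U x) : E x = 1 := by
  have := (K_rel hx k hP hKE hE hU hPU).eq_of_nhds
  simp only [mtilde, hx, hr] at this
  exact mul_right_cancel₀ h0 (by rw [this, one_mul])

theorem K_deriv {P K E U : ℂ → ℂ} {x : ℂ} (hx : starRingEnd ℂ x = x) (k : ℕ)
    (hP : MeroEq P (fun z => K z * mtilde P z)) (hKE : MeroEq K E) (hE : AnalyticAt ℂ E x)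
    (hU : AnalyticAt ℂ U x) (hPU : P =ᶠ[𝓝[≠] x] fun w => U w / (w - x) ^ k)
    (h0 : U x ≠ 0) (hr : deriv U x = 0) : deriv E x = 0 := by
  have hUt : AnalyticAt ℂ (mtilde U) x := mtilde_analytic (by rw [hx]; exact hU)
  have := (K_rel hx k hP hKE hE hU hPU).deriv_eq
  rw [deriv_fun_mul hE.differentiableAt hUt.differentiableAt, mtilde_deriv] at this
  simp only [mtilde, hx, hr, map_zero, mul_zero, add_zero] at this
  exact (mul_eq_zero.1 this).resolve_right (by simpa using h0)

theorem real_zero {M : ℕ} {f : ℂ → ℂ} (h : Std M f) {m : ℕ} {K K' : ℂ → ℂ}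
    (hK : IsKm f m K) (hK' : IsKm f (m+1) K') {T T' : Finset ℂ} {n n' : ℂ → ℤ} {l b l' b' : ℂ}
    (e : MeroEq K (kf T n l b)) (e' : MeroEq K' (kf T' n' l' b')) {x : ℂ}
    (hx : starRingEnd ℂ x = x) (hT : x ∉ T) (hT' : x ∉ T')
    (ho : 0 < meromorphicOrderAt (iteratedDeriv (m+1) f) x) :
    kf T' n' l' b' x = 1 ∨ kf T n l b x = 1 ∨ Lf T n l x = 0 := by
  have hq := Km_eq h hK
  have hq' := Km_eq h hK'
  rw [phi_tilde] at hq hq'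
  have s1 : iteratedDeriv (m+1) f = deriv (iteratedDeriv m f) := iteratedDeriv_succ
  have s2 : iteratedDeriv (m+2) f = deriv (deriv (iteratedDeriv m f)) := by
    rw [← s1]; exact iteratedDeriv_succ
  have s3 : iteratedDeriv (m+1+2) f = deriv (deriv (deriv (iteratedDeriv m f))) := by
    rw [← s2]; exact iteratedDeriv_succ
  set g := iteratedDeriv m f with hg
  have hgm : Mer g := h.mer.iter m
  have p0 : phi f m = fun w => g w * deriv (deriv g) w / deriv g w ^ 2 := by
    unfold phi; rw [s1, s2]
  have p1 : phi f (m+1) = fun w => deriv g w * deriv (deriv (deriv g)) w / deriv (deriv g) w ^ 2 := by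
    unfold phi
    rw [s1, s3, show m + 1 + 1 = m + 2 from rfl, s2]
  have hne0 := hgm.ne_top (h.ne m) x
  have hne1 := (h.mer.iter (m+1)).ne_top (h.ne (m+1)) x
  rw [s1] at ho hne1
  have hreal : ∀ k : ℕ, starRingEnd ℂ (((k : ℂ) + 1) / (k + 2)) = ((k : ℂ) + 1) / (k + 2) := by
    intro k
    rw [map_div₀, map_add, map_add, map_natCast, map_one, map_ofNat]
  have hnz : ∀ k : ℕ, ((k : ℂ) + 1) / (k + 2) ≠ 0 := by
    intro k
    apply div_ne_zero
    · exact Nat.cast_add_one_ne_zero k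
    · have := Nat.cast_ne_zero (R := ℂ).2 (show k + 2 ≠ 0 by omega)
      push_cast at this; exact this
  obtain ⟨p, hp⟩ := WithTop.ne_top_iff_exists.1 hne1
  rw [← hp] at ho
  have hp0 : 0 < p := by exact_mod_cast ho
  rcases (show p = 1 ∨ 2 ≤ p by omega) with h1 | h2
  · right
    subst h1
    obtain ⟨q, hq0⟩ := WithTop.ne_top_iff_exists.1 hne0
    by_cases hqz : q = 0
    · right
      subst hqz
      obtain ⟨U, hU, hPU, hU0, hU1⟩ := phi_crit (hgm x) hq0.symm hp.symm
      have := K_deriv hx 2 hq e (kf_analytic T n l b hT) hU (by rw [p0]; exact hPU) hU0 hU1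
      rw [(kf_hasDeriv T n l b hT).deriv] at this
      exact (mul_eq_zero.1 this).resolve_right (kf_ne T n l b hT)
    · left
      have := meromorphicOrderAt_deriv_eq_sub_one (𝕜 := ℂ) (by exact_mod_cast hqz) hq0.symm
      rw [← hp] at this
      have h3 : (1 : ℤ) = q - 1 := by exact_mod_cast this
      have h4 : q = ((0 + 2 : ℕ) : ℤ) := by push_cast; omega
      rw [h4] at hq0
      obtain ⟨U, hU, hPU, hUx⟩ := phi_zero (hgm x) 0 hq0.symm
      apply K_one hx 0 hq e (kf_analytic T n l b hT) hU (by rw [p0]; simpa using hPU)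
      · rw [hUx]; exact hnz 0
      · rw [hUx]; exact hreal 0
  · left
    obtain ⟨k, hk⟩ : ∃ k : ℕ, p = ((k + 2 : ℕ) : ℤ) := ⟨(p - 2).toNat, by push_cast; omega⟩
    rw [hk] at hp
    obtain ⟨U, hU, hPU, hUx⟩ := phi_zero (hgm.deriv x) k hp.symm
    apply K_one hx 0 hq' e' (kf_analytic T' n' l' b' hT') hU (by rw [p1]; simpa using hPU)
    · rw [hUx]; exact hnz k
    · rw [hUx]; exact hreal k

theorem unit_real {v E : ℂ → ℂ} {x : ℂ} (hx : starRingEnd ℂ x = x)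
    (h1 : MeroEq (fun z => v z * mtilde v z) (fun _ => 1)) (he : MeroEq v E)
    (hE : AnalyticAt ℂ E x) : ‖E x‖ = 1 := by
  have hEt : AnalyticAt ℂ (mtilde E) x := mtilde_analytic (by rw [hx]; exact hE)
  have h2 : (fun w => E w * mtilde E w) =ᶠ[𝓝 x] fun _ => 1 := by
    refine (ContinuousAt.eventuallyEq_nhds_iff_eventuallyEq_nhdsNE (f := fun w => E w * mtilde E w)
      (hE.mul hEt).continuousAt continuousAt_const).1 ?_
    filter_upwards [h1 x, he x, he.tilde' x] with w a b c
    rw [← b, ← c]; exact a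
  have h3 := h2.eq_of_nhds
  simp only [mtilde, hx, Complex.mul_conj] at h3
  have h4 : Complex.normSq (E x) = 1 := by exact_mod_cast h3
  rw [Complex.normSq_eq_norm_sq] at h4
  nlinarith [norm_nonneg (E x)]

theorem Km_unit {M : ℕ} {f : ℂ → ℂ} (h : Std M f) {j : ℕ} {K : ℂ → ℂ} (hK : IsKm f j K) :
    MeroEq (fun z => K z * mtilde K z) (fun _ => 1) := by
  have hq := Km_eq h hK
  rw [phi_tilde] at hq
  have hq' := hq.tilde'
  intro z
  filter_upwards [hq z, hq' z, (h.mer.phi j).ev_ne (phi_ne h.mer h.tra j) z] with w a b c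
  have e : mtilde (fun z => K z * mtilde (phi f j) z) w = mtilde K w * phi f j w := by
    simp [mtilde]
  rw [e] at b
  rw [b] at a
  apply mul_right_cancel₀ c
  rw [one_mul, mul_assoc]
  exact a.symm

theorem one_fin {T : Finset ℂ} {n : ℂ → ℤ} {l b : ℂ} (hr : IsRatFn (kf T n l b))
    (hc : ¬ ∃ c : ℂ, MeroEq (kf T n l b) (fun _ => c)) :
    {x | x ∉ T ∧ kf T n l b x = 1}.Finite := by
  have h1 : IsRatFn (fun z => kf T n l b z + (-1)) := hr.add (ratfn_const (-1))
  refine (h1.zeros ?_).subset ?_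
  · intro h0
    apply hc
    refine ⟨1, fun z => ?_⟩
    filter_upwards [h0 z] with w hw
    linear_combination hw
  · rintro x ⟨hx, he⟩
    have ha : AnalyticAt ℂ (fun z => kf T n l b z + (-1)) x :=
      (kf_analytic T n l b hx).add analyticAt_const
    have : Tendsto (fun z => kf T n l b z + (-1)) (𝓝[≠] x) (𝓝 0) := by
      have := ha.continuousAt.tendsto
      rw [he] at this
      simpa using this.mono_left nhdsWithin_le_nhds
    exact (tendsto_zero_iff_meromorphicOrderAt_pos ha.meromorphicAt).1 this

/-- At most linear growth of the counting function. -/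
def LinB (S : Set ℂ) : Prop := ∃ C : ℝ, 0 ≤ C ∧ ∀ t : ℝ, 1 ≤ t →
  (S ∩ Metric.closedBall (0:ℂ) t).Finite ∧ ((S ∩ Metric.closedBall (0:ℂ) t).ncard : ℝ) ≤ C * t

theorem LinB.of_fin {S : Set ℂ} (h : S.Finite) : LinB S := by
  refine ⟨S.ncard, by positivity, fun t ht => ⟨h.subset Set.inter_subset_left, ?_⟩⟩
  have : ((S ∩ Metric.closedBall (0:ℂ) t).ncard : ℝ) ≤ S.ncard := by
    exact_mod_cast Set.ncard_le_ncard Set.inter_subset_left h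
  nlinarith [Nat.cast_nonneg (α := ℝ) S.ncard]

theorem LinB.mono {S S' : Set ℂ} (h : LinB S') (hs : S ⊆ S') : LinB S := by
  obtain ⟨C, hC, h⟩ := h
  refine ⟨C, hC, fun t ht => ?_⟩
  have hsub := Set.inter_subset_inter_left (Metric.closedBall (0:ℂ) t) hs
  refine ⟨(h t ht).1.subset hsub, le_trans ?_ (h t ht).2⟩
  exact_mod_cast Set.ncard_le_ncard hsub (h t ht).1

theorem LinB.union {S S' : Set ℂ} (h : LinB S) (h' : LinB S') : LinB (S ∪ S') := by
  obtain ⟨C, hC, h⟩ := h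
  obtain ⟨C', hC', h'⟩ := h'
  refine ⟨C + C', by positivity, fun t ht => ?_⟩
  rw [Set.union_inter_distrib_right]
  refine ⟨(h t ht).1.union (h' t ht).1, ?_⟩
  have : (((S ∩ Metric.closedBall (0:ℂ) t) ∪ (S' ∩ Metric.closedBall (0:ℂ) t)).ncard : ℝ) ≤
      (S ∩ Metric.closedBall (0:ℂ) t).ncard + (S' ∩ Metric.closedBall (0:ℂ) t).ncard := by
    exact_mod_cast Set.ncard_union_le _ _
  linarith [(h t ht).2, (h' t ht).2]

theorem LinB.of_sep {S : Set ℂ} {δ : ℝ} (hδ : 0 < δ)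
    (h : ∀ x ∈ S, ∀ y ∈ S, |x.re - y.re| < δ → x = y) : LinB S := by
  refine ⟨2 / δ + 2, by positivity, fun t ht => ?_⟩
  set φ : ℂ → ℤ := fun x => ⌊x.re / δ⌋
  have hmaps : ∀ x ∈ S ∩ Metric.closedBall (0:ℂ) t, φ x ∈ (Set.Icc ⌊-t / δ⌋ ⌊t / δ⌋ : Set ℤ) := by
    rintro x ⟨_, hx⟩
    have h1 : |x.re| ≤ t := (Complex.abs_re_le_norm x).trans (by simpa using hx)
    rw [abs_le] at h1
    exact ⟨Int.floor_le_floor (by gcongr; exact h1.1), Int.floor_le_floor (by gcongr; exact h1.2)⟩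
  have hinj : Set.InjOn φ (S ∩ Metric.closedBall (0:ℂ) t) := by
    rintro x ⟨hx, _⟩ y ⟨hy, _⟩ he
    apply h x hx y hy
    have := Int.abs_sub_lt_one_of_floor_eq_floor he
    rw [← sub_div, abs_div, abs_of_pos hδ, div_lt_one hδ] at this
    exact this
  have hfin : (Set.Icc ⌊-t / δ⌋ ⌊t / δ⌋ : Set ℤ).Finite := Set.finite_Icc _ _
  refine ⟨Set.Finite.of_finite_image (hfin.subset (Set.image_subset_iff.2 hmaps)) hinj, ?_⟩
  have h1 := Set.ncard_le_ncard_of_injOn φ hmaps hinj hfin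
  have h2 : ((Set.Icc ⌊-t / δ⌋ ⌊t / δ⌋ : Set ℤ).ncard : ℝ) ≤ 2 * t / δ + 2 := by
    rw [← Finset.coe_Icc, Set.ncard_coe_finset, Int.card_Icc]
    have h3 : ⌊-t / δ⌋ ≤ ⌊t / δ⌋ := Int.floor_le_floor (by gcongr; linarith)
    have h4 : (((⌊t / δ⌋ + 1 - ⌊-t / δ⌋).toNat : ℤ) : ℝ) = ⌊t / δ⌋ + 1 - ⌊-t / δ⌋ := by
      rw [Int.toNat_of_nonneg (by omega)]; push_cast; ring
    have h5 : (((⌊t / δ⌋ + 1 - ⌊-t / δ⌋).toNat : ℕ) : ℝ) = ⌊t / δ⌋ + 1 - ⌊-t / δ⌋ := by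
      exact_mod_cast h4
    rw [h5]
    have h6 := Int.floor_le (t / δ)
    have h7 := Int.lt_floor_add_one (-t / δ)
    have h8 : -t / δ = -(t / δ) := by ring
    have h9 : 2 * t / δ = 2 * (t / δ) := by ring
    rw [h9]
    linarith
  have h10 : ((S ∩ Metric.closedBall (0:ℂ) t).ncard : ℝ) ≤ (Set.Icc ⌊-t / δ⌋ ⌊t / δ⌋ : Set ℤ).ncard := by
    exact_mod_cast h1
  calc _ ≤ 2 * t / δ + 2 := h10.trans h2
    _ ≤ (2 / δ + 2) * t := by
      have : 2 * t / δ = 2 / δ * t := by ring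
      rw [this]; nlinarith

theorem cob_bound {P : ℂ → Prop} (h : ∀ᶠ z in Bornology.cobounded ℂ, P z) :
    ∃ X : ℝ, 0 < X ∧ ∀ z : ℂ, X ≤ ‖z‖ → P z := by
  rw [← comap_norm_atTop, eventually_comap] at h
  obtain ⟨X, hX⟩ := eventually_atTop.1 h
  refine ⟨max X 1, by positivity, fun z hz => hX ‖z‖ ((le_max_left _ _).trans hz) z rfl⟩

theorem off_cob (T : Finset ℂ) : ∀ᶠ z in Bornology.cobounded ℂ, z ∉ T := by
  have : Bornology.IsBounded (T : Set ℂ) := T.finite_toSet.isBounded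
  exact this

theorem kf_gap (T : Finset ℂ) (n : ℂ → ℤ) {l : ℂ} (b : ℂ) (hl : l ≠ 0)
    (hu : ∀ x : ℂ, starRingEnd ℂ x = x → x ∉ T → ‖kf T n l b x‖ = 1) :
    ∃ X δ : ℝ, 0 < X ∧ 0 < δ ∧ ∀ I : Set ℝ, Convex ℝ I → (∀ s ∈ I, X ≤ |s|) →
      ∀ x ∈ I, ∀ y ∈ I, kf T n l b x = 1 → kf T n l b y = 1 → |x - y| < δ → x = y := by
  have hlp : 0 < ‖l‖ := norm_pos_iff.2 hl
  have h1 : ∀ᶠ z in Bornology.cobounded ℂ, ‖Lf T n l z - l‖ < ‖l‖ / 4 := by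
    have := (Lf_tendsto T n l).eventually (Metric.ball_mem_nhds l (show 0 < ‖l‖ / 4 by positivity))
    filter_upwards [this] with z hz
    simpa [dist_eq_norm] using hz
  obtain ⟨X, hX, hX1⟩ := cob_bound (h1.and (off_cob T))
  refine ⟨X, 1 / (8 * ‖l‖), hX, by positivity, fun I hI hIX x hx y hy ex ey hd => ?_⟩
  set J : Set ℝ := I ∩ Metric.ball x (1 / (8 * ‖l‖))
  have hJ : Convex ℝ J := hI.inter (convex_ball _ _)
  have hxJ : x ∈ J := ⟨hx, Metric.mem_ball_self (by positivity)⟩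
  have hyJ : y ∈ J := ⟨hy, by rw [Metric.mem_ball, dist_comm, Real.dist_eq]; exact hd⟩
  have hs : ∀ s ∈ J, ‖Lf T n l s - l‖ < ‖l‖ / 4 ∧ (s : ℂ) ∉ T := fun s hs =>
    hX1 s (by rw [Complex.norm_real]; exact hIX s hs.1)
  have hder : ∀ s ∈ J, HasDerivWithinAt (fun s : ℝ => kf T n l b s) (Lf T n l s * kf T n l b s) J s :=
    fun s h => (kf_hasDeriv T n l b (hs s h).2).comp_ofReal.hasDerivWithinAt
  have hone : ∀ s ∈ J, ‖kf T n l b s‖ = 1 := fun s h => hu s (Complex.conj_ofReal s) (hs s h).2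
  have hL : ∀ s ∈ J, ‖Lf T n l s‖ ≤ 2 * ‖l‖ := fun s h => by
    have h2 := norm_add_le (Lf T n l s - l) l
    rw [sub_add_cancel] at h2
    linarith [(hs s h).1]
  have hclose : ∀ s ∈ J, ‖kf T n l b s - 1‖ ≤ 1 / 4 := fun s h => by
    have := Convex.norm_image_sub_le_of_norm_hasDerivWithin_le (C := 2 * ‖l‖) hder
      (fun s h => by rw [norm_mul, hone s h, mul_one]; exact hL s h) hJ hxJ h
    simp only [ex] at this
    refine this.trans ?_
    have h3 : ‖s - x‖ < 1 / (8 * ‖l‖) := by have := h.2; rwa [Metric.mem_ball, dist_eq_norm] at this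
    calc 2 * ‖l‖ * ‖s - x‖ ≤ 2 * ‖l‖ * (1 / (8 * ‖l‖)) := by gcongr
      _ = 1 / 4 := by field_simp; norm_num
  have hfin := Convex.norm_image_sub_le_of_norm_hasDerivWithin_le (C := ‖l‖ / 2)
    (f := fun s : ℝ => kf T n l b s - l * s) (f' := fun s : ℝ => Lf T n l s * kf T n l b s - l * 1) (s := J)
    (fun s h => (hder s h).sub (((hasDerivAt_id (s : ℂ)).const_mul l).comp_ofReal.hasDerivWithinAt))
    (fun s h => by
      have e : Lf T n l s * kf T n l b s - l * 1 = (Lf T n l s - l) * kf T n l b s + l * (kf T n l b s - 1) := by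
        ring
      rw [e]
      refine (norm_add_le _ _).trans ?_
      rw [norm_mul, norm_mul, hone s h]
      have := mul_le_mul_of_nonneg_left (hclose s h) hlp.le
      linarith [(hs s h).1]) hJ hxJ hyJ
  simp only [ex, ey] at hfin
  have e : (1 - l * (y : ℂ) - (1 - l * (x : ℂ))) = l * ((x - y : ℝ) : ℂ) := by push_cast; ring
  rw [e, norm_mul, Complex.norm_real, norm_sub_rev y x] at hfin
  have h5 : ‖x - y‖ ≤ 0 := by nlinarith [norm_nonneg (x - y)]
  exact sub_eq_zero.1 (norm_le_zero_iff.1 h5)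

theorem one_lin {T : Finset ℂ} {n : ℂ → ℤ} {l b : ℂ}
    (hc : ¬ ∃ c : ℂ, MeroEq (kf T n l b) (fun _ => c))
    (hu : ∀ x : ℂ, starRingEnd ℂ x = x → x ∉ T → ‖kf T n l b x‖ = 1) :
    LinB {x | starRingEnd ℂ x = x ∧ x ∉ T ∧ kf T n l b x = 1} := by
  by_cases hl : l = 0
  · subst hl
    exact (LinB.of_fin (one_fin (kf_rat T n b) hc)).mono fun x hx => hx.2
  obtain ⟨X, δ, hX, hδ, hg⟩ := kf_gap T n b hl hu
  set A := {x | starRingEnd ℂ x = x ∧ x ∉ T ∧ kf T n l b x = 1}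
  have hre : ∀ x ∈ A, ((x.re : ℝ) : ℂ) = x := fun x hx => Complex.conj_eq_iff_re.1 hx.1
  have hfar : ∀ I : Set ℝ, Convex ℝ I → (∀ s ∈ I, X ≤ |s|) → LinB {x | x ∈ A ∧ x.re ∈ I} := by
    intro I hI hIX
    apply LinB.of_sep hδ
    rintro x ⟨hx, hxI⟩ y ⟨hy, hyI⟩ hd
    have := hg I hI hIX x.re hxI y.re hyI (by rw [hre x hx]; exact hx.2.2)
      (by rw [hre y hy]; exact hy.2.2) hd
    rw [← hre x hx, ← hre y hy, this]
  have h1 := hfar (Set.Ici X) (convex_Ici X) (fun s hs => le_trans hs (le_abs_self s))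
  have h2 := hfar (Set.Iic (-X)) (convex_Iic _) (fun s hs => by
    rw [Set.mem_Iic] at hs; exact le_trans (by linarith) (neg_le_abs s))
  have h3 : (A ∩ Metric.closedBall (0:ℂ) X).Finite := by
    by_contra hinf
    obtain ⟨z, _, hz⟩ := Set.Infinite.exists_accPt_of_subset_isCompact hinf
      (isCompact_closedBall (0:ℂ) X) Set.inter_subset_right
    rw [accPt_iff_frequently_nhdsNE] at hz
    apply hc
    exact ⟨1, mer_eq (kf_mer T n l b) (fun z => MeromorphicAt.const 1 z) (hz.mono fun w hw => hw.1.2.2)⟩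
  refine ((h1.union h2).union (LinB.of_fin h3)).mono fun x hx => ?_
  by_cases ha : X ≤ x.re
  · exact Or.inl (Or.inl ⟨hx, ha⟩)
  · by_cases hb : x.re ≤ -X
    · exact Or.inl (Or.inr ⟨hx, hb⟩)
    · right
      refine ⟨hx, ?_⟩
      rw [mem_closedBall_zero_iff, ← hre x hx, Complex.norm_real, Real.norm_eq_abs, abs_le]
      constructor <;> linarith

theorem zeros_sub {M : ℕ} {f : ℂ → ℂ} (h : Std M f) {m : ℕ} (hm : m ≤ M) {K K' : ℂ → ℂ}
    (hK : IsKm f m K) (hK' : IsKm f (m+1) K') {T T' : Finset ℂ} {n n' : ℂ → ℤ} {l b l' b' : ℂ}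
    (e : MeroEq K (kf T n l b)) (e' : MeroEq K' (kf T' n' l' b'))
    (hc : ¬ ∃ c : ℂ, MeroEq (kf T n l b) (fun _ => c)) :
    ∃ Z : Set ℂ, Z.Finite ∧ {z | 0 < meromorphicOrderAt (iteratedDeriv (m+1) f) z} ⊆
      Z ∪ ({x | starRingEnd ℂ x = x ∧ x ∉ T ∧ kf T n l b x = 1} ∪
        {x | starRingEnd ℂ x = x ∧ x ∉ T' ∧ kf T' n' l' b' x = 1}) := by
  refine ⟨{z | 0 < meromorphicOrderAt (iteratedDeriv (m+1) f) z ∧ z.im ≠ 0} ∪ (T ∪ T') ∪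
    {z | z ∉ T ∧ Lf T n l z = 0}, ((h.fin (m+1) (by omega)).union
      (T.finite_toSet.union T'.finite_toSet)).union (Lf_fin T n l b hc), fun x hx => ?_⟩
  by_cases hi : x.im = 0
  swap
  · exact Or.inl (Or.inl (Or.inl ⟨hx, hi⟩))
  have hxc : starRingEnd ℂ x = x := Complex.conj_eq_iff_im.2 hi
  by_cases hT : x ∈ T
  · exact Or.inl (Or.inl (Or.inr (Or.inl hT)))
  by_cases hT' : x ∈ T'
  · exact Or.inl (Or.inl (Or.inr (Or.inr hT')))
  rcases real_zero h hK hK' e e' hxc hT hT' hx with h1 | h1 | h1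
  · exact Or.inr (Or.inr ⟨hxc, hT', h1⟩)
  · exact Or.inr (Or.inl ⟨hxc, hT, h1⟩)
  · exact Or.inl (Or.inr ⟨hT, h1⟩)

theorem part_iii {M : ℕ} {f : ℂ → ℂ} (h : Std M f) {m : ℕ} (hm : m ≤ M) {K K' : ℂ → ℂ}
    (hK : IsKm f m K) (hK' : IsKm f (m+1) K') (hc : ¬ ∃ c : ℂ, MeroEq K (fun _ => c))
    (hc' : ¬ ∃ c : ℂ, MeroEq K' (fun _ => c)) (hr : IsRatFn K) (hr' : IsRatFn K') :
    {z | 0 < meromorphicOrderAt (iteratedDeriv (m+1) f) z}.Finite := by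
  obtain ⟨T, n, l, b, e⟩ := Km_form h (by omega) hK
  obtain ⟨T', n', l', b', e'⟩ := Km_form h (by omega) hK'
  change MeroEq K (kf T n l b) at e
  change MeroEq K' (kf T' n' l' b') at e'
  have hcE : ¬ ∃ c : ℂ, MeroEq (kf T n l b) (fun _ => c) := fun ⟨c, hh⟩ => hc ⟨c, e.trans hh⟩
  have hcE' : ¬ ∃ c : ℂ, MeroEq (kf T' n' l' b') (fun _ => c) := fun ⟨c, hh⟩ => hc' ⟨c, e'.trans hh⟩
  obtain ⟨Z, hZ, hsub⟩ := zeros_sub h hm hK hK' e e' hcE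
  refine (hZ.union (((one_fin (hr.congr e.symm) hcE).subset fun x hx => hx.2).union
    ((one_fin (hr'.congr e'.symm) hcE').subset fun x hx => hx.2))).subset hsub

theorem part_ii {M : ℕ} {f : ℂ → ℂ} (h : Std M f) {m : ℕ} (hm : m ≤ M) {K K' : ℂ → ℂ}
    (hK : IsKm f m K) (hK' : IsKm f (m+1) K') (hc : ¬ ∃ c : ℂ, MeroEq K (fun _ => c))
    (hc' : ¬ ∃ c : ℂ, MeroEq K' (fun _ => c)) :
    ∃ C : ℝ, ∀ᶠ r in atTop, NbarZeros (iteratedDeriv (m + 1) f) r ≤ C * r := by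
  obtain ⟨T, n, l, b, e⟩ := Km_form h (by omega) hK
  obtain ⟨T', n', l', b', e'⟩ := Km_form h (by omega) hK'
  change MeroEq K (kf T n l b) at e
  change MeroEq K' (kf T' n' l' b') at e'
  have hcE : ¬ ∃ c : ℂ, MeroEq (kf T n l b) (fun _ => c) := fun ⟨c, hh⟩ => hc ⟨c, e.trans hh⟩
  have hcE' : ¬ ∃ c : ℂ, MeroEq (kf T' n' l' b') (fun _ => c) := fun ⟨c, hh⟩ => hc' ⟨c, e'.trans hh⟩
  obtain ⟨Z, hZ, hsub⟩ := zeros_sub h hm hK hK' e e' hcE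
  have hlin : LinB {z | 0 < meromorphicOrderAt (iteratedDeriv (m+1) f) z} :=
    ((LinB.of_fin hZ).union ((one_lin hcE fun x hx hT =>
      unit_real hx (Km_unit h hK) e (kf_analytic T n l b hT)).union (one_lin hcE' fun x hx hT =>
      unit_real hx (Km_unit h hK') e' (kf_analytic T' n' l' b' hT)))).mono hsub
  obtain ⟨C, hC, hCt⟩ := hlin
  have hset : {z | 0 < meroOrder (iteratedDeriv (m+1) f) z} =
      {z | 0 < meromorphicOrderAt (iteratedDeriv (m+1) f) z} := by
    ext z; simp only [Set.mem_setOf_eq, (h.mer.iter (m+1)).order]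
  refine ⟨C, ?_⟩
  filter_upwards [eventually_ge_atTop 1] with r hr
  unfold NbarZeros
  rw [hset]
  have hb := intervalIntegral.norm_integral_le_of_norm_le_const (a := 1) (b := r) (C := C)
    (f := fun t => distinctCount {z | 0 < meromorphicOrderAt (iteratedDeriv (m+1) f) z} t / t)
    (fun t ht => by
      rw [Set.uIoc_of_le hr] at ht
      have ht0 : 0 < t := by linarith [ht.1]
      have := (hCt t ht.1.le).2
      unfold distinctCount
      rw [Real.norm_of_nonneg (div_nonneg (Nat.cast_nonneg _) ht0.le), div_le_iff₀ ht0]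
      exact this)
  refine (le_abs_self _).trans (hb.trans ?_)
  rw [abs_of_nonneg (by linarith)]
  nlinarith

theorem zero_in_ball {h : ℂ → ℂ} {r η : ℝ} (hr : 0 < r)
    (hd : ∀ s ∈ Metric.closedBall (0:ℂ) r, DifferentiableAt ℂ h s) (h0 : ‖h 0‖ < η)
    (hs : ∀ s ∈ Metric.sphere (0:ℂ) r, η ≤ ‖h s‖) : ∃ s ∈ Metric.closedBall (0:ℂ) r, h s = 0 := by
  by_contra hne
  push Not at hne
  have hη : 0 < η := (norm_nonneg _).trans_lt h0
  have hdc : DiffContOnCl ℂ (fun s => (h s)⁻¹) (Metric.ball 0 r) := by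
    apply DifferentiableOn.diffContOnCl
    rw [closure_ball _ hr.ne']
    exact fun s hs => ((hd s hs).inv (hne s hs)).differentiableWithinAt
  have := Complex.norm_le_of_forall_mem_frontier_norm_le (C := η⁻¹) Metric.isBounded_ball hdc (fun z hz => by
    rw [frontier_ball _ hr.ne'] at hz
    rw [norm_inv]
    exact inv_anti₀ hη (hs z hz)) (z := 0) (subset_closure (Metric.mem_ball_self hr))
  rw [norm_inv] at this
  have h00 : 0 < ‖h 0‖ := norm_pos_iff.2 (hne 0 (Metric.mem_closedBall_self hr.le))
  rw [inv_le_inv₀ h00 hη] at this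
  linarith

/-- The root of `v^2+4v+1` inside the unit disc. -/
noncomputable def gam : ℂ := ((-2 + Real.sqrt 3 : ℝ) : ℂ)

theorem gam_eq : gam ^ 2 + 4 * gam + 1 = 0 := by
  have h : Real.sqrt 3 ^ 2 = 3 := Real.sq_sqrt (by norm_num)
  have h2 : (-2 + Real.sqrt 3) ^ 2 + 4 * (-2 + Real.sqrt 3) + 1 = 0 := by nlinarith
  unfold gam
  exact_mod_cast h2

theorem gam_ne : gam ≠ 0 := by
  intro h
  have := gam_eq
  rw [h] at this
  norm_num at this

theorem gam_ne2 : gam + 2 ≠ 0 := by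
  intro h
  have h1 : gam = -2 := by linear_combination h
  have := gam_eq
  rw [h1] at this
  norm_num at this

theorem gam_norm : ‖gam‖ < 1 / 2 := by
  have h : Real.sqrt 3 ^ 2 = 3 := Real.sq_sqrt (by norm_num)
  have h0 := Real.sqrt_nonneg 3
  unfold gam
  rw [Complex.norm_real, Real.norm_eq_abs, abs_lt]
  constructor <;> nlinarith

theorem gam_r {l : ℂ} (hl : l ≠ 0) : ∃ r μ : ℝ, 0 < r ∧ r ≤ 1 ∧ 0 < μ ∧
    (∀ s ∈ Metric.closedBall (0:ℂ) r, ‖gam * exp (l * s)‖ < 1 / 2) ∧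
    (∀ s ∈ Metric.sphere (0:ℂ) r,
      μ ≤ ‖(gam * exp (l * s)) ^ 2 + 4 * (gam * exp (l * s)) + 1‖) := by
  have hd : HasDerivAt (fun s : ℂ => gam * exp (l * s)) (gam * (exp (l * 0) * (l * 1))) 0 :=
    ((((hasDerivAt_id (0:ℂ)).const_mul l).cexp).const_mul gam)
  have hd2 : HasDerivAt (fun s : ℂ => (gam * exp (l * s)) ^ 2 + 4 * (gam * exp (l * s)) + 1)
      (2 * l * gam * (gam + 2)) 0 := by
    convert! ((hd.pow 2).add (hd.const_mul 4)).add_const (1:ℂ) using 1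
    simp
    ring
  have h1 := hd2.eventually_ne (c := 0)
    (mul_ne_zero (mul_ne_zero (mul_ne_zero two_ne_zero hl) gam_ne) gam_ne2)
  have h2 : ∀ᶠ s in 𝓝 (0:ℂ), ‖gam * exp (l * s)‖ < 1 / 2 := by
    have hc := hd.continuousAt.norm
    apply hc.eventually_lt continuousAt_const
    simpa using gam_norm
  rw [eventually_nhdsWithin_iff] at h1
  obtain ⟨ε, hε, hb⟩ := Metric.eventually_nhds_iff_ball.1 (h1.and h2)
  set r := min (ε / 2) 1
  have hr : 0 < r := by positivity
  have hsub : Metric.closedBall (0:ℂ) r ⊆ Metric.ball 0 ε :=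
    Metric.closedBall_subset_ball (by have := min_le_left (ε / 2) 1; show min (ε/2) 1 < ε; linarith)
  have hcs : IsCompact (Metric.sphere (0:ℂ) r) := isCompact_sphere _ _
  have hcont : Continuous (fun s : ℂ => ‖(gam * exp (l * s)) ^ 2 + 4 * (gam * exp (l * s)) + 1‖) := by
    fun_prop
  obtain ⟨s0, hs0, hmin⟩ := hcs.exists_isMinOn (NormedSpace.sphere_nonempty.2 hr.le) hcont.continuousOn
  refine ⟨r, _, hr, min_le_right _ _, ?_, fun s hs => (hb s (hsub hs)).2, fun s hs => hmin hs⟩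
  apply norm_pos_iff.2
  apply (hb s0 (hsub (Metric.sphere_subset_closedBall hs0))).1
  rintro rfl
  simp at hs0
  exact hr.ne hs0

/-- The numerator of the third derivative. -/
noncomputable def qf (T : Finset ℂ) (n : ℂ → ℤ) (l b : ℂ) : ℂ → ℂ := fun z =>
  kf T n l b z ^ 2 + 4 * kf T n l b z + 1 - 3 * Lf1 T n z / Lf T n l z ^ 2 * (kf T n l b z ^ 2 - 1)
    + Lf2 T n z / Lf T n l z ^ 3 * (kf T n l b z - 1) ^ 2

theorem qf_close {V v α β : ℂ} {ε : ℝ} (hV : ‖V‖ ≤ 1) (hv : ‖v‖ ≤ 1) (hd : ‖v - V‖ ≤ ε)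
    (ha : ‖α‖ ≤ ε) (hb : ‖β‖ ≤ ε) :
    ‖(v ^ 2 + 4 * v + 1 - α * (v ^ 2 - 1) + β * (v - 1) ^ 2) - (V ^ 2 + 4 * V + 1)‖ ≤ 12 * ε := by
  have e : (v ^ 2 + 4 * v + 1 - α * (v ^ 2 - 1) + β * (v - 1) ^ 2) - (V ^ 2 + 4 * V + 1) =
    (v - V) * (v + V + 4) - α * (v ^ 2 - 1) + β * (v - 1) ^ 2 := by ring
  have hε : 0 ≤ ε := (norm_nonneg _).trans ha
  have h1 : ‖v + V + 4‖ ≤ 6 := by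
    refine (norm_add_le _ _).trans ?_
    have := norm_add_le v V
    have h4 : ‖(4:ℂ)‖ = 4 := by simp
    linarith
  have h2 : ‖v ^ 2 - 1‖ ≤ 2 := by
    refine (norm_sub_le _ _).trans ?_
    rw [norm_pow, norm_one]
    nlinarith [norm_nonneg v]
  have h3 : ‖(v - 1) ^ 2‖ ≤ 4 := by
    rw [norm_pow]
    have := norm_sub_le v 1
    rw [norm_one] at this
    nlinarith [norm_nonneg (v - 1)]
  rw [e]
  calc _ ≤ ‖(v - V) * (v + V + 4)‖ + ‖α * (v ^ 2 - 1)‖ + ‖β * (v - 1) ^ 2‖ :=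
        (norm_add_le _ _).trans (by gcongr; exact norm_sub_le _ _)
    _ ≤ ε * 6 + ε * 2 + ε * 4 := by
        rw [norm_mul, norm_mul, norm_mul]
        gcongr
    _ = 12 * ε := by ring

theorem kf_shift (T : Finset ℂ) (n : ℂ → ℤ) (l b : ℂ) {x t : ℂ} (hx : x ∉ T) :
    kf T n l b (x + t) = kf T n l b x * exp (l * t) * ∏ u ∈ T, (1 + t / (x - u)) ^ n u := by
  have h1 : ∏ u ∈ T, (x + t - u) ^ n u =
      (∏ u ∈ T, (x - u) ^ n u) * ∏ u ∈ T, (1 + t / (x - u)) ^ n u := by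
    rw [← Finset.prod_mul_distrib]
    apply Finset.prod_congr rfl
    intro u hu
    rw [← mul_zpow]
    congr 1
    have : x - u ≠ 0 := sub_ne_zero.2 (fun h => hx (h ▸ hu))
    field_simp
    ring
  unfold kf
  rw [h1, show l * (x + t) + b = (l * x + b) + l * t by ring, Complex.exp_add (l * x + b)]
  ring

theorem log_unit {v : ℂ} (h : ‖v‖ = 1) : ‖Complex.log v‖ ≤ Real.pi := by
  rw [Complex.log, h]
  simp
  exact Complex.abs_arg_le_pi v

theorem q_zero {T : Finset ℂ} {n : ℂ → ℤ} {l b : ℂ} (hl : l ≠ 0)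
    (hu : ∀ x : ℂ, starRingEnd ℂ x = x → x ∉ T → ‖kf T n l b x‖ = 1) (R : ℝ) :
    ∃ z, R < ‖z‖ ∧ z ∉ T ∧ Lf T n l z ≠ 0 ∧ ‖kf T n l b z‖ < 1 ∧ qf T n l b z = 0 := by
  obtain ⟨r, μ, hr, hr1, hμ, hV, hμs⟩ := gam_r hl
  set tx : ℝ → ℂ := fun x => (Complex.log gam - Complex.log (kf T n l b x)) / l with htx
  set B : ℝ := (‖Complex.log gam‖ + Real.pi) / ‖l‖ with hB
  have hlp : 0 < ‖l‖ := norm_pos_iff.2 hl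
  have hxT : ∀ᶠ x : ℝ in atTop, (x : ℂ) ∉ T := by
    obtain ⟨X, hX, hh⟩ := cob_bound (off_cob T)
    filter_upwards [eventually_ge_atTop X] with x hx
    exact hh x (by rw [Complex.norm_real]; exact hx.trans (le_abs_self x))
  have htB : ∀ᶠ x : ℝ in atTop, ‖tx x‖ ≤ B := by
    filter_upwards [hxT] with x hx
    rw [htx, hB]
    simp only [norm_div]
    gcongr
    refine (norm_sub_le _ _).trans ?_
    gcongr
    exact log_unit (hu x (Complex.conj_ofReal x) hx)
  set S := Metric.closedBall (0:ℂ) r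
  set G : Filter (ℝ × ℂ) := atTop ×ˢ 𝓟 S with hG
  have hGx : Tendsto (fun p : ℝ × ℂ => p.1) G atTop := tendsto_fst
  have hGt : ∀ᶠ p in G, ‖tx p.1 + p.2‖ ≤ B + 1 := by
    rw [hG, eventually_prod_principal_iff]
    filter_upwards [htB] with x hx s hs
    refine (norm_add_le _ _).trans ?_
    have : ‖s‖ ≤ r := by simpa [S] using hs
    linarith
  have hcob : Tendsto (fun p : ℝ × ℂ => (p.1 : ℂ) + (tx p.1 + p.2)) G (Bornology.cobounded ℂ) := by
    rw [← tendsto_norm_atTop_iff_cobounded]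
    have h1 : Tendsto (fun p : ℝ × ℂ => p.1 - (B + 1)) G atTop :=
      tendsto_atTop_add_const_right _ _ hGx
    refine tendsto_atTop_mono' _ ?_ h1
    filter_upwards [hGt] with p hp
    have h2 := norm_sub_le ((p.1 : ℂ) + (tx p.1 + p.2)) (tx p.1 + p.2)
    rw [add_sub_cancel_right, Complex.norm_real, Real.norm_eq_abs] at h2
    linarith [le_abs_self p.1]
  have hprod : Tendsto (fun p : ℝ × ℂ => ∏ u ∈ T, (1 + (tx p.1 + p.2) / ((p.1 : ℂ) - u)) ^ n u) G (𝓝 1) := by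
    have : Tendsto (fun p : ℝ × ℂ => ∏ u ∈ T, (1 + (tx p.1 + p.2) / ((p.1 : ℂ) - u)) ^ n u) G
        (𝓝 (∏ u ∈ T, (1 + 0 : ℂ) ^ n u)) := by
      apply tendsto_finset_prod
      intro u hu
      refine Tendsto.zpow₀ ?_ _ (Or.inl (by simp))
      apply tendsto_const_nhds.add
      have h1 : Tendsto (fun p : ℝ × ℂ => ((p.1 : ℂ) - u)⁻¹) G (𝓝 0) := by
        have hc : Tendsto (fun p : ℝ × ℂ => ((p.1 : ℂ))) G (Bornology.cobounded ℂ) := by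
          rw [← tendsto_norm_atTop_iff_cobounded]
          refine tendsto_atTop_mono (fun p => ?_) hGx
          rw [Complex.norm_real]; exact le_abs_self _
        have := (tendsto_inv_cob u 1 one_ne_zero).comp hc
        simpa [Function.comp_def] using this
      rw [tendsto_zero_iff_norm_tendsto_zero] at h1 ⊢
      have h2 := h1.const_mul (B + 1)
      rw [mul_zero] at h2
      refine squeeze_zero' (Eventually.of_forall fun _ => norm_nonneg _) ?_ h2
      filter_upwards [hGt] with p hp
      rw [norm_div, norm_inv, div_eq_mul_inv]
      gcongr
    simpa using this
  have hL := (Lf_tendsto T n l).comp hcob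
  have hα : Tendsto (fun p : ℝ × ℂ => 3 * Lf1 T n ((p.1 : ℂ) + (tx p.1 + p.2)) /
      Lf T n l ((p.1 : ℂ) + (tx p.1 + p.2)) ^ 2) G (𝓝 0) := by
    have := (((Lf1_tendsto T n).comp hcob).const_mul 3).div (hL.pow 2) (pow_ne_zero 2 hl)
    rw [mul_zero, zero_div] at this
    exact this
  have hβ : Tendsto (fun p : ℝ × ℂ => Lf2 T n ((p.1 : ℂ) + (tx p.1 + p.2)) /
      Lf T n l ((p.1 : ℂ) + (tx p.1 + p.2)) ^ 3) G (𝓝 0) := by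
    have := ((Lf2_tendsto T n).comp hcob).div (hL.pow 3) (pow_ne_zero 3 hl)
    rw [zero_div] at this
    exact this
  set ε := min (μ / 30) (1 / 2) with hε
  have hε0 : 0 < ε := by positivity
  have hεμ : ε ≤ μ / 30 := min_le_left _ _
  have hε2 : ε ≤ 1 / 2 := min_le_right _ _
  have small : ∀ {g : ℝ × ℂ → ℂ} {c : ℂ}, Tendsto g G (𝓝 c) → ∀ᶠ p in G, ‖g p - c‖ < ε := by
    intro g c hg
    filter_upwards [hg.eventually (Metric.ball_mem_nhds c hε0)] with p hp
    simpa [dist_eq_norm] using hp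
  have hall : ∀ᶠ p in G, R < ‖(p.1 : ℂ) + (tx p.1 + p.2)‖ ∧ (p.1 : ℂ) + (tx p.1 + p.2) ∉ T ∧
      Lf T n l ((p.1 : ℂ) + (tx p.1 + p.2)) ≠ 0 ∧
      ‖kf T n l b ((p.1 : ℂ) + (tx p.1 + p.2))‖ < 1 ∧
      ‖qf T n l b ((p.1 : ℂ) + (tx p.1 + p.2)) -
        ((gam * exp (l * p.2)) ^ 2 + 4 * (gam * exp (l * p.2)) + 1)‖ < μ / 2 := by
    have hS : ∀ᶠ p in G, p.2 ∈ S := by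
      rw [hG, eventually_prod_principal_iff]
      exact Eventually.of_forall fun x s hs => hs
    filter_upwards [small hα, small hβ, small hprod, hcob.eventually (off_cob T),
      hL.eventually_ne hl, (tendsto_norm_cobounded_atTop.comp hcob).eventually_gt_atTop R, hS,
      hGx.eventually hxT] with p h1 h2 h3 h4 h5 h6 h7 h8
    rw [sub_zero] at h1 h2
    have hx1 := hu p.1 (Complex.conj_ofReal _) h8
    have hk : kf T n l b ((p.1 : ℂ) + (tx p.1 + p.2)) = gam * exp (l * p.2) *
        ∏ u ∈ T, (1 + (tx p.1 + p.2) / ((p.1 : ℂ) - u)) ^ n u := by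
      rw [kf_shift T n l b h8]
      congr 1
      have e1 : l * (tx p.1 + p.2) = Complex.log gam - Complex.log (kf T n l b p.1) + l * p.2 := by
        rw [htx]; field_simp
      rw [e1, Complex.exp_add, Complex.exp_sub, Complex.exp_log gam_ne,
        Complex.exp_log (kf_ne T n l b h8)]
      have := kf_ne T n l b h8
      field_simp
    have hVp := hV p.2 h7
    have hD : ‖kf T n l b ((p.1 : ℂ) + (tx p.1 + p.2)) - gam * exp (l * p.2)‖ < ε := by
      rw [hk]
      have e2 : ∀ a c : ℂ, a * c - a = a * (c - 1) := fun a c => by ring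
      rw [e2, norm_mul]
      nlinarith [norm_nonneg (gam * exp (l * p.2))]
    have hk1 : ‖kf T n l b ((p.1 : ℂ) + (tx p.1 + p.2))‖ < 1 := by
      have := norm_add_le (kf T n l b ((p.1 : ℂ) + (tx p.1 + p.2)) - gam * exp (l * p.2)) (gam * exp (l * p.2))
      rw [sub_add_cancel] at this
      linarith
    refine ⟨h6, h4, h5, hk1, ?_⟩
    have := qf_close (by linarith) hk1.le hD.le h1.le h2.le
    unfold qf
    linarith
  rw [hG, eventually_prod_principal_iff] at hall
  obtain ⟨x, hx⟩ := hall.exists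
  simp only at hx
  obtain ⟨s, hs, hz⟩ := zero_in_ball (h := fun s => qf T n l b ((x : ℂ) + (tx x + s))) (η := μ / 2) hr
    (fun s hs => by
      obtain ⟨-, hT, hL0, -, -⟩ := hx s hs
      have d0 := (kf_hasDeriv T n l b hT).differentiableAt
      have d1 := (Lf_hasDeriv T n l hT).differentiableAt
      have d2 := (Lf1_hasDeriv T n hT).differentiableAt
      have d3 : DifferentiableAt ℂ (Lf2 T n) ((x : ℂ) + (tx x + s)) := by
        unfold Lf2
        apply DifferentiableAt.fun_sum
        intro u hu
        have : (x : ℂ) + (tx x + s) - u ≠ 0 := sub_ne_zero.2 (fun h => hT (h ▸ hu))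
        have h3 := pow_ne_zero 3 this
        fun_prop (disch := assumption)
      have hq : DifferentiableAt ℂ (qf T n l b) ((x : ℂ) + (tx x + s)) := by
        unfold qf
        have := pow_ne_zero 2 hL0
        have := pow_ne_zero 3 hL0
        fun_prop (disch := assumption)
      have hs : DifferentiableAt ℂ (fun s : ℂ => (x : ℂ) + (tx x + s)) s := by fun_prop
      exact hq.comp s hs)
    (by
      have := (hx 0 (Metric.mem_closedBall_self hr.le)).2.2.2.2
      rw [mul_zero, Complex.exp_zero, mul_one, gam_eq, sub_zero] at this
      exact this)
    (fun s hs => by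
      have h1 := (hx s (Metric.sphere_subset_closedBall hs)).2.2.2.2
      have h2 := hμs s hs
      have h3 := norm_sub_norm_le ((gam * exp (l * s)) ^ 2 + 4 * (gam * exp (l * s)) + 1)
        (qf T n l b ((x : ℂ) + (tx x + s)))
      rw [norm_sub_rev] at h3
      linarith)
  obtain ⟨a1, a2, a3, a4, -⟩ := hx s hs
  exact ⟨_, a1, a2, a3, a4, hz⟩

theorem Lf2_diff (T : Finset ℂ) (n : ℂ → ℤ) {z : ℂ} (hT : z ∉ T) : DifferentiableAt ℂ (Lf2 T n) z := by
  unfold Lf2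
  apply DifferentiableAt.fun_sum
  intro u hu
  have : z - u ≠ 0 := sub_ne_zero.2 (fun h => hT (h ▸ hu))
  have h3 := pow_ne_zero 3 this
  fun_prop (disch := assumption)

/-- `1/(v-1)`. -/
noncomputable def Yf (T : Finset ℂ) (n : ℂ → ℤ) (l b : ℂ) : ℂ → ℂ := fun z => (kf T n l b z - 1)⁻¹

theorem Yf_d1 (T : Finset ℂ) (n : ℂ → ℤ) (l b : ℂ) {z : ℂ} (hz : z ∉ T) (h1 : kf T n l b z ≠ 1) :
    HasDerivAt (Yf T n l b) (-(Lf T n l z * (Yf T n l b z ^ 2 + Yf T n l b z))) z := by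
  have hne : kf T n l b z - 1 ≠ 0 := sub_ne_zero.2 h1
  convert! ((kf_hasDeriv T n l b hz).sub_const 1).inv hne using 1
  unfold Yf
  field_simp
  ring

theorem Yf_d2 (T : Finset ℂ) (n : ℂ → ℤ) (l b : ℂ) {z : ℂ} (hz : z ∉ T) (h1 : kf T n l b z ≠ 1) :
    HasDerivAt (fun z => -(Lf T n l z * (Yf T n l b z ^ 2 + Yf T n l b z)))
      ((Yf T n l b z ^ 2 + Yf T n l b z) *
        (Lf T n l z ^ 2 * (2 * Yf T n l b z + 1) - Lf1 T n z)) z := by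
  have hY := Yf_d1 T n l b hz h1
  have hL := Lf_hasDeriv T n l hz
  convert! (hL.mul ((hY.pow 2).add hY)).neg using 1
  simp
  ring

theorem Yf_d3 (T : Finset ℂ) (n : ℂ → ℤ) (l b : ℂ) {z : ℂ} (hz : z ∉ T) (h1 : kf T n l b z ≠ 1) :
    HasDerivAt (fun z => (Yf T n l b z ^ 2 + Yf T n l b z) *
        (Lf T n l z ^ 2 * (2 * Yf T n l b z + 1) - Lf1 T n z))
      ((Yf T n l b z ^ 2 + Yf T n l b z) *
        (-(Lf T n l z ^ 3 * (6 * Yf T n l b z ^ 2 + 6 * Yf T n l b z + 1)) +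
          3 * Lf T n l z * Lf1 T n z * (2 * Yf T n l b z + 1) - Lf2 T n z)) z := by
  have hY := Yf_d1 T n l b hz h1
  have hL := Lf_hasDeriv T n l hz
  have hL1 := Lf1_hasDeriv T n hz
  convert! ((hY.pow 2).add hY).mul (((hL.pow 2).mul ((hY.const_mul 2).add_const 1)).sub hL1) using 1
  simp
  ring

theorem Yf_ev (T : Finset ℂ) (n : ℂ → ℤ) (l b : ℂ) {z : ℂ} (hz : z ∉ T) (h1 : kf T n l b z ≠ 1) :
    ∀ᶠ w in 𝓝 z, w ∉ T ∧ kf T n l b w ≠ 1 :=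
  (off_open T hz).and ((kf_analytic T n l b hz).continuousAt.eventually_ne h1)

theorem third_zero {w : ℂ → ℂ} (hw : Mer w) {T : Finset ℂ} {n : ℂ → ℤ} {l b d : ℂ}
    (e : MeroEq w (fun z => d + d * Yf T n l b z)) {z : ℂ} (hz : z ∉ T) (h1 : kf T n l b z ≠ 1)
    (hL : Lf T n l z ≠ 0) (hq : qf T n l b z = 0) :
    0 < meromorphicOrderAt (deriv (deriv (deriv w))) z := by
  have hev := Yf_ev T n l b hz h1
  have a1 : deriv (fun z => d + d * Yf T n l b z) =ᶠ[𝓝 z]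
      fun z => d * (-(Lf T n l z * (Yf T n l b z ^ 2 + Yf T n l b z))) := by
    filter_upwards [hev] with x hx
    exact (((Yf_d1 T n l b hx.1 hx.2).const_mul d).const_add d).deriv
  have a2 : deriv (deriv (fun z => d + d * Yf T n l b z)) =ᶠ[𝓝 z]
      fun z => d * ((Yf T n l b z ^ 2 + Yf T n l b z) *
        (Lf T n l z ^ 2 * (2 * Yf T n l b z + 1) - Lf1 T n z)) := by
    refine a1.deriv.trans ?_
    filter_upwards [hev] with x hx
    exact ((Yf_d2 T n l b hx.1 hx.2).const_mul d).deriv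
  have a3 : deriv (deriv (deriv (fun z => d + d * Yf T n l b z))) =ᶠ[𝓝 z]
      fun z => d * ((Yf T n l b z ^ 2 + Yf T n l b z) *
        (-(Lf T n l z ^ 3 * (6 * Yf T n l b z ^ 2 + 6 * Yf T n l b z + 1)) +
          3 * Lf T n l z * Lf1 T n z * (2 * Yf T n l b z + 1) - Lf2 T n z)) := by
    refine a2.deriv.trans ?_
    filter_upwards [hev] with x hx
    exact ((Yf_d3 T n l b hx.1 hx.2).const_mul d).deriv
  have a5 : deriv (deriv (deriv w)) =ᶠ[𝓝[≠] z] _ := e.deriv.deriv.deriv z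
  have a4 := a5.trans (a3.filter_mono nhdsWithin_le_nhds)
  rw [← tendsto_zero_iff_meromorphicOrderAt_pos (hw.deriv.deriv.deriv z)]
  refine Tendsto.congr' (EventuallyEq.symm a4) ?_
  have c0 := (Yf_d1 T n l b hz h1).continuousAt
  have c1 := (Lf_hasDeriv T n l hz).continuousAt
  have c2 := (Lf1_hasDeriv T n hz).continuousAt
  have c3 := (Lf2_diff T n hz).continuousAt
  have c4 : ContinuousAt (fun z => d * ((Yf T n l b z ^ 2 + Yf T n l b z) *
        (-(Lf T n l z ^ 3 * (6 * Yf T n l b z ^ 2 + 6 * Yf T n l b z + 1)) +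
          3 * Lf T n l z * Lf1 T n z * (2 * Yf T n l b z + 1) - Lf2 T n z))) z := by
    fun_prop
  have c5 := c4.tendsto.mono_left (nhdsWithin_le_nhds (s := {z}ᶜ))
  convert c5 using 2
  have hne : kf T n l b z - 1 ≠ 0 := sub_ne_zero.2 h1
  have key : -(Lf T n l z ^ 3 * (6 * Yf T n l b z ^ 2 + 6 * Yf T n l b z + 1)) +
          3 * Lf T n l z * Lf1 T n z * (2 * Yf T n l b z + 1) - Lf2 T n z =
      -(Lf T n l z ^ 3 * Yf T n l b z ^ 2) * qf T n l b z := by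
    unfold qf Yf
    field_simp
    ring
  rw [key, hq]
  ring

theorem first_fin {w : ℂ → ℂ} (hw : Mer w) {T : Finset ℂ} {n : ℂ → ℤ} {l b d : ℂ} (hd : d ≠ 0)
    (e : MeroEq w (fun z => d + d * Yf T n l b z))
    (hc : ¬ ∃ c : ℂ, MeroEq (kf T n l b) (fun _ => c)) :
    {z | 0 < meromorphicOrderAt (deriv w) z}.Finite := by
  refine (T.finite_toSet.union (Lf_fin T n l b hc)).subset fun z hz => ?_
  by_contra hn
  simp only [Set.mem_union, Finset.mem_coe, Set.mem_setOf_eq, not_or, not_and] at hn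
  obtain ⟨hT, hL⟩ := hn
  have hL := hL hT
  have hk := kf_analytic T n l b hT
  have hk1 : AnalyticAt ℂ (fun z => (kf T n l b z - 1) ^ 2) z := (hk.sub analyticAt_const).pow 2
  have hv1 : ∀ᶠ x in 𝓝[≠] z, kf T n l b x ≠ 1 := by
    by_contra hh
    have hh : ∃ᶠ x in 𝓝[≠] z, kf T n l b x = 1 := fun h0 => hh h0
    exact hc ⟨1, mer_eq (kf_mer T n l b) (fun z => MeromorphicAt.const 1 z) hh⟩
  have e1 : (fun x => deriv w x * (kf T n l b x - 1) ^ 2) =ᶠ[𝓝[≠] z]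
      fun x => -d * Lf T n l x * kf T n l b x := by
    filter_upwards [e.deriv z, off_ev T z, hv1] with x h1 h2 h3
    rw [h1, (((Yf_d1 T n l b h2 h3).const_mul d).const_add d).deriv]
    have hne : kf T n l b x - 1 ≠ 0 := sub_ne_zero.2 h3
    unfold Yf
    field_simp
    ring
  have h5 : 0 < meromorphicOrderAt (fun x => deriv w x * (kf T n l b x - 1) ^ 2) z := by
    have := meromorphicOrderAt_mul (hw.deriv z) hk1.meromorphicAt
    change 0 < meromorphicOrderAt (deriv w * fun z => (kf T n l b z - 1) ^ 2) z
    rw [this]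
    exact add_pos_of_pos_of_nonneg hz hk1.meromorphicOrderAt_nonneg
  have h6 := (tendsto_zero_iff_meromorphicOrderAt_pos ((hw.deriv z).mul hk1.meromorphicAt)).2 h5
  have h7 : Tendsto (fun x => -d * Lf T n l x * kf T n l b x) (𝓝[≠] z)
      (𝓝 (-d * Lf T n l z * kf T n l b z)) := by
    have c1 := (Lf_hasDeriv T n l hT).continuousAt
    have c2 := hk.continuousAt
    have : ContinuousAt (fun x => -d * Lf T n l x * kf T n l b x) z := by fun_prop
    exact this.tendsto.mono_left nhdsWithin_le_nhds
  have h8 := tendsto_nhds_unique (h6.congr' e1) h7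
  exact mul_ne_zero (mul_ne_zero (neg_ne_zero.2 hd) hL) (kf_ne T n l b hT) h8.symm

theorem inv_tendsto {a : ℂ → ℂ} {x : ℂ} (ha : MeromorphicAt a x) (h : ¬ 0 < meromorphicOrderAt a x) :
    ∃ c, Tendsto (fun z => (a z)⁻¹) (𝓝[≠] x) (𝓝 c) := by
  refine (tendsto_nhds_iff_meromorphicOrderAt_nonneg ha.inv).2 ?_
  rw [meromorphicOrderAt_inv]
  push Not at h
  cases h' : meromorphicOrderAt a x with
  | top => rw [h'] at h; simp at h
  | coe k =>
    rw [h'] at h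
    have hk : k ≤ 0 := by exact_mod_cast h
    change (0 : WithTop ℤ) ≤ ((-k : ℤ) : WithTop ℤ)
    exact_mod_cast (by omega : 0 ≤ -k)

theorem quot_tendsto {a : ℂ → ℂ} {x : ℂ} (ha : MeromorphicAt a x) (h : 0 < meromorphicOrderAt a x)
    (ht : meromorphicOrderAt a x ≠ ⊤) : Tendsto (fun z => a z / deriv a z) (𝓝[≠] x) (𝓝 0) := by
  obtain ⟨k, hk⟩ := WithTop.ne_top_iff_exists.1 ht
  rw [← hk] at h
  have hk0 : 0 < k := by exact_mod_cast h
  have h1 := meromorphicOrderAt_deriv_eq_sub_one (𝕜 := ℂ) (by exact_mod_cast hk0.ne') hk.symm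
  have hd : (fun z => a z / deriv a z) = a * (deriv a)⁻¹ := by
    funext z; simp [div_eq_mul_inv]
  rw [hd]
  refine (tendsto_zero_iff_meromorphicOrderAt_pos (ha.mul ha.deriv.inv)).2 ?_
  rw [meromorphicOrderAt_mul ha ha.deriv.inv, meromorphicOrderAt_inv, h1, ← hk]
  change (0 : WithTop ℤ) < ((k + -(k - 1) : ℤ) : WithTop ℤ)
  exact_mod_cast (by omega : 0 < k + -(k - 1))

/-- Constant `K_m` with infinitely many zeros of `f^(m)` makes `f^(m)` a multiple of its tilde. -/
theorem const_prop {M : ℕ} {f : ℂ → ℂ} (h : Std M f) {m : ℕ} (hm : m ≤ M + 1) {K : ℂ → ℂ}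
    (hK : IsKm f m K) {c : ℂ} (hc : MeroEq K (fun _ => c))
    (hinf : ¬ {z | 0 < meromorphicOrderAt (iteratedDeriv m f) z}.Finite) :
    ∃ c', MeroEq (iteratedDeriv m f) (fun z => c' * mtilde (iteratedDeriv m f) z) := by
  set a := iteratedDeriv m f with ha
  have ham : Mer a := h.mer.iter m
  have s1 : iteratedDeriv (m+1) f = deriv a := iteratedDeriv_succ
  have s2 : iteratedDeriv m (mtilde f) = mtilde a := mtilde_iter f m
  have s3 : iteratedDeriv (m+1) (mtilde f) = mtilde (deriv a) := by rw [mtilde_iter, s1]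
  have s3' : mtilde (deriv a) = deriv (mtilde a) := (mtilde_deriv a).symm
  have hF : Fm f m = fun z => z - a z / deriv a z := by unfold Fm; rw [s1]
  have hG : Fm (mtilde f) m = fun z => z - mtilde a z / deriv (mtilde a) z := by
    unfold Fm; rw [s2, s3, s3']
  have hFm : Mer (fun z => z - a z / deriv a z) := fun z =>
    (MeromorphicAt.id z).sub ((ham z).div (ham.deriv z))
  have hGm : Mer (fun z => z - mtilde a z / deriv (mtilde a) z) := fun z =>
    (MeromorphicAt.id z).sub ((ham.tilde z).div (ham.tilde.deriv z))
  have hd0 : MeroEq (deriv (fun z => (z - a z / deriv a z) - c * (z - mtilde a z / deriv (mtilde a) z)))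
      (fun _ => 0) := by
    intro z
    have := hK.2.2.2 z
    rw [hF, hG] at this
    filter_upwards [this, hc z, ev_diff (hFm z), ev_diff (hGm z)] with w h1 h2 h3 h4
    rw [deriv_fun_sub h3 (h4.const_mul c), deriv_const_mul _ h4, h1, h2]
    ring
  obtain ⟨d, hd⟩ := mer_const (h := fun z => (z - a z / deriv a z) - c * (z - mtilde a z / deriv (mtilde a) z))
    (fun z => (hFm z).sub ((MeromorphicAt.const c z).mul (hGm z))) hd0
  have hreal : {z | 0 < meromorphicOrderAt a z ∧ z.im = 0}.Infinite := by
    intro hfin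
    apply hinf
    refine (hfin.union (h.fin m (by omega))).subset fun z hz => ?_
    by_cases hi : z.im = 0
    · exact Or.inl ⟨hz, hi⟩
    · exact Or.inr ⟨hz, hi⟩
  have hpt : ∀ x, (0 < meromorphicOrderAt a x ∧ x.im = 0) → (x - 0) - c * (x - 0) = d := by
    rintro x ⟨hx, hi⟩
    have hxc : starRingEnd ℂ x = x := Complex.conj_eq_iff_im.2 hi
    have ht := ham.ne_top (h.ne m) x
    have t1 := quot_tendsto (ham x) hx ht
    have t2 := quot_tendsto (ham.tilde x) (by rw [mtilde_order ham, hxc]; exact hx)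
      (by rw [mtilde_order ham, hxc]; exact ht)
    have tid : Tendsto (fun z : ℂ => z) (𝓝[≠] x) (𝓝 x) := tendsto_id.mono_left nhdsWithin_le_nhds
    have t3 := (tid.sub t1).sub ((tid.sub t2).const_mul c)
    exact tendsto_nhds_unique (t3.congr' (hd x)) tendsto_const_nhds
  obtain ⟨x1, hx1⟩ := hreal.nonempty
  obtain ⟨x2, hx2, hne⟩ := hreal.exists_notMem_finite (Set.finite_singleton x1)
  have e1 := hpt x1 hx1
  have e2 := hpt x2 hx2
  have hc1 : c = 1 := by
    have h3 : (1 - c) * (x1 - x2) = 0 := by linear_combination e1 - e2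
    rcases mul_eq_zero.1 h3 with h4 | h4
    · linear_combination -h4
    · exact absurd (sub_eq_zero.1 h4).symm hne
  have hd1 : d = 0 := by rw [← e1, hc1]; ring
  have hne2 : ¬ MeroEq (mtilde a) (fun _ => 0) := by rw [← s2]; exact h.tilde.ne m
  have hne3 : ¬ MeroEq (deriv (mtilde a)) (fun _ => 0) := by rw [← s3', ← s3]; exact h.tilde.ne (m+1)
  have hne4 : ¬ MeroEq (deriv a) (fun _ => 0) := by rw [← s1]; exact h.ne (m+1)
  have hq : MeroEq (deriv (fun z => a z / mtilde a z)) (fun _ => 0) := by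
    intro z
    filter_upwards [hd z, ham.deriv.ev_ne hne4 z, ham.tilde.deriv.ev_ne hne3 z, ham.tilde.ev_ne hne2 z,
      ev_diff (ham z), ev_diff (ham.tilde z)] with w h1 h2 h3 h4 h5 h6
    rw [deriv_fun_div h5 h6 h4]
    rw [hc1, hd1] at h1
    have h7 : a w / deriv a w = mtilde a w / deriv (mtilde a) w := by linear_combination -h1
    rw [div_eq_div_iff h2 h3] at h7
    rw [div_eq_zero_iff]
    left
    linear_combination -h7
  obtain ⟨c', hc'⟩ := mer_const (h := fun z => a z / mtilde a z) (fun z => (ham z).div (ham.tilde z)) hq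
  refine ⟨c', fun z => ?_⟩
  filter_upwards [hc' z, ham.tilde.ev_ne hne2 z] with w h1 h2
  rw [← h1]; field_simp

/-- If `w = c' w̃ + d` then `w = d v/(v-1)` with `v` of the form `R e^{lz+b}`. -/
theorem v_form {M : ℕ} {f : ℂ → ℂ} (h : Std M f) {j : ℕ} (hj : j ≤ M + 1) {c d : ℂ} (hd : d ≠ 0)
    (hc : c * starRingEnd ℂ c = 1)
    (e : MeroEq (iteratedDeriv j f) (fun z => c * mtilde (iteratedDeriv j f) z + d)) :
    ∃ T n l b, MeroEq (iteratedDeriv j f) (fun z => d + d * Yf T n l b z) ∧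
      ∀ x : ℂ, starRingEnd ℂ x = x → x ∉ T → ‖kf T n l b x‖ = 1 := by
  have hc0 : c ≠ 0 := by rintro rfl; simp at hc
  set w := iteratedDeriv j f with hw
  have hwm : Mer w := h.mer.iter j
  have hwt : Mer (mtilde w) := hwm.tilde
  have s1 : iteratedDeriv (j+1) f = deriv w := iteratedDeriv_succ
  have s2 : iteratedDeriv (j+2) f = deriv (deriv w) := by
    rw [← s1]; exact iteratedDeriv_succ
  have hw0 : ¬ MeroEq w (fun _ => 0) := h.ne j
  have hwt0 : ¬ MeroEq (mtilde w) (fun _ => 0) := by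
    rw [hw, ← mtilde_iter]; exact h.tilde.ne j
  have hw1 : ¬ MeroEq (deriv w) (fun _ => 0) := by rw [← s1]; exact h.ne (j+1)
  have hwt1 : ¬ MeroEq (deriv (mtilde w)) (fun _ => 0) := by
    rw [mtilde_deriv, ← s1, ← mtilde_iter]; exact h.tilde.ne (j+1)
  have e1 : MeroEq (deriv w) (fun z => c * deriv (mtilde w) z) := by
    intro z
    filter_upwards [e.deriv z, ev_diff (hwt z)] with x h1 h2
    rw [h1, deriv_add_const, deriv_const_mul _ h2]
  have e2 : MeroEq (deriv (deriv w)) (fun z => c * deriv (deriv (mtilde w)) z) := by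
    intro z
    filter_upwards [e1.deriv z, ev_diff (hwt.deriv z)] with x h1 h2
    rw [h1, deriv_const_mul _ h2]
  set v : ℂ → ℂ := fun z => w z / (c * mtilde w z) with hv
  have hvm : Mer v := fun z => (hwm z).div ((MeromorphicAt.const c z).mul (hwt z))
  -- no real zeros
  have hnz : ∀ x, 0 < meromorphicOrderAt w x → x.im ≠ 0 := by
    intro x hx hi
    have hxc : starRingEnd ℂ x = x := Complex.conj_eq_iff_im.2 hi
    have t1 := (tendsto_zero_iff_meromorphicOrderAt_pos (hwm x)).2 hx
    have t2 := (tendsto_zero_iff_meromorphicOrderAt_pos (hwt x)).2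
      (by rw [mtilde_order hwm, hxc]; exact hx)
    have t3 := (t2.const_mul c).add_const d
    have := tendsto_nhds_unique (t1.congr' (e x)) t3
    apply hd
    simpa using this.symm
  have hzfin : {x | 0 < meromorphicOrderAt w x}.Finite :=
    (h.fin j (by omega)).subset fun x hx => ⟨hx, hnz x hx⟩
  have hztfin : {x | 0 < meromorphicOrderAt (mtilde w) x}.Finite := by
    refine (h.tilde.fin j (by omega)).subset fun x hx => ?_
    rw [mtilde_iter]
    refine ⟨hx, ?_⟩
    have := hnz (starRingEnd ℂ x) (by rw [← mtilde_order hwm]; exact hx)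
    simpa using this
  have hvK : IsKm f j v := by
    refine ⟨hvm, ?_, ?_, ?_⟩
    · refine hzfin.subset fun x hx => ?_
      rw [Set.mem_setOf_eq, hvm.order] at hx
      by_contra hn
      obtain ⟨k, hk⟩ := inv_tendsto (hwm x) hn
      have t1 := (tendsto_zero_iff_meromorphicOrderAt_pos (hvm x)).2 hx
      have t2 := t1.mul (tendsto_const_nhds.sub (hk.const_mul d) : Tendsto (fun z => 1 - d * (w z)⁻¹) _ (𝓝 (1 - d * k)))
      rw [zero_mul] at t2
      have ev : (fun z => v z * (1 - d * (w z)⁻¹)) =ᶠ[𝓝[≠] x] fun _ => 1 := by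
        filter_upwards [e x, hwm.ev_ne hw0 x, hwt.ev_ne hwt0 x] with z h1 h2 h3
        simp only [hv]
        have h4 : c * mtilde w z = w z - d := by rw [h1]; ring
        have h5 : w z - d ≠ 0 := by rw [← h4]; exact mul_ne_zero hc0 h3
        rw [h4]
        field_simp
      exact zero_ne_one (tendsto_nhds_unique (t2.congr' ev) tendsto_const_nhds)
    · refine hztfin.subset fun x hx => ?_
      rw [Set.mem_setOf_eq, hvm.order] at hx
      by_contra hn
      obtain ⟨k, hk⟩ := inv_tendsto (hwt x) hn
      have t2 : Tendsto (fun z => 1 + d / c * (mtilde w z)⁻¹) (𝓝[≠] x) (𝓝 (1 + d / c * k)) :=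
        tendsto_const_nhds.add (hk.const_mul _)
      have ev : (fun z => 1 + d / c * (mtilde w z)⁻¹) =ᶠ[𝓝[≠] x] v := by
        filter_upwards [e x, hwt.ev_ne hwt0 x] with z h1 h3
        simp only [hv]
        rw [h1]
        clear_value w
        field_simp
      have := (tendsto_nhds_iff_meromorphicOrderAt_nonneg (hvm x)).1 ⟨_, t2.congr' ev⟩
      exact absurd hx (not_lt.2 this)
    · intro z
      filter_upwards [Fm_deriv h.mer j (h.ne _) z, Fm_deriv h.tilde.mer j (h.tilde.ne _) z, e1 z, e2 z,
        hwt.deriv.ev_ne hwt1 z, hwt.ev_ne hwt0 z] with x h1 h2 h3 h4 h5 h6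
      rw [h1, h2]
      unfold phi
      rw [s1, s2, mtilde_iter, mtilde_iter, mtilde_iter, s1, s2, ← mtilde_deriv, ← mtilde_deriv,
        ← hw, h3, h4]
      simp only [hv]
      clear_value w
      field_simp
  obtain ⟨T, n, l, b, hk⟩ := Km_form h hj hvK
  change MeroEq v (kf T n l b) at hk
  have hvv : MeroEq (fun z => v z * mtilde v z) (fun _ => 1) := by
    intro z
    filter_upwards [hwm.ev_ne hw0 z, hwt.ev_ne hwt0 z] with x h1 h2
    have : mtilde v x = mtilde w x / (starRingEnd ℂ c * w x) := by
      simp [hv, mtilde]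
    have hcc : starRingEnd ℂ c ≠ 0 := by simpa using hc0
    rw [this]
    simp only [hv]
    rw [div_mul_div_comm, div_eq_one_iff_eq (by
      exact mul_ne_zero (mul_ne_zero hc0 h2) (mul_ne_zero hcc h1))]
    linear_combination -(w x * mtilde w x) * hc
  refine ⟨T, n, l, b, ?_, fun x hx hT => unit_real hx hvv hk (kf_analytic T n l b hT)⟩
  intro z
  filter_upwards [hk z, e z, hwt.ev_ne hwt0 z] with x h1 h2 h3
  unfold Yf
  rw [← h1]
  simp only [hv]
  have h4 : c * mtilde w x = w x - d := by rw [h2]; ring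
  have h5 : w x - d ≠ 0 := by rw [← h4]; exact mul_ne_zero hc0 h3
  rw [h4]
  have h6 : w x / (w x - d) - 1 = d / (w x - d) := by field_simp; ring
  rw [h6]
  field_simp
  ring

theorem rat_iter {a : ℂ → ℂ} (h : IsRatFn a) (k : ℕ) : IsRatFn (iteratedDeriv k a) := by
  induction k with
  | zero => simpa [iteratedDeriv_zero] using h
  | succ k ih => rw [iteratedDeriv_succ]; exact ih.deriv

theorem iter_iter (f : ℂ → ℂ) (j k : ℕ) :
    iteratedDeriv (j + k) f = iteratedDeriv k (iteratedDeriv j f) := by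
  induction k with
  | zero => simp [iteratedDeriv_zero]
  | succ k ih => rw [iteratedDeriv_succ, ← ih, ← add_assoc, iteratedDeriv_succ]

theorem part_i {M : ℕ} {f : ℂ → ℂ} (h : Std M f) (hs : StrictlyNonReal f) {m : ℕ} (hm : m ≤ M + 1)
    {K : ℂ → ℂ} (hK : IsKm f m K) {c : ℂ} (hc : MeroEq K (fun _ => c)) :
    {z | 0 < meromorphicOrderAt (iteratedDeriv m f) z}.Finite := by
  by_contra hinf
  have hex : ∃ i, ∃ c', MeroEq (iteratedDeriv i f) (fun z => c' * mtilde (iteratedDeriv i f) z) :=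
    ⟨m, const_prop h hm hK hc hinf⟩
  have him : Nat.find hex ≤ m := Nat.find_min' hex (const_prop h hm hK hc hinf)
  obtain ⟨c', hc'⟩ := Nat.find_spec hex
  have hmin := fun k (hk : k < Nat.find hex) => Nat.find_min hex hk
  generalize Nat.find hex = i at him hc' hmin
  have hc0 : c' ≠ 0 := by
    rintro rfl
    apply h.ne i
    simpa using hc'
  cases i with
  | zero =>
    apply hs
    refine ⟨c'⁻¹, fun z => ?_⟩
    filter_upwards [hc' z] with x hx
    rw [iteratedDeriv_zero] at hx
    rw [hx]; field_simp
  | succ j =>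
  have s1 : iteratedDeriv (j+1) f = deriv (iteratedDeriv j f) := iteratedDeriv_succ
  have hcc : c' * starRingEnd ℂ c' = 1 := by
    have h1 := hc'.tilde'
    have h2 := ((hc' 0).and (h1 0)).and ((h.mer.iter (j+1)).ev_ne (h.ne (j+1)) 0)
    obtain ⟨x, ⟨h3, h4⟩, h5⟩ := h2.exists
    have h6 : mtilde (fun z => c' * mtilde (iteratedDeriv (j+1) f) z) x =
        starRingEnd ℂ c' * iteratedDeriv (j+1) f x := by simp [mtilde]
    beta_reduce at h3
    rw [h4, h6] at h3
    apply mul_right_cancel₀ h5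
    linear_combination -h3
  set w := iteratedDeriv j f with hw
  have hwm : Mer w := h.mer.iter j
  rw [s1, ← mtilde_deriv] at hc'
  have hd0 : MeroEq (deriv (fun z => w z - c' * mtilde w z)) (fun _ => 0) := by
    intro z
    filter_upwards [hc' z, ev_diff (hwm z), ev_diff (hwm.tilde z)] with x h1 h2 h3
    rw [deriv_fun_sub h2 (h3.const_mul c'), deriv_const_mul _ h3, h1]
    ring
  obtain ⟨d, hd⟩ := mer_const (h := fun z => w z - c' * mtilde w z)
    (fun z => (hwm z).sub ((MeromorphicAt.const c' z).mul (hwm.tilde z))) hd0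
  have hdne : d ≠ 0 := by
    rintro rfl
    apply hmin j (by omega)
    refine ⟨c', fun z => ?_⟩
    filter_upwards [hd z] with x hx
    exact sub_eq_zero.1 hx
  obtain ⟨T, n, l, b, e, hu⟩ := v_form h (j := j) (by omega) hdne hcc (fun z => by
    filter_upwards [hd z] with x hx
    linear_combination hx)
  rw [← hw] at e
  obtain ⟨k, rfl⟩ : ∃ k, m = j + 1 + k := ⟨m - (j + 1), by omega⟩
  have s4 : ∀ k, iteratedDeriv (j + 1 + k) f = iteratedDeriv (1 + k) w := fun k => by
    rw [add_assoc, iter_iter]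
  have hrat : ¬ IsRatFn w := by
    intro hr
    apply hinf
    have := rat_iter hr (1 + k)
    rw [← s4] at this
    exact this.zeros (h.ne _)
  have hrat2 : ¬ IsRatFn (kf T n l b) := by
    intro hr
    apply hrat
    have h1 := ((hr.add (ratfn_const (-1))).inv.mul (ratfn_const d)).add (ratfn_const d)
    refine h1.congr (e.trans fun z => Eventually.of_forall fun x => ?_)
    unfold Yf
    ring
  have hl : l ≠ 0 := by
    rintro rfl
    exact hrat2 (kf_rat T n b)
  have hcon : ¬ ∃ c : ℂ, MeroEq (kf T n l b) (fun _ => c) := fun ⟨c, hh⟩ =>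
    hrat2 ((ratfn_const c).congr hh)
  cases k with
  | zero =>
    apply hinf
    rw [add_zero, s1]
    exact first_fin hwm hdne e hcon
  | succ k =>
    have s3 : iteratedDeriv (j + 3) f = deriv (deriv (deriv w)) := by
      rw [show j + 3 = j + 1 + 1 + 1 from rfl, iteratedDeriv_succ, iteratedDeriv_succ, s1]
    have hfin := h.fin (j + 3) (by omega)
    obtain ⟨R, hR⟩ := hfin.isBounded.exists_norm_le
    obtain ⟨z, hz, hT, hL, hk1, hq⟩ := q_zero hl hu R
    have hne : kf T n l b z ≠ 1 := by
      intro h0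
      rw [h0, norm_one] at hk1
      exact lt_irrefl _ hk1
    have hor := third_zero hwm e hT hne hL hq
    rw [← s3] at hor
    have him0 : z.im ≠ 0 := fun hi => by
      have := hu z (Complex.conj_eq_iff_im.2 hi) hT
      linarith
    have := hR z ⟨hor, him0⟩
    linarith

/-- Lemma 3.6 of the paper: under the Setup, if `f` is transcendental then the
four assertions (i)-(iv) about the functions `K_m` hold. -/
theorem statement_14 (M : ℕ) (f : ℂ → ℂ) (hs : Setup M f) (htrans : ¬ IsRatFn f) :
    (∀ m, m ≤ M + 1 → ∀ Km : ℂ → ℂ, IsKm f m Km →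
      (∃ c : ℂ, MeroEq Km (fun _ => c)) →
      {z : ℂ | 0 < meroOrder (iteratedDeriv m f) z}.Finite) ∧
    (∀ m, m ≤ M → ∀ Km Km' : ℂ → ℂ, IsKm f m Km → IsKm f (m + 1) Km' →
      (¬ ∃ c : ℂ, MeroEq Km (fun _ => c)) → (¬ ∃ c : ℂ, MeroEq Km' (fun _ => c)) →
      ∃ C : ℝ, ∀ᶠ r in atTop, NbarZeros (iteratedDeriv (m + 1) f) r ≤ C * r) ∧
    (∀ m, m ≤ M → ∀ Km Km' : ℂ → ℂ, IsKm f m Km → IsKm f (m + 1) Km' →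
      (¬ ∃ c : ℂ, MeroEq Km (fun _ => c)) → (¬ ∃ c : ℂ, MeroEq Km' (fun _ => c)) →
      IsRatFn Km → IsRatFn Km' →
      {z : ℂ | 0 < meroOrder (iteratedDeriv (m + 1) f) z}.Finite) ∧
    (∀ m, m ≤ M → ∀ Km Km' : ℂ → ℂ, IsKm f m Km → IsKm f (m + 1) Km' →
      IsRatFn Km → IsRatFn Km' →
      {z : ℂ | 0 < meroOrder (iteratedDeriv m f) z}.Finite ∨
        {z : ℂ | 0 < meroOrder (iteratedDeriv (m + 1) f) z}.Finite) := by
  have h : Std M f := by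
    refine ⟨hs.2.1, htrans, fun i hi => ?_⟩
    have h1 := hs.2.2.2 i hi
    have hi2 := Mer.iter (h := f) hs.2.1 i
    simpa only [hi2.order] using h1
  have hset : ∀ k, {z : ℂ | 0 < meroOrder (iteratedDeriv k f) z} =
      {z | 0 < meromorphicOrderAt (iteratedDeriv k f) z} := by
    intro k
    ext z
    simp only [Set.mem_setOf_eq, (h.mer.iter k).order]
  have hi : ∀ m, m ≤ M + 1 → ∀ Km : ℂ → ℂ, IsKm f m Km →
      (∃ c : ℂ, MeroEq Km (fun _ => c)) →
      {z : ℂ | 0 < meroOrder (iteratedDeriv m f) z}.Finite := by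
    rintro m hm K hK ⟨c, hc⟩
    rw [hset]
    exact part_i h hs.2.2.1 hm hK hc
  have hiii : ∀ m, m ≤ M → ∀ Km Km' : ℂ → ℂ, IsKm f m Km → IsKm f (m + 1) Km' →
      (¬ ∃ c : ℂ, MeroEq Km (fun _ => c)) → (¬ ∃ c : ℂ, MeroEq Km' (fun _ => c)) →
      IsRatFn Km → IsRatFn Km' →
      {z : ℂ | 0 < meroOrder (iteratedDeriv (m + 1) f) z}.Finite := by
    intro m hm K K' hK hK' hc hc' hr hr'
    rw [hset]
    exact part_iii h hm hK hK' hc hc' hr hr'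
  refine ⟨hi, ?_, hiii, ?_⟩
  · intro m hm K K' hK hK' hc hc'
    exact part_ii h hm hK hK' hc hc'
  · intro m hm K K' hK hK' hr hr'
    by_cases hc : ∃ c : ℂ, MeroEq K (fun _ => c)
    · exact Or.inl (hi m (by omega) K hK hc)
    by_cases hc' : ∃ c : ℂ, MeroEq K' (fun _ => c)
    · exact Or.inr (hi (m + 1) (by omega) K' hK' hc')
    exact Or.inr (hiii m hm K K' hK hK' hc hc' hr hr')
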